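/- arXiv:1504.05940 — 5 statements merged into one kernel-verified Lean document; each statement's English description precedes it below -/
import Mathlib

section
/- (Asymptotic achievability part of Theorem 3.) Consider a common-message discrete memoryless broadcast channel for which there is a unique input distribution P* simultaneously maximizing I(P, W1) and I(P, W2), with C1 = I(P*, W1) = C2 = I(P*, W2) = C > 0 and dispersions V_k = V(P*, W_k) for k = 1,2. Then for every ε ∈ (0,1) and every δ > 0, log M*_sf(l, ε) ≥ C·l/(1−ε) − √((V1+V2)/(2π(1−ε)))·√l − O(l^{1/4+δ}) as l → ∞. -/
open MeasureTheory ProbabilityTheory Filter ENNReal Real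

noncomputable section

/-- A two-user common-message discrete memoryless broadcast channel with finite
input alphabet `𝓧` and finite output alphabets `𝓨₁`, `𝓨₂`.  At each channel use the
two outputs are conditionally independent given the input, with marginal stochastic
matrices `W1` and `W2`. -/
structure BroadcastChannel (𝓧 𝓨₁ 𝓨₂ : Type) [Fintype 𝓧] [Fintype 𝓨₁] [Fintype 𝓨₂] where
  W1 : 𝓧 → 𝓨₁ → ℝ
  W2 : 𝓧 → 𝓨₂ → ℝ
  W1_nonneg : ∀ x y, 0 ≤ W1 x y
  W2_nonneg : ∀ x y, 0 ≤ W2 x y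
  W1_sum_one : ∀ x, ∑ y, W1 x y = 1
  W2_sum_one : ∀ x, ∑ y, W2 x y = 1

/-- Information density `i_{P,W}(xⁿ; yⁿ) = ∑_i log (W(yᵢ|xᵢ) / PW(yᵢ))`. -/
def infoDensity {𝓧 𝓨 : Type} [Fintype 𝓧] (P : 𝓧 → ℝ) (W : 𝓧 → 𝓨 → ℝ)
    {n : ℕ} (xs : Fin n → 𝓧) (ys : Fin n → 𝓨) : ℝ :=
  ∑ i, Real.log (W (xs i) (ys i) / ∑ x, P x * W x (ys i))

/-- An `(l, M, ε)`-VLSF (variable-length stop-feedback) code for the broadcast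
channel `ch` with common message.  The common randomness `U` takes at most 3 values
(modelled by `Fin 3`); the message `J` is uniform on `{1,…,M}` (modelled by `Fin M`);
the encoder output at time `n+1` is `f n (U, J)`; the channel acts memorylessly and
the two output sequences are conditionally independent given the input sequence;
`τ1`, `τ2` are stopping times with respect to the filtrations generated by `(U, Y₁ⁿ)`
and `(U, Y₂ⁿ)`; the average blocklength satisfies `E[max(τ1,τ2)] ≤ l`; and each
decoder `g k` errs with probability at most `ε`. -/
structure VLSFCode {𝓧 𝓨₁ 𝓨₂ : Type} [Fintype 𝓧] [Fintype 𝓨₁] [Fintype 𝓨₂]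
    (ch : BroadcastChannel 𝓧 𝓨₁ 𝓨₂) (l : ℝ) (M : ℕ) (ε : ℝ) where
  Ω : Type
  mΩ : MeasurableSpace Ω
  μ : @Measure Ω mΩ
  hμ : IsProbabilityMeasure μ
  /-- the common randomness, a random variable taking at most three values -/
  u : Ω → Fin 3
  /-- the message, uniformly distributed on `{1,…,M}` -/
  J : Ω → Fin M
  /-- output sequence at decoder 1 (`Y1seq ω i` is the output at time `i+1`) -/
  Y1seq : Ω → ℕ → 𝓨₁
  /-- output sequence at decoder 2 -/
  Y2seq : Ω → ℕ → 𝓨₂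
  /-- the encoders: the input at time `n+1` is `f n (u, J)` -/
  f : ℕ → Fin 3 → Fin M → 𝓧
  /-- stopping time of decoder 1 -/
  τ1 : Ω → ℕ
  /-- stopping time of decoder 2 -/
  τ2 : Ω → ℕ
  /-- the decoders; `g1 n u0` may depend only on the first `n` outputs -/
  g1 : ℕ → Fin 3 → (ℕ → 𝓨₁) → Fin M
  g2 : ℕ → Fin 3 → (ℕ → 𝓨₂) → Fin M
  J_uniform : ∀ j : Fin M, μ {ω | J ω = j} = (M : ℝ≥0∞)⁻¹
  /-- memoryless broadcast channel: given `(U, J)` (hence the input sequence), the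
  outputs are independent across time and across decoders, with laws `W1`, `W2`. -/
  chan_law : ∀ (u0 : Fin 3) (j : Fin M) (n : ℕ) (y1 : Fin n → 𝓨₁) (y2 : Fin n → 𝓨₂),
    μ {ω | u ω = u0 ∧ J ω = j ∧ (∀ i : Fin n, Y1seq ω i = y1 i) ∧ (∀ i : Fin n, Y2seq ω i = y2 i)}
      = μ {ω | u ω = u0 ∧ J ω = j}
        * ENNReal.ofReal (∏ i : Fin n, ch.W1 (f i u0 j) (y1 i) * ch.W2 (f i u0 j) (y2 i))
  /-- `τ1` is a stopping time w.r.t. the filtration generated by `(U, Y₁ⁿ)` -/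
  τ1_stopping : ∀ (n : ℕ) (ω ω' : Ω), u ω = u ω' → (∀ i < n, Y1seq ω i = Y1seq ω' i) →
      (τ1 ω ≤ n ↔ τ1 ω' ≤ n)
  τ2_stopping : ∀ (n : ℕ) (ω ω' : Ω), u ω = u ω' → (∀ i < n, Y2seq ω i = Y2seq ω' i) →
      (τ2 ω ≤ n ↔ τ2 ω' ≤ n)
  /-- the decoder applied at time `n` only uses the first `n` outputs -/
  g1_adapted : ∀ (n : ℕ) (u0 : Fin 3) (y y' : ℕ → 𝓨₁), (∀ i < n, y i = y' i) →
      g1 n u0 y = g1 n u0 y'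
  g2_adapted : ∀ (n : ℕ) (u0 : Fin 3) (y y' : ℕ → 𝓨₂), (∀ i < n, y i = y' i) →
      g2 n u0 y = g2 n u0 y'
  /-- average blocklength constraint `E[max(τ1, τ2)] ≤ l` -/
  avg_len : ∫⁻ ω, ((max (τ1 ω) (τ2 ω) : ℕ) : ℝ≥0∞) ∂μ ≤ ENNReal.ofReal l
  /-- reliability at decoder 1: `P[J ≠ g1(τ1, U, Y₁^{τ1})] ≤ ε` -/
  err1 : μ {ω | g1 (τ1 ω) (u ω) (Y1seq ω) ≠ J ω} ≤ ENNReal.ofReal ε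
  err2 : μ {ω | g2 (τ2 ω) (u ω) (Y2seq ω) ≠ J ω} ≤ ENNReal.ofReal ε

/-- Mutual information `I(P, W)`: mean of the information density under `P × W`. -/
def mutualInfo {𝓧 𝓨 : Type} [Fintype 𝓧] [Fintype 𝓨] (P : 𝓧 → ℝ) (W : 𝓧 → 𝓨 → ℝ) : ℝ :=
  ∑ x, ∑ y, P x * W x y * Real.log (W x y / ∑ x', P x' * W x' y)

/-- Information variance (dispersion) `V(P, W)`: variance of the information density. -/
def infoVar {𝓧 𝓨 : Type} [Fintype 𝓧] [Fintype 𝓨] (P : 𝓧 → ℝ) (W : 𝓧 → 𝓨 → ℝ) : ℝ :=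
  ∑ x, ∑ y, P x * W x y *
    (Real.log (W x y / ∑ x', P x' * W x' y) - mutualInfo P W) ^ 2

/-- The standard normal density `φ(x) = e^{−x²/2}/√(2π)`. -/
def stdGaussianPDF (x : ℝ) : ℝ := Real.exp (-x ^ 2 / 2) / Real.sqrt (2 * Real.pi)

/-- The standard Gaussian tail function `Q(x) = ∫_x^∞ φ(t) dt`. -/
def gaussQ (x : ℝ) : ℝ := ∫ t in Set.Ioi x, stdGaussianPDF t

/-- The function whose unique root `= 1` defines `Q̃⁻¹(x)` (cf. eq. (8) of the paper). -/
def tildeQFun (ρ1 ρ2 x y : ℝ) : ℝ :=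
  gaussQ (-(ρ1 * y)) * gaussQ (-(ρ2 * y))
    + x * (1 + min (gaussQ (-(ρ1 * y))) (gaussQ (-(ρ2 * y))))

/-- Expectation of `F` under the product of `ι` copies of the weights `p`. -/
def iidE {ι Z : Type} [Fintype ι] [DecidableEq ι] [Fintype Z] (p : Z → ℝ)
    (F : (ι → Z) → ℝ) : ℝ :=
  ∑ z : ι → Z, (∏ i, p (z i)) * F z

section IidExpectation

variable {ι Z : Type} [Fintype ι] [DecidableEq ι] [Fintype Z] {p : Z → ℝ}

lemma iidE_add (F G : (ι → Z) → ℝ) :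
    iidE p (fun z => F z + G z) = iidE p F + iidE p G := by
  simp only [iidE, mul_add, Finset.sum_add_distrib]

lemma iidE_sub (F G : (ι → Z) → ℝ) :
    iidE p (fun z => F z - G z) = iidE p F - iidE p G := by
  simp only [iidE, mul_sub, Finset.sum_sub_distrib]

lemma iidE_const_mul (c : ℝ) (F : (ι → Z) → ℝ) :
    iidE p (fun z => c * F z) = c * iidE p F := by
  simp only [iidE, Finset.mul_sum]
  exact Finset.sum_congr rfl fun _ _ => by ring

lemma iidE_sum {κ : Type} (s : Finset κ) (F : κ → (ι → Z) → ℝ) :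
    iidE p (fun z => ∑ k ∈ s, F k z) = ∑ k ∈ s, iidE p (F k) := by
  simp only [iidE, Finset.mul_sum]
  exact Finset.sum_comm

lemma iidE_mono (hp : ∀ z, 0 ≤ p z) {F G : (ι → Z) → ℝ}
    (h : ∀ z, (∀ i, p (z i) ≠ 0) → F z ≤ G z) : iidE p F ≤ iidE p G := by
  refine Finset.sum_le_sum fun z _ => ?_
  by_cases hz : ∀ i, p (z i) ≠ 0
  · exact mul_le_mul_of_nonneg_left (h z hz) (Finset.prod_nonneg fun i _ => hp _)
  · push Not at hz
    obtain ⟨i, hi⟩ := hz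
    rw [Finset.prod_eq_zero (Finset.mem_univ i) hi, zero_mul, zero_mul]

lemma iidE_nonneg (hp : ∀ z, 0 ≤ p z) {F : (ι → Z) → ℝ} (h : ∀ z, 0 ≤ F z) :
    0 ≤ iidE p F :=
  Finset.sum_nonneg fun z _ => mul_nonneg (Finset.prod_nonneg fun i _ => hp _) (h z)

lemma sum_prod_eq_one (hp1 : ∑ z, p z = 1) : ∑ z : ι → Z, ∏ i, p (z i) = 1 := by
  rw [← Fintype.prod_sum (fun (_ : ι) (z : Z) => p z)]
  simp [hp1]

lemma iidE_const (hp1 : ∑ z, p z = 1) (c : ℝ) : iidE (ι := ι) p (fun _ => c) = c := by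
  rw [iidE, ← Finset.sum_mul, sum_prod_eq_one hp1, one_mul]

/-- Resampling one coordinate does not change the expectation. -/
lemma iidE_resample (hp1 : ∑ z, p z = 1) (i : ι) (F : (ι → Z) → ℝ) :
    iidE p F = iidE p (fun z => ∑ w, p w * F (Function.update z i w)) := by
  have key : ∀ G : (ι → Z) → ℝ, iidE p G = ∑ v : Z, ∑ r : {j // j ≠ i} → Z,
      (p v * ∏ j, p (r j)) * G ((Equiv.funSplitAt i Z).symm (v, r)) := by
    intro G
    rw [iidE, ← (Equiv.funSplitAt i Z).symm.sum_comp, Fintype.sum_prod_type]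
    refine Finset.sum_congr rfl fun v _ => Finset.sum_congr rfl fun r _ => ?_
    congr 1
    rw [Fintype.prod_eq_mul_prod_subtype_ne _ i]
    congr 1
    · simp [Equiv.funSplitAt, Equiv.piSplitAt]
    · refine Finset.prod_congr rfl fun j _ => ?_
      simp [Equiv.funSplitAt, Equiv.piSplitAt, j.2]
  have hup : ∀ v r w, Function.update ((Equiv.funSplitAt i Z).symm (v, r)) i w
      = (Equiv.funSplitAt i Z).symm (w, r) := by
    intro v r w
    funext j
    by_cases hj : j = i
    · subst hj; simp [Equiv.funSplitAt, Equiv.piSplitAt]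
    · simp [Equiv.funSplitAt, Equiv.piSplitAt, hj]
  rw [key, key]
  simp only [hup]
  have : ∀ v : Z, ∑ r : {j // j ≠ i} → Z, (p v * ∏ j, p (r j)) *
        ∑ w, p w * F ((Equiv.funSplitAt i Z).symm (w, r))
      = p v * ∑ w, ∑ r : {j // j ≠ i} → Z, (p w * ∏ j, p (r j)) *
        F ((Equiv.funSplitAt i Z).symm (w, r)) := by
    intro v
    rw [Finset.sum_comm, Finset.mul_sum]
    refine Finset.sum_congr rfl fun r _ => ?_
    rw [Finset.mul_sum, Finset.mul_sum]
    exact Finset.sum_congr rfl fun w _ => by ring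
  simp only [this]
  rw [← Finset.sum_mul, hp1, one_mul]

/-- Marginalisation onto a single coordinate. -/
lemma iidE_eval (hp1 : ∑ z, p z = 1) (i : ι) (F : Z → ℝ) :
    iidE p (fun z : ι → Z => F (z i)) = ∑ w, p w * F w := by
  rw [iidE_resample hp1 i]
  simp only [Function.update_self]
  exact iidE_const hp1 _

/-- A coordinate that `G` ignores is independent of `G`. -/
lemma iidE_mul_coord (hp1 : ∑ z, p z = 1) (i : ι) (G : (ι → Z) → ℝ)
    (hG : ∀ z w, G (Function.update z i w) = G z) (f : Z → ℝ) :
    iidE p (fun z => G z * f (z i)) = iidE p G * ∑ w, p w * f w := by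
  rw [iidE_resample hp1 i]
  simp only [Function.update_self, hG]
  have : ∀ z, ∑ w, p w * (G z * f w) = (∑ w, p w * f w) * G z := by
    intro z
    rw [Finset.sum_mul]
    exact Finset.sum_congr rfl fun w _ => by ring
  simp only [this]
  rw [iidE_const_mul, mul_comm]

lemma iidE_abs_le_sqrt (hp : ∀ z, 0 ≤ p z) (hp1 : ∑ z, p z = 1) (F : (ι → Z) → ℝ) :
    iidE p (fun z => |F z|) ≤ √(iidE p (fun z => F z ^ 2)) := by
  set m := iidE p (fun z => |F z|) with hm
  have h0 : 0 ≤ iidE p (fun z => (|F z| - m) ^ 2) :=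
    iidE_nonneg hp fun z => sq_nonneg _
  have h1 : iidE p (fun z => (|F z| - m) ^ 2) = iidE p (fun z => F z ^ 2) - m ^ 2 := by
    have : ∀ z, (|F z| - m) ^ 2 = F z ^ 2 - (2 * m) * |F z| + m ^ 2 := by
      intro z; rw [sub_sq, sq_abs]; ring
    simp only [this]
    rw [iidE_add, iidE_sub, iidE_const_mul, iidE_const hp1, ← hm]
    ring
  exact Real.le_sqrt_of_sq_le (by linarith)

lemma exists_le_iidE (hp : ∀ z, 0 ≤ p z) (hp1 : ∑ z, p z = 1) (F : (ι → Z) → ℝ) :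
    ∃ z, F z ≤ iidE p F := by
  by_contra! h
  have h1 : iidE p F < iidE p F := by
    have hs : iidE p (fun _ : ι → Z => iidE p F) = iidE p F := iidE_const hp1 _
    conv_lhs => rw [← hs]
    refine Finset.sum_lt_sum (fun z _ => mul_le_mul_of_nonneg_left (h z).le
      (Finset.prod_nonneg fun i _ => hp _)) ?_
    by_contra! h'
    have : ∀ z : ι → Z, ∏ i, p (z i) ≤ 0 := by
      intro z
      by_contra! hz
      exact absurd (h' z (Finset.mem_univ z)) (not_le.2 (mul_lt_mul_of_pos_left (h z) hz))
    have h2 := sum_prod_eq_one (ι := ι) hp1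
    have h3 := Finset.sum_nonpos (s := Finset.univ) fun z _ => this z
    linarith
  exact lt_irrefl _ h1

end IidExpectation

section PredictableTransform

variable {Z : Type} [Fintype Z] {p : Z → ℝ} {K : ℕ}

/-- `h i` depends only on the coordinates before `i`. -/
def IsPredictableSeq (h : Fin K → (Fin K → Z) → ℝ) : Prop :=
  ∀ i j z w, i ≤ j → h i (Function.update z j w) = h i z

lemma iidE_predictable_sum (hp1 : ∑ z, p z = 1) {ξ : Z → ℝ} (hξ : ∑ z, p z * ξ z = 0)
    {h : Fin K → (Fin K → Z) → ℝ} (hh : IsPredictableSeq h) :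
    iidE p (fun z => ∑ i, h i z * ξ (z i)) = 0 := by
  rw [iidE_sum]
  refine Finset.sum_eq_zero fun i _ => ?_
  rw [iidE_mul_coord hp1 i _ (fun z w => hh i i z w le_rfl), hξ, mul_zero]

lemma iidE_predictable_sum_sq (hp1 : ∑ z, p z = 1) {ξ : Z → ℝ} (hξ : ∑ z, p z * ξ z = 0)
    {h : Fin K → (Fin K → Z) → ℝ} (hh : IsPredictableSeq h) :
    iidE p (fun z => (∑ i, h i z * ξ (z i)) ^ 2)
      = (∑ z, p z * ξ z ^ 2) * iidE p (fun z => ∑ i, h i z ^ 2) := by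
  have cross : ∀ i j : Fin K, i < j →
      iidE p (fun z => (h i z * ξ (z i)) * (h j z * ξ (z j))) = 0 := by
    intro i j hij
    have := iidE_mul_coord hp1 j (fun z => h i z * ξ (z i) * h j z)
      (fun z w => by
        simp only [hh i j z w hij.le, hh j j z w le_rfl, Function.update_of_ne hij.ne]) ξ
    rw [hξ, mul_zero] at this
    rw [← this]
    congr 1
    funext z
    ring
  simp only [sq (∑ i, _), Finset.sum_mul_sum]
  rw [iidE_sum, iidE_sum, Finset.mul_sum]
  refine Finset.sum_congr rfl fun i _ => ?_
  rw [iidE_sum, Finset.sum_eq_single i]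
  · have := iidE_mul_coord hp1 i (fun z => h i z ^ 2)
      (fun z w => by simp only [hh i i z w le_rfl]) (fun w => ξ w ^ 2)
    rw [mul_comm, ← this]
    congr 1
    funext z
    ring
  · intro j _ hji
    rcases lt_or_gt_of_ne hji with hlt | hlt
    · rw [← cross j i hlt]
      congr 1
      funext z
      ring
    · exact cross i j hlt
  · simp

end PredictableTransform

section GaussianPotential

lemma continuous_stdGaussianPDF : Continuous stdGaussianPDF := by
  unfold stdGaussianPDF
  fun_prop

lemma stdGaussianPDF_pos (x : ℝ) : 0 < stdGaussianPDF x := by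
  unfold stdGaussianPDF
  positivity

lemma stdGaussianPDF_le_half (x : ℝ) : stdGaussianPDF x ≤ 1 / 2 := by
  unfold stdGaussianPDF
  have h1 : Real.exp (-x ^ 2 / 2) ≤ 1 := Real.exp_le_one_iff.2 (by nlinarith [sq_nonneg x])
  have h2 : (2 : ℝ) ≤ √(2 * π) := Real.le_sqrt_of_sq_le (by nlinarith [Real.pi_gt_three])
  rw [div_le_div_iff₀ (by linarith) (by norm_num)]
  linarith

lemma stdGaussianPDF_neg (x : ℝ) : stdGaussianPDF (-x) = stdGaussianPDF x := by
  simp [stdGaussianPDF]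

lemma hasDerivAt_stdGaussianPDF (x : ℝ) :
    HasDerivAt stdGaussianPDF (-(x * stdGaussianPDF x)) x := by
  have h : HasDerivAt (fun x : ℝ => -x ^ 2 / 2) (-x) x := by
    have := ((hasDerivAt_pow 2 x).neg).div_const 2
    refine this.congr_deriv ?_
    push_cast
    ring
  have := h.exp.div_const (√(2 * π))
  refine this.congr_deriv ?_
  unfold stdGaussianPDF
  ring

lemma abs_mul_stdGaussianPDF_le (x : ℝ) : |x * stdGaussianPDF x| ≤ 1 := by
  have h0 : 0 < √(2 * π) := by positivity
  have h2 : (1 : ℝ) ≤ √(2 * π) := Real.le_sqrt_of_sq_le (by nlinarith [Real.pi_gt_three])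
  have h3 : |x| ≤ Real.exp (x ^ 2 / 2) := by
    have := Real.add_one_le_exp (x ^ 2 / 2)
    nlinarith [sq_nonneg (|x| - 1), sq_abs x]
  rw [abs_mul, abs_of_pos (stdGaussianPDF_pos x)]
  unfold stdGaussianPDF
  have h4 : Real.exp (-x ^ 2 / 2) * Real.exp (x ^ 2 / 2) = 1 := by
    rw [← Real.exp_add]; simp [neg_div]
  have h5 : |x| * Real.exp (-x ^ 2 / 2) ≤ 1 := by
    nlinarith [Real.exp_pos (-x ^ 2 / 2)]
  rw [← mul_div_assoc]
  exact (div_le_one h0).2 (h5.trans h2)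

lemma stdGaussianPDF_lipschitz (x y : ℝ) :
    |stdGaussianPDF x - stdGaussianPDF y| ≤ |x - y| := by
  have := Convex.norm_image_sub_le_of_norm_hasDerivWithin_le (f := stdGaussianPDF)
    (f' := fun x => -(x * stdGaussianPDF x)) (s := Set.univ) (C := 1) (x := y) (y := x)
    (fun x _ => (hasDerivAt_stdGaussianPDF x).hasDerivWithinAt)
    (fun x _ => by simpa using abs_mul_stdGaussianPDF_le x) convex_univ trivial trivial
  simpa using this

/-- `E[sign (z + Z)]` for a standard normal `Z`. -/
def gaussSign (z : ℝ) : ℝ := 2 * ∫ t in (0 : ℝ)..z, stdGaussianPDF t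

/-- `E|z + Z|` for a standard normal `Z`. -/
def gaussAbs (z : ℝ) : ℝ := 2 * stdGaussianPDF z + z * gaussSign z

lemma hasDerivAt_gaussSign (z : ℝ) : HasDerivAt gaussSign (2 * stdGaussianPDF z) z :=
  (intervalIntegral.integral_hasDerivAt_right
    (continuous_stdGaussianPDF.intervalIntegrable _ _)
    (continuous_stdGaussianPDF.stronglyMeasurableAtFilter _ _)
    continuous_stdGaussianPDF.continuousAt).const_mul 2

lemma hasDerivAt_gaussAbs (z : ℝ) : HasDerivAt gaussAbs (gaussSign z) z := by
  have := ((hasDerivAt_stdGaussianPDF z).const_mul 2).add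
    ((hasDerivAt_id z).mul (hasDerivAt_gaussSign z))
  refine this.congr_deriv ?_
  simp only [id]
  ring

lemma gaussSign_neg (z : ℝ) : gaussSign (-z) = -gaussSign z := by
  unfold gaussSign
  have := intervalIntegral.integral_comp_neg (a := 0) (b := z) stdGaussianPDF
  simp only [stdGaussianPDF_neg, neg_zero] at this
  rw [this, intervalIntegral.integral_symm]
  ring

lemma gaussAbs_neg (z : ℝ) : gaussAbs (-z) = gaussAbs z := by
  simp [gaussAbs, gaussSign_neg, stdGaussianPDF_neg]

lemma gaussAbs_zero : gaussAbs 0 = √(2 / π) := by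
  have h : √(2 * π) = √2 * √π := Real.sqrt_mul (by norm_num) _
  simp only [gaussAbs, stdGaussianPDF, zero_mul, add_zero]
  rw [Real.sqrt_div (by norm_num), h]
  have h2 : √2 * √2 = (2 : ℝ) := Real.mul_self_sqrt (by norm_num)
  have : (0 : ℝ) < √π := by positivity
  simp
  field_simp
  nlinarith

lemma monotone_gaussSign : Monotone gaussSign :=
  monotone_of_hasDerivAt_nonneg hasDerivAt_gaussSign
    fun x => by have := stdGaussianPDF_pos x; simp only [Pi.zero_apply]; linarith

lemma tendsto_gaussSign : Tendsto gaussSign atTop (nhds 1) := by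
  have hint : Integrable stdGaussianPDF := by
    have := (integrable_exp_neg_mul_sq (b := 1 / 2) (by norm_num)).div_const (√(2 * π))
    refine this.congr (Eventually.of_forall fun x => ?_)
    simp only [stdGaussianPDF]
    ring_nf
  have h := intervalIntegral_tendsto_integral_Ioi (f := stdGaussianPDF) (μ := volume) 0
    hint.integrableOn tendsto_id
  have hval : ∫ x in Set.Ioi 0, stdGaussianPDF x = 1 / 2 := by
    have h1 := integral_gaussian_Ioi (1 / 2)
    have h2 : ∀ x : ℝ, stdGaussianPDF x = Real.exp (-(1 / 2) * x ^ 2) / √(2 * π) := by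
      intro x; simp only [stdGaussianPDF]; ring_nf
    simp only [h2]
    rw [integral_div, h1]
    have : √(π / (1 / 2)) = √(2 * π) := by congr 1; ring
    rw [this]
    have : 0 < √(2 * π) := by positivity
    field_simp
  rw [hval] at h
  have := h.const_mul 2
  rw [show (2 : ℝ) * (1 / 2) = 1 by norm_num] at this
  exact this

lemma gaussAbs_tangent_le (z w : ℝ) :
    gaussAbs z + gaussSign z * (w - z) ≤ gaussAbs w := by
  have hc : ConvexOn ℝ Set.univ gaussAbs := by
    refine Monotone.convexOn_univ_of_deriv
      (fun x => (hasDerivAt_gaussAbs x).differentiableAt) ?_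
    have : deriv gaussAbs = gaussSign := funext fun x => (hasDerivAt_gaussAbs x).deriv
    rw [this]
    exact monotone_gaussSign
  rcases lt_trichotomy z w with h | h | h
  · have := hc.le_slope_of_hasDerivAt trivial trivial h (hasDerivAt_gaussAbs z)
    rw [slope_def_field, le_div_iff₀ (by linarith)] at this
    linarith
  · simp [h]
  · have := hc.slope_le_of_hasDerivAt trivial trivial h (hasDerivAt_gaussAbs z)
    rw [slope_def_field, div_le_iff₀ (by linarith)] at this
    linarith

lemma le_gaussAbs (z : ℝ) : z ≤ gaussAbs z := by
  have h1 : ∀ w, z * gaussSign w ≤ gaussAbs z := by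
    intro w
    have := gaussAbs_tangent_le w z
    have h2 := stdGaussianPDF_pos w
    simp only [gaussAbs] at this ⊢
    nlinarith
  have := le_of_tendsto (tendsto_gaussSign.const_mul z) (Eventually.of_forall h1)
  simpa using this

lemma abs_le_gaussAbs (z : ℝ) : |z| ≤ gaussAbs z :=
  abs_le'.2 ⟨le_gaussAbs z, gaussAbs_neg z ▸ le_gaussAbs (-z)⟩

lemma gaussAbs_taylor_of_nonneg (z : ℝ) {t : ℝ} (ht : 0 ≤ t) :
    gaussAbs (z + t) ≤ gaussAbs z + gaussSign z * t + stdGaussianPDF z * t ^ 2 + t ^ 3 := by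
  have hshift : ∀ s : ℝ, HasDerivAt (fun s => z + s) 1 s := fun s =>
    (hasDerivAt_id s).const_add z
  have h1 : ∀ s, 0 ≤ s → gaussSign (z + s) ≤ gaussSign z + 2 * stdGaussianPDF z * s + s ^ 2 := by
    intro s hs
    have hd : ∀ s, HasDerivAt
        (fun s => gaussSign z + 2 * stdGaussianPDF z * s + s ^ 2 - gaussSign (z + s))
        (2 * stdGaussianPDF z + 2 * s - 2 * stdGaussianPDF (z + s)) s := by
      intro s
      have := ((((hasDerivAt_id s).const_mul (2 * stdGaussianPDF z)).const_add
        (gaussSign z)).add (hasDerivAt_pow 2 s)).sub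
        ((hasDerivAt_gaussSign (z + s)).comp s (hshift s))
      refine this.congr_deriv ?_
      push_cast
      ring
    have hm : MonotoneOn
        (fun s => gaussSign z + 2 * stdGaussianPDF z * s + s ^ 2 - gaussSign (z + s))
        (Set.Ici 0) := by
      refine monotoneOn_of_deriv_nonneg (convex_Ici 0)
        (fun s _ => (hd s).continuousAt.continuousWithinAt)
        (fun s _ => (hd s).differentiableAt.differentiableWithinAt) fun s hs => ?_
      rw [interior_Ici] at hs
      rw [(hd s).deriv]
      have := abs_le.1 (stdGaussianPDF_lipschitz (z + s) z)
      have h3 : |z + s - z| = s := by rw [add_sub_cancel_left, abs_of_pos hs]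
      rw [h3] at this
      linarith [this.2]
    have := hm (Set.mem_Ici.2 le_rfl) (Set.mem_Ici.2 hs) hs
    simp at this
    linarith
  have hd : ∀ s, HasDerivAt
      (fun s => gaussAbs z + gaussSign z * s + stdGaussianPDF z * s ^ 2 + s ^ 3 - gaussAbs (z + s))
      (gaussSign z + 2 * stdGaussianPDF z * s + 3 * s ^ 2 - gaussSign (z + s)) s := by
    intro s
    have := (((((hasDerivAt_id s).const_mul (gaussSign z)).const_add
      (gaussAbs z)).add ((hasDerivAt_pow 2 s).const_mul (stdGaussianPDF z))).add
      (hasDerivAt_pow 3 s)).sub ((hasDerivAt_gaussAbs (z + s)).comp s (hshift s))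
    refine this.congr_deriv ?_
    push_cast
    ring
  have hm : MonotoneOn
      (fun s => gaussAbs z + gaussSign z * s + stdGaussianPDF z * s ^ 2 + s ^ 3 - gaussAbs (z + s))
      (Set.Ici 0) := by
    refine monotoneOn_of_deriv_nonneg (convex_Ici 0)
      (fun s _ => (hd s).continuousAt.continuousWithinAt)
      (fun s _ => (hd s).differentiableAt.differentiableWithinAt) fun s hs => ?_
    rw [interior_Ici] at hs
    rw [(hd s).deriv]
    have := h1 s (le_of_lt hs)
    nlinarith [sq_nonneg s]
  have := hm (Set.mem_Ici.2 le_rfl) (Set.mem_Ici.2 ht) ht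
  simp at this
  linarith

lemma gaussAbs_taylor (z t : ℝ) :
    gaussAbs (z + t)
      ≤ gaussAbs z + gaussSign z * t + stdGaussianPDF z * t ^ 2 + |t| ^ 3 := by
  rcases le_total 0 t with h | h
  · rw [abs_of_nonneg h]
    exact gaussAbs_taylor_of_nonneg z h
  · have := gaussAbs_taylor_of_nonneg (-z) (neg_nonneg.2 h)
    rw [← neg_add, gaussAbs_neg, gaussAbs_neg, gaussSign_neg, stdGaussianPDF_neg] at this
    rw [abs_of_nonpos h]
    linarith

/-- `E|x + √s Z|` for a standard normal `Z`. -/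
def heatAbs (s x : ℝ) : ℝ := √s * gaussAbs (x / √s)

lemma abs_le_heatAbs {s : ℝ} (hs : 0 < s) (x : ℝ) : |x| ≤ heatAbs s x := by
  have h0 : 0 < √s := Real.sqrt_pos.2 hs
  have := mul_le_mul_of_nonneg_left (abs_le_gaussAbs (x / √s)) h0.le
  rw [abs_div, abs_of_pos h0, mul_div_cancel₀ _ h0.ne'] at this
  exact this

lemma heatAbs_add_time {s v : ℝ} (hs : 0 < s) (hv : 0 ≤ v) (x : ℝ) :
    heatAbs s x + stdGaussianPDF (x / √s) * (v / √s)
      ≤ heatAbs (s + v) x + v ^ 2 / (s * √s) := by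
  have h0 : 0 < √s := Real.sqrt_pos.2 hs
  have h1 : 0 < √(s + v) := Real.sqrt_pos.2 (by linarith)
  have e0 : √s ^ 2 = s := Real.sq_sqrt hs.le
  have e1 : √(s + v) ^ 2 = s + v := Real.sq_sqrt (by linarith)
  have hle : √s ≤ √(s + v) := Real.sqrt_le_sqrt (by linarith)
  set r := √s
  set r' := √(s + v)
  set z := x / r with hz
  have htan := mul_le_mul_of_nonneg_left (gaussAbs_tangent_le z (x / r')) h1.le
  have hx : x = r * z := by rw [hz]; field_simp
  have hlow : heatAbs s x + 2 * stdGaussianPDF z * (r' - r) ≤ heatAbs (s + v) x := by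
    have : r' * (gaussAbs z + gaussSign z * (x / r' - z))
        = r * gaussAbs z + 2 * stdGaussianPDF z * (r' - r) := by
      have h3 : r' * (x / r' - z) = r * z - r' * z := by
        rw [mul_sub, mul_div_cancel₀ _ h1.ne', hx]
      have : r' * (gaussAbs z + gaussSign z * (x / r' - z))
        = r' * gaussAbs z + gaussSign z * (r' * (x / r' - z)) := by ring
      rw [this, h3]
      simp only [gaussAbs]
      ring
    unfold heatAbs
    rw [← this]
    exact htan
  have hv' : v = (r' - r) * (r' + r) := by nlinarith
  have hgap : v / r - 2 * (r' - r) ≤ v ^ 2 / (s * r) := by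
    have e3 : v / r - 2 * (r' - r) = (r' - r) ^ 2 / r := by
      rw [eq_div_iff h0.ne', sub_mul, div_mul_cancel₀ _ h0.ne']
      rw [hv']; ring
    rw [e3, ← div_div]
    refine div_le_div_of_nonneg_right ?_ h0.le
    rw [le_div_iff₀ hs, hv', ← e0]
    have : 0 ≤ r' - r := by linarith
    have h5 : r ^ 2 ≤ (r' + r) ^ 2 := by nlinarith
    calc (r' - r) ^ 2 * r ^ 2 ≤ (r' - r) ^ 2 * (r' + r) ^ 2 :=
          mul_le_mul_of_nonneg_left h5 (sq_nonneg _)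
      _ = _ := by ring
  have hφ := stdGaussianPDF_le_half z
  have hφ0 := stdGaussianPDF_pos z
  have hq : 0 ≤ v ^ 2 / (s * r) := by positivity
  nlinarith

/-- One step of the Lindeberg replacement argument for the absolute value. -/
lemma sum_heatAbs_step {Z : Type} [Fintype Z] {p : Z → ℝ} (hp : ∀ z, 0 ≤ p z)
    (hp1 : ∑ z, p z = 1) {ξ : Z → ℝ} {B v : ℝ} (hB : ∀ z, |ξ z| ≤ B)
    (hξ : ∑ z, p z * ξ z = 0) (hv : ∑ z, p z * ξ z ^ 2 = v) {s : ℝ} (hs : 0 < s) (x : ℝ) :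
    ∑ z, p z * heatAbs s (x + ξ z)
      ≤ heatAbs (s + v) x + (v ^ 2 / (s * √s) + B * v / s) := by
  have h0 : 0 < √s := Real.sqrt_pos.2 hs
  have e0 : √s ^ 2 = s := Real.sq_sqrt hs.le
  have hv0 : 0 ≤ v := hv ▸ Finset.sum_nonneg fun z _ => mul_nonneg (hp z) (sq_nonneg _)
  have hpt : ∀ z, heatAbs s (x + ξ z) ≤ heatAbs s x + gaussSign (x / √s) * ξ z
      + (stdGaussianPDF (x / √s) / √s + B / s) * ξ z ^ 2 := by
    intro z
    have h1 := mul_le_mul_of_nonneg_left (gaussAbs_taylor (x / √s) (ξ z / √s)) h0.le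
    rw [← add_div] at h1
    have h2 : √s * |ξ z / √s| ^ 3 ≤ B / s * ξ z ^ 2 := by
      rw [abs_div, abs_of_pos h0, div_pow]
      have : √s * (|ξ z| ^ 3 / √s ^ 3) = |ξ z| / s * ξ z ^ 2 := by
        rw [← sq_abs (ξ z)]
        nth_rw 3 [← e0]
        field_simp
      rw [this]
      exact mul_le_mul_of_nonneg_right (div_le_div_of_nonneg_right (hB z) hs.le) (sq_nonneg _)
    have h3 : √s * (gaussSign (x / √s) * (ξ z / √s)) = gaussSign (x / √s) * ξ z := by
      field_simp
    have h4 : √s * (stdGaussianPDF (x / √s) * (ξ z / √s) ^ 2)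
        = stdGaussianPDF (x / √s) / √s * ξ z ^ 2 := by
      field_simp
    unfold heatAbs
    calc _ ≤ _ := h1
      _ = √s * gaussAbs (x / √s) + √s * (gaussSign (x / √s) * (ξ z / √s))
          + √s * (stdGaussianPDF (x / √s) * (ξ z / √s) ^ 2) + √s * |ξ z / √s| ^ 3 := by ring
      _ ≤ _ := by rw [h3, h4]; linarith
  have hsum : ∑ z, p z * heatAbs s (x + ξ z) ≤ heatAbs s x
      + (stdGaussianPDF (x / √s) / √s + B / s) * v := by
    calc _ ≤ ∑ z, p z * (heatAbs s x + gaussSign (x / √s) * ξ z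
      + (stdGaussianPDF (x / √s) / √s + B / s) * ξ z ^ 2) :=
          Finset.sum_le_sum fun z _ => mul_le_mul_of_nonneg_left (hpt z) (hp z)
      _ = heatAbs s x * ∑ z, p z + gaussSign (x / √s) * ∑ z, p z * ξ z
          + (stdGaussianPDF (x / √s) / √s + B / s) * ∑ z, p z * ξ z ^ 2 := by
          simp only [Finset.mul_sum, ← Finset.sum_add_distrib]
          exact Finset.sum_congr rfl fun z _ => by ring
      _ = _ := by rw [hp1, hξ, hv]; ring
  have := heatAbs_add_time hs hv0 x
  have e5 : (stdGaussianPDF (x / √s) / √s + B / s) * v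
      = stdGaussianPDF (x / √s) * (v / √s) + B * v / s := by ring
  linarith

end GaussianPotential

section Walk

/-- The first time `n` with `Q n`, truncated at the horizon `K`. -/
def hitTime (K : ℕ) (Q : ℕ → Prop) : ℕ := sInf {n | n = K ∨ Q n}

lemma hitTime_spec (K : ℕ) (Q : ℕ → Prop) : hitTime K Q = K ∨ Q (hitTime K Q) :=
  Nat.sInf_mem (s := {n | n = K ∨ Q n}) ⟨K, Or.inl rfl⟩

lemma hitTime_le (K : ℕ) (Q : ℕ → Prop) : hitTime K Q ≤ K := Nat.sInf_le (Or.inl rfl)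

lemma hitTime_le_of {K : ℕ} {Q : ℕ → Prop} {n : ℕ} (h : Q n) : hitTime K Q ≤ n :=
  Nat.sInf_le (Or.inr h)

lemma not_of_lt_hitTime {K : ℕ} {Q : ℕ → Prop} {n : ℕ} (h : n < hitTime K Q) : ¬ Q n :=
  fun hq => absurd (hitTime_le_of hq) (not_le.2 h)

lemma hitTime_le_iff {K : ℕ} {Q : ℕ → Prop} {n : ℕ} :
    hitTime K Q ≤ n ↔ K ≤ n ∨ ∃ m ≤ n, Q m := by
  constructor
  · intro h
    rcases hitTime_spec K Q with h1 | h1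
    · exact Or.inl (h1 ▸ h)
    · exact Or.inr ⟨_, h, h1⟩
  · rintro (h | ⟨m, hm, hq⟩)
    · exact (hitTime_le K Q).trans h
    · exact (hitTime_le_of hq).trans hm

lemma hitTime_anti {K : ℕ} {Q Q' : ℕ → Prop} (h : ∀ n, Q n → Q' n) :
    hitTime K Q' ≤ hitTime K Q := by
  rcases hitTime_spec K Q with h1 | h1
  · exact (hitTime_le K Q').trans h1.ge
  · exact hitTime_le_of (h _ h1)

variable {Z : Type} {K : ℕ}

/-- The partial sum of `a (z i)` over the coordinates `i < n`. -/
def walk (a : Z → ℝ) (z : Fin K → Z) (n : ℕ) : ℝ :=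
  ∑ i : Fin K, if i.val < n then a (z i) else 0

lemma walk_zero (a : Z → ℝ) (z : Fin K → Z) : walk a z 0 = 0 := by simp [walk]

lemma walk_succ (a : Z → ℝ) (z : Fin K → Z) (i : Fin K) :
    walk a z (i.val + 1) = walk a z i.val + a (z i) := by
  have : walk a z (i.val + 1) - walk a z i.val = a (z i) := by
    simp only [walk, ← Finset.sum_sub_distrib]
    rw [Finset.sum_eq_single i]
    · simp
    · intro j _ hj
      have : j.val ≠ i.val := fun h => hj (Fin.ext h)
      by_cases h : j.val < i.val
      · simp [h, Nat.lt_succ_of_lt h]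
      · have : ¬ j.val < i.val + 1 := by omega
        simp [h, this]
    · simp
  linarith

lemma walk_update (a : Z → ℝ) (z : Fin K → Z) {n : ℕ} {j : Fin K} (h : n ≤ j.val) (w : Z) :
    walk a (Function.update z j w) n = walk a z n := by
  refine Finset.sum_congr rfl fun i _ => ?_
  by_cases hi : i.val < n
  · have : i ≠ j := fun e => by subst e; omega
    rw [Function.update_of_ne this]
  · simp [hi]

/-- First time both walks have reached `γ`, truncated at the horizon `K`. -/
def jointHit (a b : Z → ℝ) (γ : ℝ) (z : Fin K → Z) : ℕ :=
  hitTime K (fun n => γ ≤ walk a z n ∧ γ ≤ walk b z n)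

lemma lt_jointHit_update (a b : Z → ℝ) (γ : ℝ) {i j : Fin K} (hij : i ≤ j) (z : Fin K → Z)
    (w : Z) : i.val < jointHit a b γ (Function.update z j w) ↔ i.val < jointHit a b γ z := by
  simp only [jointHit, ← not_le, hitTime_le_iff]
  have hij' : i.val ≤ j.val := hij
  have : (∃ m ≤ i.val, γ ≤ walk a (Function.update z j w) m ∧ γ ≤ walk b (Function.update z j w) m)
      ↔ ∃ m ≤ i.val, γ ≤ walk a z m ∧ γ ≤ walk b z m := by
    refine exists_congr fun m => and_congr_right fun hm => ?_
    rw [walk_update a z (hm.trans hij'), walk_update b z (hm.trans hij')]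
  rw [this]

lemma one_add_log_le {x : ℝ} (hx : 0 < x) : 1 + Real.log x ≤ 4 * √√x := by
  have h := Real.log_le_sub_one_of_pos (x := √√x) (by positivity)
  rw [Real.log_sqrt (by positivity), Real.log_sqrt hx.le] at h
  linarith

variable [Fintype Z] {p : Z → ℝ}

/-- Mean absolute value of a centred walk, with a remainder of smaller order. -/
lemma iidE_abs_walk_le (hp : ∀ z, 0 ≤ p z) (hp1 : ∑ z, p z = 1) {ξ : Z → ℝ} {B v : ℝ}
    (hB0 : 0 ≤ B) (hB : ∀ z, |ξ z| ≤ B) (hξ : ∑ z, p z * ξ z = 0)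
    (hv : ∑ z, p z * ξ z ^ 2 = v) {N : ℕ} (hN : N ≤ K) :
    iidE p (fun z : Fin K → Z => |walk ξ z N|)
      ≤ √(v * (N + 1)) * √(2 / π) + (√v + B) * (4 * √√N) := by
  have hv0 : 0 ≤ v := hv ▸ Finset.sum_nonneg fun z _ => mul_nonneg (hp z) (sq_nonneg _)
  rcases hv0.eq_or_lt with h0 | hvpos
  · have h1 := iidE_abs_le_sqrt hp hp1 (fun z : Fin K → Z => walk ξ z N)
    have h2 : iidE p (fun z : Fin K → Z => walk ξ z N ^ 2) = 0 := by
      have := iidE_predictable_sum_sq hp1 hξ (h := fun (i : Fin K) _ => if i.val < N then 1 else 0)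
        (fun _ _ _ _ _ => rfl)
      simp only [ite_mul, one_mul, zero_mul] at this
      rw [hv, ← h0, zero_mul] at this
      exact this
    rw [h2, Real.sqrt_zero] at h1
    refine h1.trans ?_
    positivity
  have hstep : ∀ k ≤ N, iidE p (fun z : Fin K → Z => heatAbs v (walk ξ z N))
      ≤ iidE p (fun z : Fin K → Z => heatAbs (v * (k + 1)) (walk ξ z (N - k)))
        + (√v + B) * ∑ m ∈ Finset.range k, ((m : ℝ) + 1)⁻¹ := by
    intro k
    induction k with
    | zero => intro _; simp
    | succ k ih =>
      intro hk
      refine (ih (by omega)).trans ?_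
      set i : Fin K := ⟨N - (k + 1), by omega⟩ with hi
      have hik : N - k = i.val + 1 := by simp only [hi]; omega
      have hs : 0 < v * ((k : ℝ) + 1) := by positivity
      have hone : iidE p (fun z : Fin K → Z => heatAbs (v * (k + 1)) (walk ξ z (N - k)))
          ≤ iidE p (fun z : Fin K → Z => heatAbs (v * (k + 1) + v) (walk ξ z i.val)
            + (v ^ 2 / (v * (k + 1) * √(v * (k + 1))) + B * v / (v * (k + 1)))) := by
        rw [iidE_resample hp1 i]
        refine iidE_mono hp fun z _ => ?_
        have := sum_heatAbs_step hp hp1 hB hξ hv hs (walk ξ z i.val)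
        simpa only [hik, walk_succ, walk_update ξ z le_rfl, Function.update_self] using this
      rw [iidE_add, iidE_const hp1] at hone
      have herr : v ^ 2 / (v * ((k : ℝ) + 1) * √(v * (k + 1))) + B * v / (v * (k + 1))
          ≤ (√v + B) * ((k : ℝ) + 1)⁻¹ := by
        have hsv : 0 < √v := Real.sqrt_pos.2 hvpos
        have e1 : B * v / (v * ((k : ℝ) + 1)) = B * ((k : ℝ) + 1)⁻¹ := by field_simp
        have e2 : v ^ 2 / (v * ((k : ℝ) + 1) * √(v * (k + 1)))
            ≤ √v * ((k : ℝ) + 1)⁻¹ := by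
          have h3 : √v ≤ √(v * (k + 1)) := by
            refine Real.sqrt_le_sqrt ?_
            nlinarith [(Nat.cast_nonneg k : (0 : ℝ) ≤ k)]
          have h4 : v ^ 2 / (v * ((k : ℝ) + 1) * √(v * (k + 1)))
              = v * ((k : ℝ) + 1)⁻¹ / √(v * (k + 1)) := by
            field_simp
          rw [h4, div_le_iff₀ (hsv.trans_le h3)]
          have h5 : v = √v * √v := (Real.mul_self_sqrt hv0).symm
          have h6 : √v * √v ≤ √v * √(v * (k + 1)) := mul_le_mul_of_nonneg_left h3 hsv.le
          have h7 : 0 ≤ ((k : ℝ) + 1)⁻¹ := by positivity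
          nlinarith
        rw [e1]
        linarith
      rw [Finset.sum_range_succ, mul_add (√v + B)]
      have e3 : v * ((k : ℝ) + 1) + v = v * (((k + 1 : ℕ) : ℝ) + 1) := by push_cast; ring
      rw [e3] at hone
      simp only [hi] at hone
      linarith
  have h1 : iidE p (fun z : Fin K → Z => |walk ξ z N|)
      ≤ iidE p (fun z : Fin K → Z => heatAbs v (walk ξ z N)) :=
    iidE_mono hp fun z _ => abs_le_heatAbs hvpos _
  have h2 := hstep N le_rfl
  simp only [Nat.sub_self, walk_zero] at h2
  rw [iidE_const hp1] at h2
  have h3 : heatAbs (v * ((N : ℝ) + 1)) 0 = √(v * (N + 1)) * √(2 / π) := by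
    simp [heatAbs, gaussAbs_zero]
  have h4 : ∑ m ∈ Finset.range N, ((m : ℝ) + 1)⁻¹ ≤ 4 * √√N := by
    rcases Nat.eq_zero_or_pos N with h | h
    · subst h; simp
    · have h5 := harmonic_le_one_add_log N
      have h6 : ((harmonic N : ℚ) : ℝ) = ∑ m ∈ Finset.range N, ((m : ℝ) + 1)⁻¹ := by
        simp [harmonic]
      rw [← h6]
      exact h5.trans (one_add_log_le (Nat.cast_pos.2 h))
  have h5 : 0 ≤ √v + B := by positivity
  have := mul_le_mul_of_nonneg_left h4 h5
  rw [h3] at h2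
  linarith

end Walk

section ExpectedHittingTime

variable {Z : Type} {K : ℕ}

lemma walk_eq_sum_indicator (a : Z → ℝ) (z : Fin K → Z) (n : ℕ) :
    walk a z n = ∑ i : Fin K, (if i.val < n then (1 : ℝ) else 0) * a (z i) := by
  simp [walk]

lemma sum_indicator_lt {n : ℕ} (hn : n ≤ K) :
    ∑ i : Fin K, (if i.val < n then (1 : ℝ) else 0) = n := by
  rw [Fin.sum_univ_eq_sum_range (fun i => if i < n then (1 : ℝ) else 0) K,
    ← Finset.sum_filter, Finset.sum_const, nsmul_eq_mul, mul_one]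
  congr 1
  have : (Finset.range K).filter (fun i => i < n) = Finset.range n := by
    ext i; simp only [Finset.mem_filter, Finset.mem_range]; omega
  rw [this, Finset.card_range]

lemma sum_indicator_sub_sq {n m : ℕ} (hn : n ≤ K) (hm : m ≤ K) :
    ∑ i : Fin K, ((if i.val < n then (1 : ℝ) else 0) - (if i.val < m then (1 : ℝ) else 0)) ^ 2
      = |(n : ℝ) - m| := by
  wlog h : m ≤ n generalizing n m
  · rw [abs_sub_comm, ← this hm hn (by omega)]
    exact Finset.sum_congr rfl fun i _ => by ring
  have : ∀ i : Fin K,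
      ((if i.val < n then (1 : ℝ) else 0) - (if i.val < m then (1 : ℝ) else 0)) ^ 2
      = (if i.val < n then (1 : ℝ) else 0) - (if i.val < m then (1 : ℝ) else 0) := by
    intro i
    by_cases h1 : i.val < m
    · have : i.val < n := by omega
      simp [h1, this]
    · by_cases h2 : i.val < n <;> simp [h1, h2]
  simp only [this, Finset.sum_sub_distrib, sum_indicator_lt hn, sum_indicator_lt hm]
  rw [abs_of_nonneg]
  have : (m : ℝ) ≤ n := Nat.cast_le.2 h
  linarith

lemma walk_sub (a b : Z → ℝ) (z : Fin K → Z) (n : ℕ) :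
    walk (fun z => a z - b z) z n = walk a z n - walk b z n := by
  simp only [walk, ← Finset.sum_sub_distrib]
  exact Finset.sum_congr rfl fun i _ => by split_ifs <;> simp

lemma min_walk_jointHit_le {a b : Z → ℝ} {B γ : ℝ} (hB : 0 ≤ B) (ha : ∀ z, a z ≤ B)
    (hb : ∀ z, b z ≤ B) (hγ : 0 ≤ γ) (z : Fin K → Z) :
    min (walk a z (jointHit a b γ z)) (walk b z (jointHit a b γ z)) ≤ γ + B := by
  rcases h : jointHit a b γ z with _ | n
  · simp only [walk_zero, min_self]; linarith
  · have hn : n < jointHit a b γ z := by omega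
    have hK : n < K := hn.trans_le (hitTime_le _ _)
    have h1 := not_of_lt_hitTime hn
    rw [not_and_or, not_le, not_le] at h1
    have ea := walk_succ a z ⟨n, hK⟩
    have eb := walk_succ b z ⟨n, hK⟩
    simp only at ea eb
    rcases h1 with h1 | h1
    · exact (min_le_left _ _).trans (by rw [ea]; linarith [ha (z ⟨n, hK⟩)])
    · exact (min_le_right _ _).trans (by rw [eb]; linarith [hb (z ⟨n, hK⟩)])

lemma le_walk_of_jointHit_lt {a b : Z → ℝ} {γ : ℝ} {z : Fin K → Z}
    (h : jointHit a b γ z < K) :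
    γ ≤ walk a z (jointHit a b γ z) ∧ γ ≤ walk b z (jointHit a b γ z) := by
  rcases hitTime_spec K (fun n => γ ≤ walk a z n ∧ γ ≤ walk b z n) with h1 | h1
  · exact absurd h1 h.ne
  · exact h1

variable [Fintype Z] {p : Z → ℝ}

/-- Wald's first identity for the joint hitting time. -/
lemma iidE_walk_jointHit (hp1 : ∑ z, p z = 1) (a b : Z → ℝ) (γ : ℝ) {ξ : Z → ℝ}
    (hξ : ∑ z, p z * ξ z = 0) :
    iidE p (fun z : Fin K → Z => walk ξ z (jointHit a b γ z)) = 0 := by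
  simp only [walk_eq_sum_indicator]
  refine iidE_predictable_sum hp1 hξ
    (h := fun i z => if i.val < jointHit a b γ z then (1 : ℝ) else 0) fun i j z w hij => ?_
  simp only [lt_jointHit_update a b γ hij]

/-- Wald's second identity for the increment of a walk between a deterministic time and the
joint hitting time. -/
lemma iidE_walk_jointHit_sub_sq (hp1 : ∑ z, p z = 1) (a b : Z → ℝ) (γ : ℝ) {ξ : Z → ℝ}
    (hξ : ∑ z, p z * ξ z = 0) {N : ℕ} (hN : N ≤ K) :
    iidE p (fun z : Fin K → Z => (walk ξ z (jointHit a b γ z) - walk ξ z N) ^ 2)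
      = (∑ z, p z * ξ z ^ 2) * iidE p (fun z : Fin K → Z => |(jointHit a b γ z : ℝ) - N|) := by
  have := iidE_predictable_sum_sq hp1 hξ (K := K)
    (h := fun i z => (if i.val < jointHit a b γ z then (1 : ℝ) else 0)
      - (if i.val < N then (1 : ℝ) else 0)) fun i j z w hij => by
        simp only [lt_jointHit_update a b γ hij]
  simp only [sub_mul, Finset.sum_sub_distrib, ← walk_eq_sum_indicator] at this
  rw [this]
  congr 2
  funext z
  exact sum_indicator_sub_sq (hitTime_le _ _) hN

lemma sqrt_add_one_le {x : ℝ} (hx : 0 ≤ x) : √(x + 1) ≤ √x + 1 := by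
  refine Real.sqrt_le_iff.2 ⟨by positivity, ?_⟩
  nlinarith [Real.sqrt_nonneg x, Real.sq_sqrt hx]

lemma sqrt_mul_le_amgm {C v t : ℝ} (hC : 0 < C) (hv : 0 ≤ v) (ht : 0 ≤ t) :
    √(v * t) ≤ C * t + v / (4 * C) := by
  refine Real.sqrt_le_iff.2 ⟨by positivity, ?_⟩
  have : v * t = 4 * (C * t) * (v / (4 * C)) := by field_simp
  rw [this]
  nlinarith [sq_nonneg (C * t - v / (4 * C))]

/-- Solving the chain of inequalities relating the expected stopping time `t`, its mean deviation
`r` from `N`, the stopped discrepancy `D` and the unstopped discrepancy `D₀`. -/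
lemma stopping_time_bound_of_chain {C B v w : ℝ} (hC : 0 < C) (hB : 0 ≤ B) (hv : 0 ≤ v)
    (hw : 0 ≤ w) : ∃ c : ℝ, 0 ≤ c ∧ ∀ γ t r D D₀ N : ℝ, 1 ≤ γ → 0 ≤ t → 0 ≤ r → 0 ≤ N →
      N ≤ γ / C → C * t ≤ γ + B + D / 2 → D ≤ √(v * t) →
      C * r ≤ √(w * t) + B + D / 2 + C → D ≤ D₀ + √(v * r) →
      D₀ ≤ √(v * (N + 1)) * √(2 / π) + (√v + B) * (4 * √√N) →
      t ≤ γ / C + √v / (2 * C) * √(2 * γ / (π * C)) + c * √√γ := by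
  set c₁ := 2 / C * (1 + B + v / (8 * C)) with hc₁
  have hc₁0 : 0 ≤ c₁ := by positivity
  set c₃ := (√(w * c₁) + B + √(v * c₁) / 2 + C) / C with hc₃
  have hc₃0 : 0 ≤ c₃ := by positivity
  set c₆ := √v + 4 * (√v + B) * √√(1 / C) + √(v * c₃) with hc₆
  have hc₆0 : 0 ≤ c₆ := by positivity
  refine ⟨B / C + c₆ / (2 * C), by positivity, ?_⟩
  intro γ t r D D₀ N hγ ht hr hN hNγ h1 h2 h3 h4 h5
  have hγ0 : 0 < γ := by linarith
  have hs1 : 1 ≤ √γ := Real.one_le_sqrt.2 hγ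
  have hs2 : 1 ≤ √√γ := Real.one_le_sqrt.2 hs1
  have hamgm := sqrt_mul_le_amgm hC hv ht
  have htc : t ≤ c₁ * γ := by
    have e1 : v / (4 * C) / 2 = v / (8 * C) := by field_simp; ring
    have h6 : C * t ≤ 2 * (γ + B + v / (8 * C)) := by linarith
    have h7 : 0 ≤ v / (8 * C) := by positivity
    have h8 : γ + B + v / (8 * C) ≤ (1 + B + v / (8 * C)) * γ := by
      have := mul_le_mul_of_nonneg_left hγ (by positivity : 0 ≤ B + v / (8 * C))
      linarith
    have h9 : C * t ≤ C * (c₁ * γ) := by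
      have : C * (c₁ * γ) = 2 * ((1 + B + v / (8 * C)) * γ) := by rw [hc₁]; field_simp
      linarith
    exact le_of_mul_le_mul_left h9 hC
  have hsq : ∀ u : ℝ, 0 ≤ u → √(u * t) ≤ √(u * c₁) * √γ := by
    intro u hu
    rw [← Real.sqrt_mul (by positivity), mul_assoc]
    exact Real.sqrt_le_sqrt (mul_le_mul_of_nonneg_left htc hu)
  have hD : D ≤ √(v * c₁) * √γ := h2.trans (hsq v hv)
  have hr3 : r ≤ c₃ * √γ := by
    have h6 : C * (c₃ * √γ) = (√(w * c₁) + B + √(v * c₁) / 2 + C) * √γ := by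
      rw [hc₃]; field_simp
    have h7 := hsq w hw
    have h8 : C * r ≤ C * (c₃ * √γ) := by
      have h9 := mul_le_mul_of_nonneg_left hs1 (by positivity : 0 ≤ B + C)
      rw [h6]
      linarith
    exact le_of_mul_le_mul_left h8 hC
  have hvr : √(v * r) ≤ √(v * c₃) * √√γ := by
    rw [← Real.sqrt_mul (by positivity), mul_assoc]
    exact Real.sqrt_le_sqrt (mul_le_mul_of_nonneg_left hr3 hv)
  have hpi : √(2 / π) ≤ 1 := by
    refine Real.sqrt_le_one.2 ?_
    rw [div_le_one Real.pi_pos]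
    linarith [Real.pi_gt_three]
  have hN1 : √(v * (N + 1)) * √(2 / π) ≤ √v * √(2 * γ / (π * C)) + √v * √√γ := by
    have e1 : √(v * (N + 1)) ≤ √v * √(γ / C) + √v := by
      rw [Real.sqrt_mul hv]
      have : √(N + 1) ≤ √(γ / C) + 1 := by
        exact (Real.sqrt_le_sqrt (by linarith)).trans (sqrt_add_one_le (by positivity))
      have := mul_le_mul_of_nonneg_left this (Real.sqrt_nonneg v)
      rwa [mul_add, mul_one] at this
    have e2 : √v * √(γ / C) * √(2 / π) = √v * √(2 * γ / (π * C)) := by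
      rw [mul_assoc, ← Real.sqrt_mul (by positivity)]
      congr 2
      field_simp
    have e3 : √v * √(2 / π) ≤ √v * √√γ :=
      mul_le_mul_of_nonneg_left (hpi.trans hs2) (Real.sqrt_nonneg v)
    have := mul_le_mul_of_nonneg_right e1 (Real.sqrt_nonneg (2 / π))
    linarith
  have hN2 : √√N ≤ √√(1 / C) * √√γ := by
    rw [← Real.sqrt_mul (by positivity), ← Real.sqrt_mul (by positivity)]
    refine Real.sqrt_le_sqrt (Real.sqrt_le_sqrt ?_)
    rwa [one_div_mul_eq_div]
  have hD6 : D ≤ √v * √(2 * γ / (π * C)) + c₆ * √√γ := by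
    have h6 : (√v + B) * (4 * √√N) ≤ (√v + B) * (4 * (√√(1 / C) * √√γ)) := by gcongr
    have h7 : c₆ * √√γ = √v * √√γ + (√v + B) * (4 * (√√(1 / C) * √√γ)) + √(v * c₃) * √√γ := by
      rw [hc₆]; ring
    linarith
  have h6 : C * t ≤ C * (γ / C + √v / (2 * C) * √(2 * γ / (π * C))
      + (B / C + c₆ / (2 * C)) * √√γ) := by
    have h7 : C * (γ / C + √v / (2 * C) * √(2 * γ / (π * C)) + (B / C + c₆ / (2 * C)) * √√γ)
        = γ + B * √√γ + (√v * √(2 * γ / (π * C)) + c₆ * √√γ) / 2 := by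
      field_simp
      ring
    have h8 := mul_le_mul_of_nonneg_left hs2 hB
    rw [h7]
    linarith
  exact le_of_mul_le_mul_left h6 hC

/-- Expected time for two walks of equal drift `C` to be simultaneously above `γ`. -/
theorem exists_iidE_jointHit_le (hp : ∀ z, 0 ≤ p z) (hp1 : ∑ z, p z = 1) {a b : Z → ℝ}
    {C v : ℝ} (hC : 0 < C) (ha : ∑ z, p z * a z = C) (hb : ∑ z, p z * b z = C)
    (hv : ∑ z, p z * (a z - b z) ^ 2 = v) :
    ∃ c : ℝ, 0 ≤ c ∧ ∀ γ : ℝ, 1 ≤ γ → ∀ K : ℕ, γ ≤ C * K →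
      iidE p (fun z : Fin K → Z => (jointHit a b γ z : ℝ))
        ≤ γ / C + √v / (2 * C) * √(2 * γ / (π * C)) + c * √√γ := by
  obtain ⟨B, hB0, haB, hbB, hdB⟩ : ∃ B : ℝ, 0 ≤ B ∧ (∀ z, a z ≤ B) ∧ (∀ z, b z ≤ B) ∧
      ∀ z, |a z - b z| ≤ B := by
    refine ⟨∑ z, |a z| + ∑ z, |b z|, by positivity, fun z => ?_, fun z => ?_, fun z => ?_⟩ <;>
    have h1 := Finset.single_le_sum (f := fun z => |a z|) (fun z _ => abs_nonneg _)
      (Finset.mem_univ z) <;>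
    have h2 := Finset.single_le_sum (f := fun z => |b z|) (fun z _ => abs_nonneg _)
      (Finset.mem_univ z)
    · linarith [le_abs_self (a z), abs_nonneg (b z)]
    · linarith [le_abs_self (b z), abs_nonneg (a z)]
    · linarith [abs_sub (a z) (b z)]
  have hv0 : 0 ≤ v := hv ▸ Finset.sum_nonneg fun z _ => mul_nonneg (hp z) (sq_nonneg _)
  have hξ : ∑ z, p z * (a z - b z) = 0 := by
    simp only [mul_sub, Finset.sum_sub_distrib, ha, hb, sub_self]
  have hζ : ∑ z, p z * ((a z + b z) / 2 - C) = 0 := by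
    have : ∀ z, p z * ((a z + b z) / 2 - C) = (p z * a z) / 2 + (p z * b z) / 2 - p z * C := by
      intro z; ring
    simp only [this, Finset.sum_sub_distrib, Finset.sum_add_distrib, ← Finset.sum_div,
      ← Finset.sum_mul, ha, hb, hp1]
    ring
  set w := ∑ z, p z * ((a z + b z) / 2 - C) ^ 2 with hw
  have hw0 : 0 ≤ w := Finset.sum_nonneg fun z _ => mul_nonneg (hp z) (sq_nonneg _)
  obtain ⟨c, hc0, hc⟩ := stopping_time_bound_of_chain hC hB0 hv0 hw0
  refine ⟨c, hc0, fun γ hγ K hK => ?_⟩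
  have hγ0 : 0 < γ := by linarith
  set N := ⌊γ / C⌋₊ with hN
  have hNle : (N : ℝ) ≤ γ / C := Nat.floor_le (by positivity)
  have hNlt : γ / C < N + 1 := Nat.lt_floor_add_one _
  have hNK : N ≤ K := by
    have : (N : ℝ) ≤ K := hNle.trans ((div_le_iff₀ hC).2 (by linarith))
    exact_mod_cast this
  have hCN : |C * N - γ| ≤ C := by
    rw [le_div_iff₀ hC] at hNle
    rw [div_lt_iff₀ hC] at hNlt
    rw [abs_le]
    constructor <;> nlinarith
  set T : (Fin K → Z) → ℕ := fun z => jointHit a b γ z with hT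
  set Δ : (Fin K → Z) → ℕ → ℝ := fun z n => walk (fun z => a z - b z) z n with hΔ
  set A : (Fin K → Z) → ℕ → ℝ := fun z n => walk (fun z => (a z + b z) / 2 - C) z n with hA
  have hTK : ∀ z, T z ≤ K := fun z => hitTime_le _ _
  have hsplit : ∀ z n, n ≤ K → (walk a z n + walk b z n) / 2 = A z n + C * n := by
    intro z n hn
    rw [← sum_indicator_lt hn, hA]
    simp only [walk, Finset.mul_sum, ← Finset.sum_add_distrib, Finset.sum_div]
    refine Finset.sum_congr rfl fun i _ => ?_
    split_ifs <;> ring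
  have hmin : ∀ z, (walk a z (T z) + walk b z (T z)) / 2 ≤ γ + B + |Δ z (T z)| / 2 := by
    intro z
    have h1 := min_walk_jointHit_le hB0 haB hbB hγ0.le z
    have h2 : min (walk a z (T z)) (walk b z (T z))
        = (walk a z (T z) + walk b z (T z) - |walk b z (T z) - walk a z (T z)|) / 2 := by
      rw [← min_add_max (walk a z (T z)), ← max_sub_min_eq_abs]
      ring
    simp only [hΔ, walk_sub]
    simp only [hT] at h2 ⊢
    rw [abs_sub_comm] at h2
    have h3 := abs_sub_comm (walk a z (jointHit a b γ z)) (walk b z (jointHit a b γ z))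
    linarith
  have hdev : ∀ z, |C * T z - γ| ≤ |A z (T z)| + B + |Δ z (T z)| / 2 := by
    intro z
    have h1 := hsplit z (T z) (hTK z)
    have h2 := hmin z
    have h3 := abs_le.1 (le_refl |A z (T z)|)
    have h4 := abs_nonneg (Δ z (T z))
    rw [abs_le]
    refine ⟨?_, by linarith⟩
    rcases (hTK z).lt_or_eq with hlt | heq
    · obtain ⟨h5, h6⟩ := le_walk_of_jointHit_lt hlt
      simp only [hT] at h1 h2 h3 h4 ⊢
      linarith
    · rw [heq]
      have := abs_nonneg (A z K)
      have := abs_nonneg (Δ z K)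
      linarith
  have hwald1 := iidE_walk_jointHit (K := K) hp1 a b γ hζ
  have hwaldΔ := iidE_walk_jointHit_sub_sq (K := K) hp1 a b γ hξ hNK
  have hwaldΔ0 := iidE_walk_jointHit_sub_sq (K := K) hp1 a b γ hξ (Nat.zero_le K)
  have hwaldA := iidE_walk_jointHit_sub_sq (K := K) hp1 a b γ hζ (Nat.zero_le K)
  simp only [walk_zero, Nat.cast_zero, sub_zero, Nat.abs_cast] at hwaldΔ0 hwaldA
  rw [hv] at hwaldΔ hwaldΔ0
  rw [← hw] at hwaldA
  have hlin : iidE p (fun z => (walk a z (T z) + walk b z (T z)) / 2)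
      = C * iidE p (fun z => (T z : ℝ)) := by
    have : ∀ z, (walk a z (T z) + walk b z (T z)) / 2 = A z (T z) + C * T z := fun z =>
      hsplit z _ (hTK z)
    simp only [this]
    rw [iidE_add, iidE_const_mul, hwald1, zero_add]
  have habs : ∀ F : (Fin K → Z) → ℝ, iidE p (fun z => F z / 2) = iidE p F / 2 := by
    intro F
    simp only [div_eq_inv_mul]
    exact iidE_const_mul _ _
  refine hc γ _ (iidE p (fun z => |(T z : ℝ) - N|)) (iidE p (fun z => |Δ z (T z)|))
    (iidE p (fun z => |Δ z N|)) N hγ (iidE_nonneg hp fun z => by positivity)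
    (iidE_nonneg hp fun z => abs_nonneg _) (by positivity) hNle ?_ ?_ ?_ ?_ ?_
  · rw [← hlin]
    refine (iidE_mono hp fun z _ => hmin z).trans ?_
    rw [iidE_add, iidE_const hp1, habs]
  · rw [← hwaldΔ0]
    exact iidE_abs_le_sqrt hp hp1 _
  · rw [← iidE_const_mul, ← hwaldA]
    have h1 := iidE_abs_le_sqrt hp hp1 (fun z => A z (T z))
    have h2 : iidE p (fun z => C * |(T z : ℝ) - N|)
        ≤ iidE p (fun z => |A z (T z)| + B + |Δ z (T z)| / 2 + C) := by
      refine iidE_mono hp fun z _ => ?_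
      have h3 := hdev z
      have h4 : C * |(T z : ℝ) - N| = |(C * T z - γ) - (C * N - γ)| := by
        rw [← abs_of_pos hC, ← abs_mul, abs_of_pos hC]
        congr 1
        ring
      rw [h4]
      have := abs_sub (C * (T z : ℝ) - γ) (C * N - γ)
      linarith
    rw [iidE_add, iidE_add, iidE_add, iidE_const hp1, iidE_const hp1, habs] at h2
    exact h2.trans (by linarith)
  · have h1 := iidE_abs_le_sqrt hp hp1 (fun z => Δ z (T z) - Δ z N)
    have h2 : iidE p (fun z => |Δ z (T z)|)
        ≤ iidE p (fun z => |Δ z N| + |Δ z (T z) - Δ z N|) := by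
      refine iidE_mono hp fun z _ => ?_
      have := abs_add_le (Δ z N) (Δ z (T z) - Δ z N)
      rwa [add_sub_cancel] at this
    rw [iidE_add] at h2
    rw [hwaldΔ] at h1
    linarith
  · exact iidE_abs_walk_le hp hp1 hB0 hdB hξ hv hNK

end ExpectedHittingTime

section OptimalInput

variable {𝓧 𝓨 : Type} [Fintype 𝓧] [Fintype 𝓨]

lemma mutualInfo_mix_ge [DecidableEq 𝓧] {P : 𝓧 → ℝ} {W : 𝓧 → 𝓨 → ℝ} (hP : ∀ x, 0 ≤ P x)
    (hP1 : ∑ x, P x = 1) (hW : ∀ x y, 0 ≤ W x y) (hW1 : ∀ x, ∑ y, W x y = 1) {x₀ : 𝓧}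
    (hx₀ : P x₀ ≠ 0) {t : ℝ} (ht0 : 0 < t) (ht1 : t < 1) :
    (1 - t) * mutualInfo P W + t * ∑ y, W x₀ y * Real.log (W x₀ y / ∑ x, P x * W x y)
        - t ^ 2 * ∑ y, (W x₀ y - ∑ x, P x * W x y) ^ 2 / ∑ x, P x * W x y
      ≤ mutualInfo (fun x => (1 - t) * P x + t * if x = x₀ then 1 else 0) W := by
  set q : 𝓨 → ℝ := fun y => ∑ x, P x * W x y with hq
  set Pt : 𝓧 → ℝ := fun x => (1 - t) * P x + t * if x = x₀ then 1 else 0 with hPt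
  have hqt : ∀ y, ∑ x, Pt x * W x y = q y + t * (W x₀ y - q y) := by
    intro y
    have : ∀ x, Pt x * W x y = (1 - t) * (P x * W x y) + t * if x = x₀ then W x y else 0 := by
      intro x; simp only [hPt]; split_ifs <;> ring
    simp only [this, Finset.sum_add_distrib, ← Finset.mul_sum, Finset.sum_ite_eq',
      Finset.mem_univ, if_true, hq]
    ring
  have hsupp : ∀ x y, P x ≠ 0 → W x y ≠ 0 → 0 < q y := by
    intro x y hx hw
    have h1 : 0 < P x * W x y :=
      mul_pos ((hP x).lt_of_ne' hx) ((hW x y).lt_of_ne' hw)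
    exact h1.trans_le (Finset.single_le_sum (f := fun x => P x * W x y)
      (fun x _ => mul_nonneg (hP x) (hW x y)) (Finset.mem_univ x))
  have hPtnn : ∀ x, 0 ≤ Pt x := by
    intro x
    have := mul_nonneg (by linarith : 0 ≤ 1 - t) (hP x)
    simp only [hPt]
    split_ifs <;> linarith
  have hterm : ∀ x y, Pt x * W x y * Real.log (W x y / q y)
      - Pt x * W x y * (t * (W x₀ y - q y) / q y)
      ≤ Pt x * W x y * Real.log (W x y / ∑ x', Pt x' * W x' y) := by
    intro x y
    rw [hqt]
    by_cases hz : Pt x * W x y = 0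
    · simp [hz]
    have hPx : P x ≠ 0 := by
      intro h
      by_cases hxx : x = x₀
      · exact hx₀ (hxx ▸ h)
      · exact hz (by simp [hPt, h, hxx])
    have hWx : W x y ≠ 0 := fun h => hz (by simp [h])
    have hqy := hsupp x y hPx hWx
    have hqty : 0 < q y + t * (W x₀ y - q y) := by
      nlinarith [hW x₀ y]
    have hlog := Real.log_le_sub_one_of_pos (div_pos hqty hqy)
    rw [Real.log_div hqty.ne' hqy.ne'] at hlog
    have e1 : (q y + t * (W x₀ y - q y)) / q y - 1 = t * (W x₀ y - q y) / q y := by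
      field_simp
      ring
    rw [Real.log_div hWx hqy.ne', Real.log_div hWx hqty.ne', ← mul_sub]
    exact mul_le_mul_of_nonneg_left (by linarith) (mul_nonneg (hPtnn x) (hW x y))
  have hsum1 : ∑ x, ∑ y, Pt x * W x y * Real.log (W x y / q y)
      = (1 - t) * mutualInfo P W + t * ∑ y, W x₀ y * Real.log (W x₀ y / q y) := by
    have : ∀ x, ∑ y, Pt x * W x y * Real.log (W x y / q y)
        = (1 - t) * ∑ y, P x * W x y * Real.log (W x y / q y)
          + t * if x = x₀ then ∑ y, W x y * Real.log (W x y / q y) else 0 := by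
      intro x
      rw [Finset.mul_sum]
      split_ifs with h
      · rw [Finset.mul_sum, ← Finset.sum_add_distrib]
        exact Finset.sum_congr rfl fun y _ => by simp only [hPt, if_pos h]; ring
      · rw [mul_zero, add_zero]
        exact Finset.sum_congr rfl fun y _ => by simp only [hPt, if_neg h]; ring
    simp only [this, Finset.sum_add_distrib, ← Finset.mul_sum, Finset.sum_ite_eq',
      Finset.mem_univ, if_true]
    rfl
  have hqsum : ∑ y, q y = 1 := by
    simp only [hq]
    rw [Finset.sum_comm]
    simp only [← Finset.mul_sum, hW1, mul_one, hP1]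
  have hsum2 : ∑ x, ∑ y, Pt x * W x y * (t * (W x₀ y - q y) / q y)
      = t ^ 2 * ∑ y, (W x₀ y - q y) ^ 2 / q y := by
    rw [Finset.sum_comm]
    have : ∀ y, ∑ x, Pt x * W x y * (t * (W x₀ y - q y) / q y)
        = t * (W x₀ y - q y) + t ^ 2 * ((W x₀ y - q y) ^ 2 / q y) := by
      intro y
      rw [← Finset.sum_mul, hqt]
      by_cases hqy : q y = 0
      · have : W x₀ y = 0 := by
          by_contra h
          exact (hsupp x₀ y hx₀ h).ne' hqy
        simp [hqy, this]
      · field_simp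
    simp only [this, Finset.sum_add_distrib, ← Finset.mul_sum, Finset.sum_sub_distrib, hqsum,
      hW1, sub_self, mul_zero, zero_add]
  rw [← hsum1, ← hsum2]
  simp only [← Finset.sum_sub_distrib]
  exact Finset.sum_le_sum fun x _ => Finset.sum_le_sum fun y _ => hterm x y

/-- For an input distribution maximising the mutual information, the mean information density
given the input is constant on the support. -/
theorem divergence_eq_of_isMax {P : 𝓧 → ℝ} {W : 𝓧 → 𝓨 → ℝ} (hP : ∀ x, 0 ≤ P x)
    (hP1 : ∑ x, P x = 1) (hW : ∀ x y, 0 ≤ W x y) (hW1 : ∀ x, ∑ y, W x y = 1) {C : ℝ}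
    (hC : mutualInfo P W = C)
    (hmax : ∀ P' : 𝓧 → ℝ, (∀ x, 0 ≤ P' x) → ∑ x, P' x = 1 → mutualInfo P' W ≤ C)
    {x₀ : 𝓧} (hx₀ : P x₀ ≠ 0) :
    ∑ y, W x₀ y * Real.log (W x₀ y / ∑ x, P x * W x y) = C := by
  classical
  set D : 𝓧 → ℝ := fun x₀ => ∑ y, W x₀ y * Real.log (W x₀ y / ∑ x, P x * W x y) with hD
  have hle : ∀ x₀, P x₀ ≠ 0 → D x₀ ≤ C := by
    intro x₀ hx₀
    by_contra! hlt
    set χ := ∑ y, (W x₀ y - ∑ x, P x * W x y) ^ 2 / ∑ x, P x * W x y with hχ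
    have hχ0 : 0 ≤ χ := Finset.sum_nonneg fun y _ => div_nonneg (sq_nonneg _)
      (Finset.sum_nonneg fun x _ => mul_nonneg (hP x) (hW x y))
    have hbound : ∀ t : ℝ, 0 < t → t < 1 → D x₀ - C ≤ t * χ := by
      intro t ht0 ht1
      have h1 := mutualInfo_mix_ge hP hP1 hW hW1 hx₀ ht0 ht1
      have h2 := hmax (fun x => (1 - t) * P x + t * if x = x₀ then 1 else 0)
        (fun x => by
          have := mul_nonneg (by linarith : 0 ≤ 1 - t) (hP x)
          split_ifs <;> linarith)
        (by
          simp only [Finset.sum_add_distrib, ← Finset.mul_sum, hP1, Finset.sum_ite_eq',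
            Finset.mem_univ, if_true]
          ring)
      rw [hC] at h1
      have h3 : t * (D x₀ - C) ≤ t * (t * χ) := by
        simp only [hD]
        linarith
      exact le_of_mul_le_mul_left h3 ht0
    have hd : 0 < D x₀ - C := by linarith
    have h4 := hbound (min (1 / 2) ((D x₀ - C) / (2 * (χ + 1))))
      (lt_min (by norm_num) (by positivity)) ((min_le_left _ _).trans_lt (by norm_num))
    have h5 := mul_le_mul_of_nonneg_right
      (min_le_right (1 / 2) ((D x₀ - C) / (2 * (χ + 1)))) hχ0
    have h6 : (D x₀ - C) / (2 * (χ + 1)) * χ < D x₀ - C := by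
      rw [div_mul_eq_mul_div, div_lt_iff₀ (by positivity)]
      nlinarith
    linarith
  have hsum : ∑ x, P x * (C - D x) = 0 := by
    have : ∀ x, P x * (C - D x) = C * P x
        - ∑ y, P x * W x y * Real.log (W x y / ∑ x, P x * W x y) := by
      intro x
      simp only [hD, mul_sub, Finset.mul_sum]
      congr 1
      · ring
      · exact Finset.sum_congr rfl fun y _ => by ring
    simp only [this, Finset.sum_sub_distrib, ← Finset.mul_sum, hP1]
    rw [← hC, mutualInfo]
    ring
  have hz := (Finset.sum_eq_zero_iff_of_nonneg (fun x _ => ?_)).1 hsum x₀ (Finset.mem_univ _)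
  · rcases mul_eq_zero.1 hz with h | h
    · exact absurd h hx₀
    · exact (sub_eq_zero.1 h).symm
  · by_cases h : P x = 0
    · simp [h]
    · exact mul_nonneg (hP x) (sub_nonneg.2 (hle x h))

end OptimalInput

section SingleLetter

variable {𝓧 𝓨₁ 𝓨₂ : Type} [Fintype 𝓧] [Fintype 𝓨₁] [Fintype 𝓨₂]

lemma sum_sum_mul_eq {α β : Type} [Fintype α] [Fintype β] (f : α → ℝ) (g : β → ℝ) :
    ∑ y : α × β, f y.1 * g y.2 = (∑ a, f a) * ∑ b, g b := by
  rw [Fintype.sum_prod_type, Finset.sum_mul_sum]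

/-- The channel seen jointly by both receivers. -/
def BroadcastChannel.joint (ch : BroadcastChannel 𝓧 𝓨₁ 𝓨₂) (x : 𝓧) (y : 𝓨₁ × 𝓨₂) : ℝ :=
  ch.W1 x y.1 * ch.W2 x y.2

lemma BroadcastChannel.joint_nonneg (ch : BroadcastChannel 𝓧 𝓨₁ 𝓨₂) (x : 𝓧) (y : 𝓨₁ × 𝓨₂) :
    0 ≤ ch.joint x y := mul_nonneg (ch.W1_nonneg _ _) (ch.W2_nonneg _ _)

lemma BroadcastChannel.sum_joint (ch : BroadcastChannel 𝓧 𝓨₁ 𝓨₂) (x : 𝓧) :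
    ∑ y, ch.joint x y = 1 := by
  simp only [BroadcastChannel.joint]
  rw [sum_sum_mul_eq, ch.W1_sum_one, ch.W2_sum_one, one_mul]

/-- The input-output weights of a channel `V` driven by `P`. -/
def inOut {𝓨 : Type} (P : 𝓧 → ℝ) (V : 𝓧 → 𝓨 → ℝ) (z : 𝓧 × 𝓨) : ℝ := P z.1 * V z.1 z.2

lemma inOut_nonneg {𝓨 : Type} {P : 𝓧 → ℝ} {V : 𝓧 → 𝓨 → ℝ} (hP : ∀ x, 0 ≤ P x)
    (hV : ∀ x y, 0 ≤ V x y) (z : 𝓧 × 𝓨) : 0 ≤ inOut P V z := mul_nonneg (hP _) (hV _ _)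

lemma sum_inOut {𝓨 : Type} [Fintype 𝓨] {P : 𝓧 → ℝ} {V : 𝓧 → 𝓨 → ℝ} (hP1 : ∑ x, P x = 1)
    (hV1 : ∀ x, ∑ y, V x y = 1) : ∑ z, inOut P V z = 1 := by
  simp only [inOut, Fintype.sum_prod_type, ← Finset.mul_sum, hV1, mul_one, hP1]

/-- The likelihood ratio `W(y|x) / PW(y)`. -/
def lratio {𝓨 : Type} (P : 𝓧 → ℝ) (W : 𝓧 → 𝓨 → ℝ) (x : 𝓧) (y : 𝓨) : ℝ :=
  W x y / ∑ x', P x' * W x' y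

lemma sum_inOut_joint (ch : BroadcastChannel 𝓧 𝓨₁ 𝓨₂) (P : 𝓧 → ℝ) (f : 𝓧 → 𝓨₁ → ℝ)
    (g : 𝓧 → 𝓨₂ → ℝ) :
    ∑ z : 𝓧 × (𝓨₁ × 𝓨₂), inOut P ch.joint z * (f z.1 z.2.1 * g z.1 z.2.2)
      = ∑ x, P x * ((∑ y, ch.W1 x y * f x y) * ∑ y, ch.W2 x y * g x y) := by
  rw [Fintype.sum_prod_type]
  refine Finset.sum_congr rfl fun x _ => ?_
  rw [← sum_sum_mul_eq, Finset.mul_sum]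
  refine Finset.sum_congr rfl fun y _ => ?_
  simp only [inOut, BroadcastChannel.joint]
  ring

lemma sum_inOut_joint_fst (ch : BroadcastChannel 𝓧 𝓨₁ 𝓨₂) (P : 𝓧 → ℝ) (f : 𝓧 → 𝓨₁ → ℝ) :
    ∑ z : 𝓧 × (𝓨₁ × 𝓨₂), inOut P ch.joint z * f z.1 z.2.1
      = ∑ x, ∑ y, P x * ch.W1 x y * f x y := by
  have := sum_inOut_joint ch P f (fun _ _ => 1)
  simp only [mul_one, ch.W2_sum_one] at this
  rw [this]
  refine Finset.sum_congr rfl fun x _ => ?_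
  rw [Finset.mul_sum]
  exact Finset.sum_congr rfl fun y _ => by ring

lemma sum_inOut_joint_snd (ch : BroadcastChannel 𝓧 𝓨₁ 𝓨₂) (P : 𝓧 → ℝ) (g : 𝓧 → 𝓨₂ → ℝ) :
    ∑ z : 𝓧 × (𝓨₁ × 𝓨₂), inOut P ch.joint z * g z.1 z.2.2
      = ∑ x, ∑ y, P x * ch.W2 x y * g x y := by
  have := sum_inOut_joint ch P (fun _ _ => 1) g
  simp only [mul_one, one_mul, ch.W1_sum_one] at this
  rw [this]
  refine Finset.sum_congr rfl fun x _ => ?_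
  rw [Finset.mul_sum]
  exact Finset.sum_congr rfl fun y _ => by ring

/-- At a common maximiser the two information densities are uncorrelated, so the variance of
their difference is the sum of the dispersions. -/
lemma sum_inOut_joint_sub_sq (ch : BroadcastChannel 𝓧 𝓨₁ 𝓨₂) {P : 𝓧 → ℝ}
    (hP : ∀ x, 0 ≤ P x) (hP1 : ∑ x, P x = 1) {C : ℝ}
    (hC1 : mutualInfo P ch.W1 = C) (hC2 : mutualInfo P ch.W2 = C)
    (hmax : ∀ P' : 𝓧 → ℝ, (∀ x, 0 ≤ P' x) → ∑ x, P' x = 1 → mutualInfo P' ch.W1 ≤ C) :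
    ∑ z : 𝓧 × (𝓨₁ × 𝓨₂), inOut P ch.joint z *
        (Real.log (lratio P ch.W1 z.1 z.2.1) - Real.log (lratio P ch.W2 z.1 z.2.2)) ^ 2
      = infoVar P ch.W1 + infoVar P ch.W2 := by
  have e : ∀ z : 𝓧 × (𝓨₁ × 𝓨₂), inOut P ch.joint z *
        (Real.log (lratio P ch.W1 z.1 z.2.1) - Real.log (lratio P ch.W2 z.1 z.2.2)) ^ 2
      = inOut P ch.joint z * (Real.log (lratio P ch.W1 z.1 z.2.1) - C) ^ 2
        + inOut P ch.joint z * (Real.log (lratio P ch.W2 z.1 z.2.2) - C) ^ 2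
        - 2 * (inOut P ch.joint z * ((Real.log (lratio P ch.W1 z.1 z.2.1) - C)
          * (Real.log (lratio P ch.W2 z.1 z.2.2) - C))) := by
    intro z; ring
  simp only [e, Finset.sum_sub_distrib, Finset.sum_add_distrib, ← Finset.mul_sum]
  rw [sum_inOut_joint_fst ch P (fun x y => (Real.log (lratio P ch.W1 x y) - C) ^ 2),
    sum_inOut_joint_snd ch P (fun x y => (Real.log (lratio P ch.W2 x y) - C) ^ 2),
    sum_inOut_joint ch P (fun x y => Real.log (lratio P ch.W1 x y) - C)
      (fun x y => Real.log (lratio P ch.W2 x y) - C)]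
  have hz : ∀ x, P x * ((∑ y, ch.W1 x y * (Real.log (lratio P ch.W1 x y) - C)) *
      ∑ y, ch.W2 x y * (Real.log (lratio P ch.W2 x y) - C)) = 0 := by
    intro x
    by_cases hx : P x = 0
    · rw [hx, zero_mul]
    · have h := divergence_eq_of_isMax hP hP1 ch.W1_nonneg ch.W1_sum_one hC1 hmax hx
      have h' : ∑ y, ch.W1 x y * (Real.log (lratio P ch.W1 x y) - C) = 0 := by
        simp only [mul_sub, Finset.sum_sub_distrib, ← Finset.sum_mul, ch.W1_sum_one, lratio]
        rw [h]; ring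
      rw [h']; ring
  simp only [hz, Finset.sum_const_zero, mul_zero, sub_zero]
  simp only [infoVar, hC1, hC2, lratio]

end SingleLetter

section Decoder

variable {𝓧 𝓨 : Type} {K M : ℕ}

/-- The product of the ratios `r (xᵢ) (yᵢ)` over the first `n` symbols. -/
def likelihood (r : 𝓧 → 𝓨 → ℝ) (x : Fin K → 𝓧) (y : Fin K → 𝓨) (n : ℕ) : ℝ :=
  ∏ i : Fin K, if i.val < n then r (x i) (y i) else 1

lemma likelihood_congr (r : 𝓧 → 𝓨 → ℝ) (x : Fin K → 𝓧) {y y' : Fin K → 𝓨} {n : ℕ}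
    (h : ∀ i : Fin K, i.val < n → y i = y' i) : likelihood r x y n = likelihood r x y' n := by
  refine Finset.prod_congr rfl fun i _ => ?_
  split_ifs with hi
  · rw [h i hi]
  · rfl

lemma likelihood_nonneg {r : 𝓧 → 𝓨 → ℝ} (hr : ∀ x y, 0 ≤ r x y) (x : Fin K → 𝓧)
    (y : Fin K → 𝓨) (n : ℕ) : 0 ≤ likelihood r x y n := by
  refine Finset.prod_nonneg fun i _ => ?_
  split_ifs
  · exact hr _ _
  · exact zero_le_one

lemma sum_prod_mul_likelihood_le_one [Fintype 𝓧] {P : 𝓧 → ℝ} (hP : ∀ x, 0 ≤ P x)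
    (hP1 : ∑ x, P x = 1) {r : 𝓧 → 𝓨 → ℝ} (hr : ∀ x y, 0 ≤ r x y)
    (hr1 : ∀ y, ∑ x, P x * r x y ≤ 1) (y : Fin K → 𝓨) (n : ℕ) :
    ∑ w : Fin K → 𝓧, (∏ i, P (w i)) * likelihood r w y n ≤ 1 := by
  simp only [likelihood, ← Finset.prod_mul_distrib]
  rw [← Fintype.prod_sum (fun (i : Fin K) (x : 𝓧) => P x * if i.val < n then r x (y i) else 1)]
  refine Finset.prod_le_one (fun i _ => Finset.sum_nonneg fun x _ => mul_nonneg (hP x) ?_)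
    fun i _ => ?_
  · split_ifs
    · exact hr _ _
    · exact zero_le_one
  · split_ifs
    · exact hr1 _
    · simp [hP1]

lemma exp_walk_log {r : 𝓧 → 𝓨 → ℝ} {Z : Type} (f : Z → 𝓧) (g : Z → 𝓨) (z : Fin K → Z)
    (h : ∀ i, 0 < r (f (z i)) (g (z i))) (n : ℕ) :
    Real.exp (walk (fun w => Real.log (r (f w) (g w))) z n)
      = likelihood r (fun i => f (z i)) (fun i => g (z i)) n := by
  rw [walk, Real.exp_sum]
  refine Finset.prod_congr rfl fun i _ => ?_
  split_ifs
  · rw [Real.exp_log (h i)]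
  · exact Real.exp_zero

/-- The decoder stops once the likelihood of some codeword reaches `θ`, at the latest at `K`. -/
def decodeTime (r : 𝓧 → 𝓨 → ℝ) (θ : ℝ) (c : Fin M → Fin K → 𝓧) (y : Fin K → 𝓨) : ℕ :=
  hitTime K (fun n => ∃ j, θ ≤ likelihood r (c j) y n)

/-- A message whose likelihood has reached `θ`, if there is one. -/
def decodeMsg [NeZero M] (r : 𝓧 → 𝓨 → ℝ) (θ : ℝ) (c : Fin M → Fin K → 𝓧) (n : ℕ)
    (y : Fin K → 𝓨) : Fin M :=
  Classical.epsilon fun j => θ ≤ likelihood r (c j) y n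

lemma decodeTime_le (r : 𝓧 → 𝓨 → ℝ) (θ : ℝ) (c : Fin M → Fin K → 𝓧) (y : Fin K → 𝓨) :
    decodeTime r θ c y ≤ K := hitTime_le _ _

lemma decodeTime_le_iff_of_eq (r : 𝓧 → 𝓨 → ℝ) (θ : ℝ) (c : Fin M → Fin K → 𝓧)
    {y y' : Fin K → 𝓨} {n : ℕ} (h : ∀ i : Fin K, i.val < n → y i = y' i) :
    decodeTime r θ c y ≤ n ↔ decodeTime r θ c y' ≤ n := by
  simp only [decodeTime, hitTime_le_iff]
  refine or_congr Iff.rfl (exists_congr fun m => and_congr_right fun hm => ?_)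
  refine exists_congr fun j => ?_
  rw [likelihood_congr r (c j) fun i hi => h i (hi.trans_le hm)]

lemma decodeMsg_congr [NeZero M] (r : 𝓧 → 𝓨 → ℝ) (θ : ℝ) (c : Fin M → Fin K → 𝓧)
    {y y' : Fin K → 𝓨} {n : ℕ} (h : ∀ i : Fin K, i.val < n → y i = y' i) :
    decodeMsg r θ c n y = decodeMsg r θ c n y' := by
  unfold decodeMsg
  congr 1
  funext j
  rw [likelihood_congr r (c j) h]

/-- A decoding error forces a timeout or a wrong codeword reaching the threshold. -/
lemma decode_error_le [NeZero M] {r : 𝓧 → 𝓨 → ℝ} (hr : ∀ x y, 0 ≤ r x y) {θ : ℝ} (hθ : 0 < θ)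
    (c : Fin M → Fin K → 𝓧) (y : Fin K → 𝓨) (j : Fin M) :
    (if decodeMsg r θ c (decodeTime r θ c y) y ≠ j then (1 : ℝ) else 0)
      ≤ (if decodeTime r θ c y = K then 1 else 0)
        + ∑ j' ∈ Finset.univ.erase j, ∑ n ∈ Finset.range (K + 1),
            likelihood r (c j') y n / θ := by
  have h0 : ∀ j' n, 0 ≤ likelihood r (c j') y n / θ := fun j' n =>
    div_nonneg (likelihood_nonneg hr _ _ _) hθ.le
  have hs : 0 ≤ ∑ j' ∈ Finset.univ.erase j, ∑ n ∈ Finset.range (K + 1),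
      likelihood r (c j') y n / θ :=
    Finset.sum_nonneg fun j' _ => Finset.sum_nonneg fun n _ => h0 _ _
  split_ifs with h1 h2 h2
  · linarith
  · rw [zero_add]
    have h3 : ∃ j', θ ≤ likelihood r (c j') y (decodeTime r θ c y) :=
      (hitTime_spec K fun n => ∃ j, θ ≤ likelihood r (c j) y n).resolve_left h2
    have h4 := Classical.epsilon_spec h3
    have h5 : (1 : ℝ) ≤ likelihood r (c (decodeMsg r θ c (decodeTime r θ c y) y)) y
        (decodeTime r θ c y) / θ := (one_le_div hθ).2 h4
    refine h5.trans ((Finset.single_le_sum (f := fun n => likelihood r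
      (c (decodeMsg r θ c (decodeTime r θ c y) y)) y n / θ) (fun n _ => h0 _ n)
      (Finset.mem_range.2 (Nat.lt_succ_of_le (decodeTime_le r θ c y)))).trans ?_)
    exact Finset.single_le_sum (f := fun j' => ∑ n ∈ Finset.range (K + 1),
      likelihood r (c j') y n / θ) (fun j' _ => Finset.sum_nonneg fun n _ => h0 _ _)
      (Finset.mem_erase.2 ⟨h1, Finset.mem_univ _⟩)
  · linarith
  · linarith

end Decoder

section RandomCoding

variable {𝓧 𝓨 𝓨₁ 𝓨₂ : Type} {K M : ℕ}

/-- Expectation over the output block of the memoryless channel `V` with input block `x`. -/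
def blockE [Fintype 𝓨] (V : 𝓧 → 𝓨 → ℝ) (x : Fin K → 𝓧) (F : (Fin K → 𝓨) → ℝ) : ℝ :=
  ∑ y : Fin K → 𝓨, (∏ i, V (x i) (y i)) * F y

lemma blockE_add [Fintype 𝓨] (V : 𝓧 → 𝓨 → ℝ) (x : Fin K → 𝓧) (F G : (Fin K → 𝓨) → ℝ) :
    blockE V x (fun y => F y + G y) = blockE V x F + blockE V x G := by
  simp only [blockE, mul_add, Finset.sum_add_distrib]

lemma blockE_const_mul [Fintype 𝓨] (V : 𝓧 → 𝓨 → ℝ) (x : Fin K → 𝓧) (a : ℝ)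
    (F : (Fin K → 𝓨) → ℝ) : blockE V x (fun y => a * F y) = a * blockE V x F := by
  simp only [blockE, Finset.mul_sum]
  exact Finset.sum_congr rfl fun _ _ => by ring

lemma blockE_sum [Fintype 𝓨] {κ : Type} (V : 𝓧 → 𝓨 → ℝ) (x : Fin K → 𝓧) (s : Finset κ)
    (F : κ → (Fin K → 𝓨) → ℝ) :
    blockE V x (fun y => ∑ k ∈ s, F k y) = ∑ k ∈ s, blockE V x (F k) := by
  simp only [blockE, Finset.mul_sum]
  exact Finset.sum_comm

lemma blockE_mono [Fintype 𝓨] {V : 𝓧 → 𝓨 → ℝ} (hV : ∀ x y, 0 ≤ V x y) (x : Fin K → 𝓧)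
    {F G : (Fin K → 𝓨) → ℝ} (h : ∀ y, (∀ i, V (x i) (y i) ≠ 0) → F y ≤ G y) :
    blockE V x F ≤ blockE V x G := by
  refine Finset.sum_le_sum fun y _ => ?_
  by_cases hy : ∀ i, V (x i) (y i) ≠ 0
  · exact mul_le_mul_of_nonneg_left (h y hy) (Finset.prod_nonneg fun i _ => hV _ _)
  · push Not at hy
    obtain ⟨i, hi⟩ := hy
    rw [Finset.prod_eq_zero (Finset.mem_univ i) hi, zero_mul, zero_mul]

lemma blockE_const [Fintype 𝓨] {V : 𝓧 → 𝓨 → ℝ} (hV1 : ∀ x, ∑ y, V x y = 1)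
    (x : Fin K → 𝓧) (a : ℝ) : blockE V x (fun _ => a) = a := by
  rw [blockE, ← Finset.sum_mul, ← Fintype.prod_sum (fun (i : Fin K) (y : 𝓨) => V (x i) y)]
  simp [hV1]

lemma sum_prod_mul_blockE [Fintype 𝓧] [Fintype 𝓨] (P : 𝓧 → ℝ) (V : 𝓧 → 𝓨 → ℝ)
    (F : (Fin K → 𝓧) → (Fin K → 𝓨) → ℝ) :
    ∑ x : Fin K → 𝓧, (∏ i, P (x i)) * blockE V x (F x)
      = iidE (inOut P V) (fun z : Fin K → 𝓧 × 𝓨 => F (fun i => (z i).1) (fun i => (z i).2)) := by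
  rw [iidE, ← (Equiv.arrowProdEquivProdArrow (Fin K) (fun _ => 𝓧) (fun _ => 𝓨)).symm.sum_comp,
    Fintype.sum_prod_type]
  refine Finset.sum_congr rfl fun x _ => ?_
  rw [blockE, Finset.mul_sum]
  refine Finset.sum_congr rfl fun y _ => ?_
  simp only [inOut, Equiv.arrowProdEquivProdArrow, Equiv.coe_fn_symm_mk, Finset.prod_mul_distrib]
  ring

/-- An independent codeword reaches a likelihood of `θ` with small probability. -/
lemma iidE_blockE_likelihood_le [Fintype 𝓧] [Fintype 𝓨] {P : 𝓧 → ℝ} (hP : ∀ x, 0 ≤ P x)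
    (hP1 : ∑ x, P x = 1) {V : 𝓧 → 𝓨 → ℝ} (hV : ∀ x y, 0 ≤ V x y) (hV1 : ∀ x, ∑ y, V x y = 1)
    {𝓨' : Type} (g : 𝓨 → 𝓨') {r : 𝓧 → 𝓨' → ℝ} (hr : ∀ x y, 0 ≤ r x y)
    (hr1 : ∀ y, ∑ x, P x * r x y ≤ 1) {θ : ℝ} (hθ : 0 < θ) {j j' : Fin M} (hj : j' ≠ j) :
    iidE (fun x : Fin K → 𝓧 => ∏ i, P (x i)) (fun c : Fin M → Fin K → 𝓧 =>
        blockE V (c j) fun y => ∑ n ∈ Finset.range (K + 1),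
          likelihood r (c j') (fun i => g (y i)) n / θ) ≤ (K + 1) / θ := by
  have hQ : ∀ x : Fin K → 𝓧, 0 ≤ ∏ i, P (x i) := fun x => Finset.prod_nonneg fun i _ => hP _
  have hQ1 : ∑ x : Fin K → 𝓧, ∏ i, P (x i) = 1 := sum_prod_eq_one hP1
  rw [iidE_resample hQ1 j']
  refine (iidE_mono hQ (G := fun _ => (K + 1) / θ) fun c _ => ?_).trans_eq (iidE_const hQ1 _)
  simp only [Function.update_self, Function.update_of_ne hj.symm]
  have : ∑ w : Fin K → 𝓧, (∏ i, P (w i)) * blockE V (c j) (fun y =>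
        ∑ n ∈ Finset.range (K + 1), likelihood r w (fun i => g (y i)) n / θ)
      = blockE V (c j) (fun y => ∑ n ∈ Finset.range (K + 1),
          (∑ w : Fin K → 𝓧, (∏ i, P (w i)) * likelihood r w (fun i => g (y i)) n) / θ) := by
    simp only [← blockE_const_mul]
    rw [← blockE_sum]
    congr 1
    funext y
    simp only [Finset.mul_sum]
    rw [Finset.sum_comm]
    refine Finset.sum_congr rfl fun n _ => ?_
    rw [Finset.sum_div]
    exact Finset.sum_congr rfl fun w _ => by ring
  rw [this]
  refine (blockE_mono hV (c j) (G := fun _ => (K + 1) / θ) fun y _ => ?_).trans_eq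
    (blockE_const hV1 _ _)
  refine (Finset.sum_le_card_nsmul _ _ (1 / θ) fun n _ => ?_).trans_eq ?_
  · gcongr
    exact sum_prod_mul_likelihood_le_one hP hP1 hr hr1 _ n
  · rw [Finset.card_range, nsmul_eq_mul]
    push_cast
    ring

variable [Fintype 𝓧] [Fintype 𝓨₁] [Fintype 𝓨₂]

lemma lratio_nonneg {P : 𝓧 → ℝ} (hP : ∀ x, 0 ≤ P x) {W : 𝓧 → 𝓨 → ℝ} (hW : ∀ x y, 0 ≤ W x y)
    (x : 𝓧) (y : 𝓨) : 0 ≤ lratio P W x y :=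
  div_nonneg (hW _ _) (Finset.sum_nonneg fun x' _ => mul_nonneg (hP x') (hW x' y))

lemma lratio_pos {P : 𝓧 → ℝ} (hP : ∀ x, 0 ≤ P x) {W : 𝓧 → 𝓨 → ℝ} (hW : ∀ x y, 0 ≤ W x y)
    {x : 𝓧} {y : 𝓨} (hx : P x ≠ 0) (hxy : W x y ≠ 0) : 0 < lratio P W x y := by
  have h1 : 0 < W x y := (hW x y).lt_of_ne' hxy
  refine div_pos h1 ((mul_pos ((hP x).lt_of_ne' hx) h1).trans_le ?_)
  exact Finset.single_le_sum (f := fun x => P x * W x y)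
    (fun x _ => mul_nonneg (hP x) (hW x y)) (Finset.mem_univ x)

lemma sum_mul_lratio_le_one (P : 𝓧 → ℝ) (W : 𝓧 → 𝓨 → ℝ) (y : 𝓨) :
    ∑ x, P x * lratio P W x y ≤ 1 := by
  have : ∑ x, P x * lratio P W x y = (∑ x, P x * W x y) / ∑ x, P x * W x y := by
    rw [Finset.sum_div]
    exact Finset.sum_congr rfl fun x _ => by rw [lratio]; ring
  rw [this]
  exact div_self_le_one _

/-- The joint hitting time of the information densities of the two receivers. -/
def densityHit (ch : BroadcastChannel 𝓧 𝓨₁ 𝓨₂) (P : 𝓧 → ℝ) (γ : ℝ)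
    (z : Fin K → 𝓧 × (𝓨₁ × 𝓨₂)) : ℕ :=
  jointHit (fun z : 𝓧 × (𝓨₁ × 𝓨₂) => Real.log (lratio P ch.W1 z.1 z.2.1))
    (fun z => Real.log (lratio P ch.W2 z.1 z.2.2)) γ z

lemma decodeTime_le_densityHit (ch : BroadcastChannel 𝓧 𝓨₁ 𝓨₂) {P : 𝓧 → ℝ}
    (hP : ∀ x, 0 ≤ P x) (γ : ℝ) (c : Fin M → Fin K → 𝓧) (j : Fin M) (hc : ∀ i, P (c j i) ≠ 0)
    {y : Fin K → 𝓨₁ × 𝓨₂} (hy : ∀ i, ch.joint (c j i) (y i) ≠ 0) :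
    decodeTime (lratio P ch.W1) (Real.exp γ) c (fun i => (y i).1)
        ≤ densityHit ch P γ (fun i => (c j i, y i)) ∧
      decodeTime (lratio P ch.W2) (Real.exp γ) c (fun i => (y i).2)
        ≤ densityHit ch P γ (fun i => (c j i, y i)) := by
  constructor
  · refine hitTime_anti fun n hn => ⟨j, ?_⟩
    rw [← Real.exp_le_exp] at hn
    refine hn.1.trans_eq (exp_walk_log (r := lratio P ch.W1) (fun z : 𝓧 × (𝓨₁ × 𝓨₂) => z.1)
      (fun z => z.2.1) _ (fun i => ?_) n)
    exact lratio_pos hP ch.W1_nonneg (hc i) (left_ne_zero_of_mul (hy i))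
  · refine hitTime_anti fun n hn => ⟨j, ?_⟩
    have hn2 := Real.exp_le_exp.2 hn.2
    refine hn2.trans_eq (exp_walk_log (r := lratio P ch.W2) (fun z : 𝓧 × (𝓨₁ × 𝓨₂) => z.1)
      (fun z => z.2.2) _ (fun i => ?_) n)
    exact lratio_pos hP ch.W2_nonneg (hc i) (right_ne_zero_of_mul (hy i))

/-- Average of `max(τ₁, τ₂)` over messages and outputs for the codebook `c`. -/
def codebookLength (ch : BroadcastChannel 𝓧 𝓨₁ 𝓨₂) (P : 𝓧 → ℝ) (θ : ℝ)
    (c : Fin M → Fin K → 𝓧) : ℝ :=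
  (M : ℝ)⁻¹ * ∑ j, blockE ch.joint (c j) fun y =>
    ((max (decodeTime (lratio P ch.W1) θ c fun i => (y i).1)
      (decodeTime (lratio P ch.W2) θ c fun i => (y i).2) : ℕ) : ℝ)

/-- Average error probability for the codebook `c` of the receiver that observes `g ∘ y` and
decodes with the ratios `r`. -/
def codebookError [NeZero M] [Fintype 𝓨] {𝓨' : Type} (V : 𝓧 → 𝓨 → ℝ) (g : 𝓨 → 𝓨')
    (r : 𝓧 → 𝓨' → ℝ) (θ : ℝ) (c : Fin M → Fin K → 𝓧) : ℝ :=
  (M : ℝ)⁻¹ * ∑ j, blockE V (c j) fun y =>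
    if decodeMsg r θ c (decodeTime r θ c fun i => g (y i)) (fun i => g (y i)) ≠ j then 1 else 0

end RandomCoding

section CodebookExistence

variable {𝓧 𝓨₁ 𝓨₂ : Type} {K M : ℕ} [Fintype 𝓧] [Fintype 𝓨₁] [Fintype 𝓨₂]

lemma decoding_cost_le [NeZero M] (ch : BroadcastChannel 𝓧 𝓨₁ 𝓨₂) {P : 𝓧 → ℝ}
    (hP : ∀ x, 0 ≤ P x) (γ : ℝ) {Λ : ℝ} (hΛ : 0 ≤ Λ) (hK : 0 < K) (c : Fin M → Fin K → 𝓧)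
    (j : Fin M) (hc : ∀ i, P (c j i) ≠ 0) {y : Fin K → 𝓨₁ × 𝓨₂}
    (hy : ∀ i, ch.joint (c j i) (y i) ≠ 0) :
    ((max (decodeTime (lratio P ch.W1) (Real.exp γ) c fun i => (y i).1)
      (decodeTime (lratio P ch.W2) (Real.exp γ) c fun i => (y i).2) : ℕ) : ℝ)
      + Λ * ((if decodeMsg (lratio P ch.W1) (Real.exp γ) c
            (decodeTime (lratio P ch.W1) (Real.exp γ) c fun i => (y i).1)
            (fun i => (y i).1) ≠ j then 1 else 0)
          + (if decodeMsg (lratio P ch.W2) (Real.exp γ) c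
            (decodeTime (lratio P ch.W2) (Real.exp γ) c fun i => (y i).2)
            (fun i => (y i).2) ≠ j then 1 else 0))
      ≤ (1 + 2 * Λ / K) * densityHit ch P γ (fun i => (c j i, y i))
        + Λ * (∑ j' ∈ Finset.univ.erase j, ∑ n ∈ Finset.range (K + 1),
            likelihood (lratio P ch.W1) (c j') (fun i => (y i).1) n / Real.exp γ)
        + Λ * (∑ j' ∈ Finset.univ.erase j, ∑ n ∈ Finset.range (K + 1),
            likelihood (lratio P ch.W2) (c j') (fun i => (y i).2) n / Real.exp γ) := by
  obtain ⟨h1, h2⟩ := decodeTime_le_densityHit ch hP γ c j hc hy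
  set T := densityHit ch P γ (fun i => (c j i, y i)) with hT
  have hK' : (0 : ℝ) < K := Nat.cast_pos.2 hK
  have e1 := decode_error_le (lratio_nonneg hP ch.W1_nonneg) (Real.exp_pos γ) c
    (fun i => (y i).1) j
  have e2 := decode_error_le (lratio_nonneg hP ch.W2_nonneg) (Real.exp_pos γ) c
    (fun i => (y i).2) j
  have ht : ∀ τ : ℕ, τ ≤ T → (if τ = K then (1 : ℝ) else 0) ≤ T / K := by
    intro τ hτ
    split_ifs with h
    · rw [one_le_div hK']
      exact_mod_cast h ▸ hτ
    · positivity
  have hm : ((max (decodeTime (lratio P ch.W1) (Real.exp γ) c fun i => (y i).1)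
      (decodeTime (lratio P ch.W2) (Real.exp γ) c fun i => (y i).2) : ℕ) : ℝ) ≤ T := by
    exact_mod_cast max_le h1 h2
  have e3 := mul_le_mul_of_nonneg_left (add_le_add (e1.trans (add_le_add_left (ht _ h1) _))
    (e2.trans (add_le_add_left (ht _ h2) _))) hΛ
  refine (add_le_add hm e3).trans_eq ?_
  ring

/-- Random coding: some codebook has small length and error probability simultaneously. -/
theorem exists_codebook [NeZero M] (ch : BroadcastChannel 𝓧 𝓨₁ 𝓨₂) {P : 𝓧 → ℝ}
    (hP : ∀ x, 0 ≤ P x) (hP1 : ∑ x, P x = 1) (γ : ℝ) {Λ : ℝ} (hΛ : 0 ≤ Λ) (hK : 0 < K) :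
    ∃ c : Fin M → Fin K → 𝓧,
      codebookLength ch P (Real.exp γ) c
        + Λ * (codebookError ch.joint Prod.fst (lratio P ch.W1) (Real.exp γ) c
          + codebookError ch.joint Prod.snd (lratio P ch.W2) (Real.exp γ) c)
      ≤ (1 + 2 * Λ / K) * iidE (inOut P ch.joint)
            (fun z : Fin K → 𝓧 × (𝓨₁ × 𝓨₂) => (densityHit ch P γ z : ℝ))
        + 2 * Λ * (M * ((K + 1) / Real.exp γ)) := by
  have hQ : ∀ x : Fin K → 𝓧, 0 ≤ ∏ i, P (x i) := fun x => Finset.prod_nonneg fun i _ => hP _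
  have hQ1 : ∑ x : Fin K → 𝓧, ∏ i, P (x i) = 1 := sum_prod_eq_one hP1
  have hM : (0 : ℝ) < M := Nat.cast_pos.2 (Nat.pos_of_ne_zero (NeZero.ne M))
  obtain ⟨c, hc⟩ := exists_le_iidE (ι := Fin M) hQ hQ1 fun c =>
    codebookLength ch P (Real.exp γ) c
        + Λ * (codebookError ch.joint Prod.fst (lratio P ch.W1) (Real.exp γ) c
          + codebookError ch.joint Prod.snd (lratio P ch.W2) (Real.exp γ) c)
  refine ⟨c, hc.trans ?_⟩
  set t := iidE (inOut P ch.joint)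
    (fun z : Fin K → 𝓧 × (𝓨₁ × 𝓨₂) => (densityHit ch P γ z : ℝ)) with ht
  set A1 : Fin M → Fin M → (Fin M → Fin K → 𝓧) → ℝ := fun j j' c => blockE ch.joint (c j)
    fun y => ∑ n ∈ Finset.range (K + 1),
      likelihood (lratio P ch.W1) (c j') (fun i => (y i).1) n / Real.exp γ with hA1
  set A2 : Fin M → Fin M → (Fin M → Fin K → 𝓧) → ℝ := fun j j' c => blockE ch.joint (c j)
    fun y => ∑ n ∈ Finset.range (K + 1),
      likelihood (lratio P ch.W2) (c j') (fun i => (y i).2) n / Real.exp γ with hA2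
  have hb1 : ∀ j, ∀ j' ∈ Finset.univ.erase j, iidE (fun x : Fin K → 𝓧 => ∏ i, P (x i))
      (A1 j j') ≤ (K + 1) / Real.exp γ := fun j j' hj =>
    iidE_blockE_likelihood_le hP hP1 ch.joint_nonneg ch.sum_joint Prod.fst
      (lratio_nonneg hP ch.W1_nonneg) (sum_mul_lratio_le_one P ch.W1) (Real.exp_pos γ)
      (Finset.ne_of_mem_erase hj)
  have hb2 : ∀ j, ∀ j' ∈ Finset.univ.erase j, iidE (fun x : Fin K → 𝓧 => ∏ i, P (x i))
      (A2 j j') ≤ (K + 1) / Real.exp γ := fun j j' hj =>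
    iidE_blockE_likelihood_le hP hP1 ch.joint_nonneg ch.sum_joint Prod.snd
      (lratio_nonneg hP ch.W2_nonneg) (sum_mul_lratio_le_one P ch.W2) (Real.exp_pos γ)
      (Finset.ne_of_mem_erase hj)
  have hcost : ∀ c : Fin M → Fin K → 𝓧, (∀ j, ∏ i, P (c j i) ≠ 0) →
      codebookLength ch P (Real.exp γ) c
        + Λ * (codebookError ch.joint Prod.fst (lratio P ch.W1) (Real.exp γ) c
          + codebookError ch.joint Prod.snd (lratio P ch.W2) (Real.exp γ) c)
      ≤ (M : ℝ)⁻¹ * ∑ j, ((1 + 2 * Λ / K) * blockE ch.joint (c j)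
            (fun y => (densityHit ch P γ (fun i => (c j i, y i)) : ℝ))
          + Λ * (∑ j' ∈ Finset.univ.erase j, A1 j j' c)
          + Λ * (∑ j' ∈ Finset.univ.erase j, A2 j j' c)) := by
    intro c hc
    simp only [codebookLength, codebookError, hA1, hA2]
    rw [← mul_add, mul_left_comm, ← mul_add]
    refine mul_le_mul_of_nonneg_left ?_ (inv_nonneg.2 hM.le)
    rw [← Finset.sum_add_distrib, Finset.mul_sum, ← Finset.sum_add_distrib]
    refine Finset.sum_le_sum fun j _ => ?_
    rw [← blockE_add, ← blockE_const_mul, ← blockE_add, ← blockE_sum, ← blockE_sum,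
      ← blockE_const_mul, ← blockE_const_mul, ← blockE_const_mul, ← blockE_add, ← blockE_add]
    refine blockE_mono ch.joint_nonneg _ fun y hy => ?_
    exact decoding_cost_le ch hP γ hΛ hK c j
      (fun i => (Finset.prod_ne_zero_iff.1 (hc j)) i (Finset.mem_univ i)) hy
  refine (iidE_mono hQ fun c hc => hcost c hc).trans ?_
  rw [iidE_const_mul, iidE_sum]
  have hcard : ∀ j : Fin M, ((Finset.univ.erase j).card : ℝ) ≤ M := by
    intro j
    exact_mod_cast (Finset.card_le_univ _).trans_eq (Fintype.card_fin M)
  have hj : ∀ j : Fin M, iidE (fun x : Fin K → 𝓧 => ∏ i, P (x i)) (fun c =>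
      (1 + 2 * Λ / K) * blockE ch.joint (c j)
            (fun y => (densityHit ch P γ (fun i => (c j i, y i)) : ℝ))
          + Λ * (∑ j' ∈ Finset.univ.erase j, A1 j j' c)
          + Λ * (∑ j' ∈ Finset.univ.erase j, A2 j j' c))
      ≤ (1 + 2 * Λ / K) * t + 2 * Λ * (M * ((K + 1) / Real.exp γ)) := by
    intro j
    rw [iidE_add, iidE_add, iidE_const_mul, iidE_const_mul, iidE_const_mul, iidE_sum, iidE_sum]
    have h0 : iidE (fun x : Fin K → 𝓧 => ∏ i, P (x i)) (fun c : Fin M → Fin K → 𝓧 =>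
        blockE ch.joint (c j) (fun y => (densityHit ch P γ (fun i => (c j i, y i)) : ℝ))) = t := by
      rw [iidE_eval hQ1 j (fun x => blockE ch.joint x
        (fun y => (densityHit ch P γ (fun i => (x i, y i)) : ℝ))), sum_prod_mul_blockE]
    have h3 : ((Finset.univ.erase j).card : ℝ) * ((K + 1) / Real.exp γ)
        ≤ M * ((K + 1) / Real.exp γ) := by
      have := hcard j
      gcongr
    have h1 := (Finset.sum_le_card_nsmul _ _ _ (hb1 j)).trans
      ((nsmul_eq_mul _ _).trans_le h3)
    have h2 := (Finset.sum_le_card_nsmul _ _ _ (hb2 j)).trans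
      ((nsmul_eq_mul _ _).trans_le h3)
    rw [h0]
    have := mul_le_mul_of_nonneg_left h1 hΛ
    have := mul_le_mul_of_nonneg_left h2 hΛ
    linarith
  calc _ ≤ (M : ℝ)⁻¹ * ∑ j : Fin M,
          ((1 + 2 * Λ / K) * t + 2 * Λ * (M * ((K + 1) / Real.exp γ))) := by
        refine mul_le_mul_of_nonneg_left (Finset.sum_le_sum fun j _ => hj j) (inv_nonneg.2 hM.le)
    _ = _ := by
        rw [Finset.sum_const, Finset.card_univ, Fintype.card_fin, nsmul_eq_mul,
          inv_mul_cancel_left₀ hM.ne']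

end CodebookExistence

section ChannelMeasure

variable {𝓧 𝓨 : Type} [Fintype 𝓨] [MeasurableSpace 𝓨] [MeasurableSingletonClass 𝓨]

/-- The output law of the channel `V` with input `x`. -/
def outLaw (V : 𝓧 → 𝓨 → ℝ) (x : 𝓧) : Measure 𝓨 :=
  ∑ y, ENNReal.ofReal (V x y) • Measure.dirac y

lemma outLaw_singleton (V : 𝓧 → 𝓨 → ℝ) (x : 𝓧) (y : 𝓨) :
    outLaw V x {y} = ENNReal.ofReal (V x y) := by
  classical
  simp only [outLaw, Measure.finsetSum_apply, Measure.smul_apply, smul_eq_mul,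
    Measure.dirac_apply' _ (measurableSet_singleton y), Set.indicator_apply,
    Set.mem_singleton_iff, Pi.one_apply, mul_ite, mul_one, mul_zero]
  simp

lemma isProbabilityMeasure_outLaw {V : 𝓧 → 𝓨 → ℝ} (hV : ∀ x y, 0 ≤ V x y)
    (hV1 : ∀ x, ∑ y, V x y = 1) (x : 𝓧) : IsProbabilityMeasure (outLaw V x) := by
  constructor
  simp only [outLaw, Measure.finsetSum_apply, Measure.smul_apply, smul_eq_mul, measure_univ,
    mul_one]
  rw [← ENNReal.ofReal_sum_of_nonneg fun y _ => hV x y, hV1, ENNReal.ofReal_one]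

/-- The law of the output sequence when the input sequence is `s`. -/
def seqLaw (V : 𝓧 → 𝓨 → ℝ) (s : ℕ → 𝓧) : Measure (ℕ → 𝓨) :=
  Measure.infinitePi fun n => outLaw V (s n)

lemma seqLaw_prefix {V : 𝓧 → 𝓨 → ℝ} (hV : ∀ x y, 0 ≤ V x y) (hV1 : ∀ x, ∑ y, V x y = 1)
    (s : ℕ → 𝓧) {n : ℕ} (y : Fin n → 𝓨) :
    seqLaw V s ((fun (w : ℕ → 𝓨) (i : Fin n) => w i) ⁻¹' {y})
      = ENNReal.ofReal (∏ i : Fin n, V (s i) (y i)) := by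
  have := fun n => isProbabilityMeasure_outLaw hV hV1 (s n)
  set t : ℕ → Set 𝓨 := fun k => if h : k < n then {y ⟨k, h⟩} else ∅ with ht
  have e : (fun (w : ℕ → 𝓨) (i : Fin n) => w i) ⁻¹' {y}
      = Set.pi (Finset.range n : Finset ℕ) t := by
    ext w
    simp only [Set.mem_preimage, Set.mem_singleton_iff, Set.mem_pi, Finset.coe_range,
      Set.mem_Iio, ht]
    constructor
    · rintro h k hk
      rw [dif_pos hk, Set.mem_singleton_iff, ← h]
    · intro h
      funext i
      have := h i i.2
      rwa [dif_pos i.2, Set.mem_singleton_iff] at this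
  rw [e, seqLaw, Measure.infinitePi_pi, Finset.prod_range, ENNReal.ofReal_prod_of_nonneg]
  · refine Finset.prod_congr rfl fun i _ => ?_
    rw [ht]
    simp only [i.2, dif_pos]
    exact outLaw_singleton V _ _
  · exact fun i _ => hV _ _
  · intro k hk
    rw [ht]
    simp only [Finset.mem_range.1 hk, dif_pos]
    exact measurableSet_singleton _

lemma measurable_prefix (n : ℕ) : Measurable fun (w : ℕ → 𝓨) (i : Fin n) => w i :=
  measurable_pi_lambda _ fun i => measurable_pi_apply _

lemma lintegral_seqLaw_prefix {V : 𝓧 → 𝓨 → ℝ} (hV : ∀ x y, 0 ≤ V x y)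
    (hV1 : ∀ x, ∑ y, V x y = 1) (s : ℕ → 𝓧) {n : ℕ} {G : (Fin n → 𝓨) → ℝ} (hG : ∀ y, 0 ≤ G y) :
    ∫⁻ w, ENNReal.ofReal (G fun i => w i) ∂(seqLaw V s)
      = ENNReal.ofReal (blockE V (fun i : Fin n => s i) G) := by
  rw [← lintegral_map (f := fun y => ENNReal.ofReal (G y)) (Measurable.of_discrete)
    (measurable_prefix n), lintegral_fintype, blockE, ENNReal.ofReal_sum_of_nonneg]
  · refine Finset.sum_congr rfl fun y _ => ?_
    rw [Measure.map_apply (measurable_prefix n) (measurableSet_singleton y),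
      seqLaw_prefix hV hV1, mul_comm, ENNReal.ofReal_mul]
    exact Finset.prod_nonneg fun i _ => hV _ _
  · exact fun y _ => mul_nonneg (Finset.prod_nonneg fun i _ => hV _ _) (hG y)

variable {M : ℕ}

/-- The law of (common randomness, message, outputs) when the common randomness has weights `ρ`,
the message is uniform and the encoder sends `s u j`. -/
def codeLaw (V : 𝓧 → 𝓨 → ℝ) (ρ : Fin 3 → ℝ) (s : Fin 3 → Fin M → ℕ → 𝓧) :
    Measure (Fin 3 × Fin M × (ℕ → 𝓨)) :=
  ∑ u, ∑ j, ENNReal.ofReal (ρ u * (M : ℝ)⁻¹) •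
    Measure.map (fun w => (u, j, w)) (seqLaw V (s u j))

lemma lintegral_codeLaw {V : 𝓧 → 𝓨 → ℝ} (hV : ∀ x y, 0 ≤ V x y)
    (hV1 : ∀ x, ∑ y, V x y = 1) {ρ : Fin 3 → ℝ} (hρ : ∀ u, 0 ≤ ρ u)
    (s : Fin 3 → Fin M → ℕ → 𝓧) {n : ℕ}
    {G : Fin 3 → Fin M → (Fin n → 𝓨) → ℝ} (hG : ∀ u j y, 0 ≤ G u j y) :
    ∫⁻ ω, ENNReal.ofReal (G ω.1 ω.2.1 fun i => ω.2.2 i) ∂(codeLaw V ρ s)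
      = ENNReal.ofReal (∑ u, ρ u * ((M : ℝ)⁻¹ * ∑ j, blockE V (fun i : Fin n => s u j i) (G u j))) := by
  have hm : Measurable fun ω : Fin 3 × Fin M × (ℕ → 𝓨) =>
      ENNReal.ofReal (G ω.1 ω.2.1 fun i => ω.2.2 i) := by
    have h1 : Measurable fun ω : Fin 3 × Fin M × (Fin n → 𝓨) =>
        ENNReal.ofReal (G ω.1 ω.2.1 ω.2.2) := Measurable.of_discrete
    exact h1.comp (measurable_fst.prodMk ((measurable_fst.comp measurable_snd).prodMk
      ((measurable_prefix n).comp (measurable_snd.comp measurable_snd))))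
  have hb : ∀ u j, 0 ≤ blockE V (fun i : Fin n => s u j i) (G u j) := fun u j =>
    Finset.sum_nonneg fun y _ => mul_nonneg (Finset.prod_nonneg fun i _ => hV _ _) (hG u j y)
  have hM : (0 : ℝ) ≤ (M : ℝ)⁻¹ := inv_nonneg.2 (Nat.cast_nonneg M)
  simp only [codeLaw]
  rw [lintegral_finsetSum_measure, ENNReal.ofReal_sum_of_nonneg]
  · refine Finset.sum_congr rfl fun u _ => ?_
    rw [lintegral_finsetSum_measure, ← mul_assoc, Finset.mul_sum, ENNReal.ofReal_sum_of_nonneg]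
    · refine Finset.sum_congr rfl fun j _ => ?_
      rw [lintegral_smul_measure, lintegral_map hm (by fun_prop), smul_eq_mul,
        ENNReal.ofReal_mul (mul_nonneg (hρ u) hM)]
      congr 1
      exact lintegral_seqLaw_prefix hV hV1 (s u j) (hG u j)
    · exact fun j _ => mul_nonneg (mul_nonneg (hρ u) hM) (hb u j)
  · exact fun u _ => mul_nonneg (hρ u) (mul_nonneg hM (Finset.sum_nonneg fun j _ => hb u j))

lemma codeLaw_prefix {V : 𝓧 → 𝓨 → ℝ} (hV : ∀ x y, 0 ≤ V x y)
    (hV1 : ∀ x, ∑ y, V x y = 1) {ρ : Fin 3 → ℝ} (hρ : ∀ u, 0 ≤ ρ u)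
    (s : Fin 3 → Fin M → ℕ → 𝓧) {n : ℕ} (B : Fin 3 → Fin M → (Fin n → 𝓨) → Prop)
    [∀ u j y, Decidable (B u j y)] :
    codeLaw V ρ s {ω | B ω.1 ω.2.1 fun i => ω.2.2 i}
      = ENNReal.ofReal (∑ u, ρ u * ((M : ℝ)⁻¹ * ∑ j, blockE V (fun i : Fin n => s u j i)
          fun y => if B u j y then 1 else 0)) := by
  have hm : MeasurableSet {ω : Fin 3 × Fin M × (ℕ → 𝓨) | B ω.1 ω.2.1 fun i => ω.2.2 i} := by
    have h1 : MeasurableSet {ω : Fin 3 × Fin M × (Fin n → 𝓨) | B ω.1 ω.2.1 ω.2.2} :=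
      MeasurableSet.of_discrete
    exact (measurable_fst.prodMk ((measurable_fst.comp measurable_snd).prodMk
      ((measurable_prefix n).comp (measurable_snd.comp measurable_snd)))) h1
  rw [← lintegral_codeLaw hV hV1 hρ s (fun u j y => by split_ifs <;> norm_num),
    ← lintegral_indicator_one hm]
  refine lintegral_congr fun ω => ?_
  simp only [Set.indicator_apply, Set.mem_ofPred_eq, Pi.one_apply]
  split_ifs <;> simp

end ChannelMeasure

section CodeConstruction

variable {𝓧 𝓨₁ 𝓨₂ : Type} {K M : ℕ} [Fintype 𝓧] [Fintype 𝓨₁] [Fintype 𝓨₂]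

/-- Common randomness: value `0` (decode at once) with probability `ε'`, value `1` otherwise. -/
def stopWeight (ε' : ℝ) : Fin 3 → ℝ := ![ε', 1 - ε', 0]

lemma sum_stopWeight_mul (ε' : ℝ) (F : Fin 3 → ℝ) :
    ∑ u, stopWeight ε' u * F u = ε' * F 0 + (1 - ε') * F 1 := by
  simp [stopWeight, Fin.sum_univ_three]

/-- Extend a codebook by a constant input after time `K`. -/
def extendCodebook [Nonempty 𝓧] (c : Fin M → Fin K → 𝓧) (j : Fin M) (n : ℕ) : 𝓧 :=
  if h : n < K then c j ⟨n, h⟩ else Classical.arbitrary 𝓧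

lemma extendCodebook_coe [Nonempty 𝓧] (c : Fin M → Fin K → 𝓧) (j : Fin M) (i : Fin K) :
    extendCodebook c j i = c j i := by simp [extendCodebook]

lemma sum_mul_ite_eq {ι : Type} [Fintype ι] [DecidableEq ι] (a : ℝ) (F : ι → ℝ) (j : ι) :
    a * ∑ i, (if i = j then F i else 0) = a * F j := by simp

set_option maxHeartbeats 1000000 in
/-- A codebook together with immediate stopping with probability `ε'` yields a VLSF code. -/
theorem nonempty_vlsfCode [NeZero M] [Nonempty 𝓧] (ch : BroadcastChannel 𝓧 𝓨₁ 𝓨₂) (P : 𝓧 → ℝ)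
    (θ : ℝ) (c : Fin M → Fin K → 𝓧) {ε' l ε : ℝ} (h0 : 0 ≤ ε') (h1 : ε' ≤ 1)
    (hlen : (1 - ε') * codebookLength ch P θ c ≤ l)
    (herr1 : ε' + (1 - ε') * codebookError ch.joint Prod.fst (lratio P ch.W1) θ c ≤ ε)
    (herr2 : ε' + (1 - ε') * codebookError ch.joint Prod.snd (lratio P ch.W2) θ c ≤ ε) :
    Nonempty (VLSFCode ch l M ε) := by
  classical
  let _ : MeasurableSpace (𝓨₁ × 𝓨₂) := ⊤
  have hM : (M : ℝ) ≠ 0 := Nat.cast_ne_zero.2 (NeZero.ne M)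
  have hV := ch.joint_nonneg
  have hV1 := ch.sum_joint
  have hρ : ∀ u, 0 ≤ stopWeight ε' u := by
    intro u
    fin_cases u <;> simp [stopWeight, h0, h1]
  have hρ1 : ∑ u, stopWeight ε' u = 1 := by simp [stopWeight, Fin.sum_univ_three]
  set s : Fin 3 → Fin M → ℕ → 𝓧 := fun _ j => extendCodebook c j with hs
  have hsK : ∀ u j, (fun i : Fin K => s u j i) = c j := fun u j =>
    funext fun i => extendCodebook_coe c j i
  set μ : Measure (Fin 3 × Fin M × (ℕ → 𝓨₁ × 𝓨₂)) := codeLaw ch.joint (stopWeight ε') s with hμ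
  have hevent : ∀ {n : ℕ} (B : Fin 3 → Fin M → (Fin n → 𝓨₁ × 𝓨₂) → Prop)
      [∀ u j y, Decidable (B u j y)],
      μ {ω | B ω.1 ω.2.1 fun i => ω.2.2 i}
      = ENNReal.ofReal (∑ u, stopWeight ε' u * ((M : ℝ)⁻¹ * ∑ j,
          blockE ch.joint (fun i : Fin n => s u j i) fun y => if B u j y then 1 else 0)) :=
    fun B _ => codeLaw_prefix hV hV1 hρ s B
  have hle1 : ∀ (j : Fin M) (F : (Fin K → 𝓨₁ × 𝓨₂) → Prop) [∀ y, Decidable (F y)],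
      blockE ch.joint (c j) (fun y => if F y then 1 else 0) ≤ 1 := fun j F _ =>
    (blockE_mono hV _ (G := fun _ => 1) fun y _ => by split_ifs <;> norm_num).trans_eq
      (blockE_const hV1 _ _)
  have hMsum : ∀ a : ℝ, (M : ℝ)⁻¹ * ∑ _j : Fin M, a = a := by
    intro a
    rw [Finset.sum_const, Finset.card_univ, Fintype.card_fin, nsmul_eq_mul,
      inv_mul_cancel_left₀ hM]
  have herr : ∀ {e : ℝ} (E : Fin M → (Fin K → 𝓨₁ × 𝓨₂) → Prop)
      (B : Fin 3 → Fin M → (Fin K → 𝓨₁ × 𝓨₂) → Prop) [∀ j y, Decidable (E j y)]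
      [∀ u j y, Decidable (B u j y)],
      (M : ℝ)⁻¹ * ∑ j, blockE ch.joint (c j) (fun y => if E j y then 1 else 0) = e →
      (∀ j y, B 1 j y ↔ E j y) → ε' + (1 - ε') * e ≤ ε →
      μ {ω | B ω.1 ω.2.1 fun i => ω.2.2 i} ≤ ENNReal.ofReal ε := by
    intro e E B _ _ he hB hε
    rw [hevent B]
    refine ENNReal.ofReal_le_ofReal (le_trans ?_ hε)
    rw [sum_stopWeight_mul]
    simp only [hsK, hB, he]
    gcongr
    refine mul_le_of_le_one_right h0 ?_
    refine (mul_le_mul_of_nonneg_left (Finset.sum_le_sum fun j _ => hle1 j (B 0 j))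
      (by positivity)).trans_eq (hMsum 1)
  refine ⟨{
    Ω := Fin 3 × Fin M × (ℕ → 𝓨₁ × 𝓨₂)
    mΩ := inferInstance
    μ := μ
    hμ := ?_
    u := fun ω => ω.1
    J := fun ω => ω.2.1
    Y1seq := fun ω i => (ω.2.2 i).1
    Y2seq := fun ω i => (ω.2.2 i).2
    f := fun n u j => s u j n
    τ1 := fun ω => if ω.1 = 0 then 0 else
      decodeTime (lratio P ch.W1) θ c fun i : Fin K => (ω.2.2 i).1
    τ2 := fun ω => if ω.1 = 0 then 0 else
      decodeTime (lratio P ch.W2) θ c fun i : Fin K => (ω.2.2 i).2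
    g1 := fun n _ y => decodeMsg (lratio P ch.W1) θ c n fun i : Fin K => y i
    g2 := fun n _ y => decodeMsg (lratio P ch.W2) θ c n fun i : Fin K => y i
    J_uniform := ?_
    chan_law := ?_
    τ1_stopping := ?_
    τ2_stopping := ?_
    g1_adapted := fun n _ y y' h => decodeMsg_congr _ _ _ fun i hi => h i hi
    g2_adapted := fun n _ y y' h => decodeMsg_congr _ _ _ fun i hi => h i hi
    avg_len := ?_
    err1 := ?_
    err2 := ?_ }⟩
  · constructor
    have := hevent (n := 0) fun _ _ _ => True
    simp only [Set.ofPred_true, if_true, blockE_const hV1, hMsum, mul_one, hρ1,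
      ENNReal.ofReal_one] at this
    exact this
  · intro j
    have := hevent (n := 0) fun _ j' _ => j' = j
    rw [this]
    have hb : ∀ u j', blockE ch.joint (fun i : Fin 0 => s u j' i)
        (fun _ => if j' = j then (1 : ℝ) else 0) = if j' = j then 1 else 0 := fun u j' =>
      blockE_const hV1 _ _
    simp only [hb, sum_mul_ite_eq _ (fun _ => (1 : ℝ)), mul_one]
    rw [← Finset.sum_mul, hρ1, one_mul, ENNReal.ofReal_inv_of_pos (by positivity),
      ENNReal.ofReal_natCast]
  · intro u0 j0 n y1 y2
    have e1 := hevent (n := n) fun u j y => u = u0 ∧ j = j0 ∧ y = fun i => (y1 i, y2 i)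
    have e2 := hevent (n := 0) fun u j _ => u = u0 ∧ j = j0
    have e3 : {ω : Fin 3 × Fin M × (ℕ → 𝓨₁ × 𝓨₂) | ω.1 = u0 ∧ ω.2.1 = j0 ∧
        (∀ i : Fin n, (ω.2.2 i).1 = y1 i) ∧ (∀ i : Fin n, (ω.2.2 i).2 = y2 i)}
        = {ω | ω.1 = u0 ∧ ω.2.1 = j0 ∧ (fun i : Fin n => ω.2.2 i) = fun i => (y1 i, y2 i)} := by
      ext ω
      simp only [Set.mem_ofPred_eq, funext_iff, Prod.ext_iff, forall_and]
    rw [e3, e1, e2, ← ENNReal.ofReal_mul]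
    · congr 1
      have h2 : ∀ u j, blockE ch.joint (fun i : Fin 0 => s u j i)
          (fun _ => if u = u0 ∧ j = j0 then (1 : ℝ) else 0) = if j = j0 then
            (if u = u0 then 1 else 0) else 0 := fun u j => by
        rw [blockE_const hV1]
        split_ifs <;> simp_all
      have h3 : ∀ u j, blockE ch.joint (fun i : Fin n => s u j i)
          (fun y => if u = u0 ∧ j = j0 ∧ y = (fun i => (y1 i, y2 i)) then (1 : ℝ) else 0)
          = if j = j0 then (if u = u0 then
            ∏ i : Fin n, ch.W1 (s u0 j0 i) (y1 i) * ch.W2 (s u0 j0 i) (y2 i) else 0) else 0 := by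
        intro u j
        rw [blockE]
        by_cases hj : j = j0
        · by_cases hu : u = u0
          · subst hj hu
            simp [BroadcastChannel.joint]
          · simp [hu]
        · simp [hj]
      simp only [h2, h3, Finset.sum_ite_eq', Finset.mem_univ, if_true, mul_ite, mul_zero]
      ring
    · exact Finset.sum_nonneg fun u _ => mul_nonneg (hρ u) (mul_nonneg (by positivity)
        (Finset.sum_nonneg fun j _ => Finset.sum_nonneg fun y _ =>
          mul_nonneg (Finset.prod_nonneg fun i _ => hV _ _) (by split_ifs <;> norm_num)))
  · intro n ω ω' hu hy
    simp only [← hu]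
    split_ifs
    · exact Iff.rfl
    · exact decodeTime_le_iff_of_eq _ _ _ fun i hi => hy i hi
  · intro n ω ω' hu hy
    simp only [← hu]
    split_ifs
    · exact Iff.rfl
    · exact decodeTime_le_iff_of_eq _ _ _ fun i hi => hy i hi
  · have := lintegral_codeLaw hV hV1 hρ s (n := K) (G := fun u _ y => if u = 0 then 0 else
      ((max (decodeTime (lratio P ch.W1) θ c fun i => (y i).1)
        (decodeTime (lratio P ch.W2) θ c fun i => (y i).2) : ℕ) : ℝ))
      (fun u j y => by split_ifs <;> positivity)
    refine (lintegral_congr fun ω => ?_).trans_le (this.trans_le ?_)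
    · rw [← ENNReal.ofReal_natCast]
      split_ifs <;> simp
    · refine ENNReal.ofReal_le_ofReal (le_trans (le_of_eq ?_) hlen)
      rw [sum_stopWeight_mul]
      simp only [hsK, if_true, blockE_const hV1, Fin.one_eq_zero_iff, codebookLength]
      simp
  · refine herr (fun j y => decodeMsg (lratio P ch.W1) θ c
      (decodeTime (lratio P ch.W1) θ c fun i => (y i).1) (fun i => (y i).1) ≠ j)
      (fun u j y => decodeMsg (lratio P ch.W1) θ c (if u = 0 then 0 else
        decodeTime (lratio P ch.W1) θ c fun i => (y i).1) (fun i => (y i).1) ≠ j) ?_ ?_ herr1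
    · rfl
    · intro j y
      simp
  · refine herr (fun j y => decodeMsg (lratio P ch.W2) θ c
      (decodeTime (lratio P ch.W2) θ c fun i => (y i).2) (fun i => (y i).2) ≠ j)
      (fun u j y => decodeMsg (lratio P ch.W2) θ c (if u = 0 then 0 else
        decodeTime (lratio P ch.W2) θ c fun i => (y i).2) (fun i => (y i).2) ≠ j) ?_ ?_ herr2
    · rfl
    · intro j y
      simp

end CodeConstruction

section Achievability

variable {𝓧 𝓨₁ 𝓨₂ : Type} [Fintype 𝓧] [Fintype 𝓨₁] [Fintype 𝓨₂]

lemma blockE_nonneg {𝓨 : Type} [Fintype 𝓨] {K : ℕ} {V : 𝓧 → 𝓨 → ℝ} (hV : ∀ x y, 0 ≤ V x y)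
    (x : Fin K → 𝓧) {F : (Fin K → 𝓨) → ℝ} (hF : ∀ y, 0 ≤ F y) : 0 ≤ blockE V x F :=
  Finset.sum_nonneg fun y _ => mul_nonneg (Finset.prod_nonneg fun _ _ => hV _ _) (hF y)

lemma codebookError_nonneg {𝓨 𝓨' : Type} [Fintype 𝓨] {K M : ℕ} [NeZero M] {V : 𝓧 → 𝓨 → ℝ}
    (hV : ∀ x y, 0 ≤ V x y) (g : 𝓨 → 𝓨') (r : 𝓧 → 𝓨' → ℝ) (θ : ℝ) (c : Fin M → Fin K → 𝓧) :
    0 ≤ codebookError V g r θ c :=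
  mul_nonneg (by positivity) (Finset.sum_nonneg fun j _ => blockE_nonneg hV _ fun y => by
    split_ifs <;> norm_num)

lemma codebookLength_nonneg {K M : ℕ} (ch : BroadcastChannel 𝓧 𝓨₁ 𝓨₂) (P : 𝓧 → ℝ) (θ : ℝ)
    (c : Fin M → Fin K → 𝓧) : 0 ≤ codebookLength ch P θ c :=
  mul_nonneg (by positivity) (Finset.sum_nonneg fun j _ => blockE_nonneg ch.joint_nonneg _
    fun y => Nat.cast_nonneg _)

/-- A bound on the mean of the joint hitting time produces a code of error `ε`: the decoder errs
with probability about `1 / l` and stops immediately with probability `ε - 1 / l`. -/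
theorem nonempty_vlsfCode_of_densityHit [Nonempty 𝓧] {K M : ℕ}
    (ch : BroadcastChannel 𝓧 𝓨₁ 𝓨₂) {P : 𝓧 → ℝ} (hP : ∀ x, 0 ≤ P x) (hP1 : ∑ x, P x = 1)
    {γ l D ε : ℝ} (hε : ε < 1) (hl : 0 < l) (hlε : 1 / l ≤ ε) (hD : 1 ≤ D)
    (hDl : (1 - ε + 1 / l) * D = l) (hK : 4 * l * D ^ 2 ≤ K) (hM : 1 ≤ M)
    (hMK : 4 * l * D * (M * (K + 1)) ≤ Real.exp γ)
    (ht : iidE (inOut P ch.joint)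
      (fun z : Fin K → 𝓧 × (𝓨₁ × 𝓨₂) => (densityHit ch P γ z : ℝ)) ≤ D - 1) :
    Nonempty (VLSFCode ch l M ε) := by
  have : NeZero M := ⟨by omega⟩
  have hD0 : 0 < D := by linarith
  have hK0 : (0 : ℝ) < K := lt_of_lt_of_le (by positivity) hK
  have hKpos : 0 < K := by exact_mod_cast hK0
  have hl1 : 0 < 1 / l := by positivity
  obtain ⟨c, hc⟩ := exists_codebook (M := M) ch hP hP1 γ (Λ := l * D) (by positivity) hKpos
  set t := iidE (inOut P ch.joint)
    (fun z : Fin K → 𝓧 × (𝓨₁ × 𝓨₂) => (densityHit ch P γ z : ℝ)) with htdef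
  set e1 := codebookError ch.joint Prod.fst (lratio P ch.W1) (Real.exp γ) c with he1
  set e2 := codebookError ch.joint Prod.snd (lratio P ch.W2) (Real.exp γ) c with he2
  set L := codebookLength ch P (Real.exp γ) c with hL
  have h1 : 0 ≤ e1 := codebookError_nonneg ch.joint_nonneg _ _ _ _
  have h2 : 0 ≤ e2 := codebookError_nonneg ch.joint_nonneg _ _ _ _
  have h3 : 0 ≤ L := codebookLength_nonneg _ _ _ _
  have h4 : 2 * (l * D) / K * t ≤ 1 / 2 := by
    have : 2 * (l * D) / K * t ≤ 2 * (l * D) / K * D := by gcongr; linarith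
    refine this.trans ?_
    rw [div_mul_eq_mul_div, div_le_iff₀ hK0]
    nlinarith
  have h5 : 2 * (l * D) * (M * ((K + 1) / Real.exp γ)) ≤ 1 / 2 := by
    have : 2 * (l * D) * (M * ((K + 1) / Real.exp γ))
        = (4 * l * D * (M * (K + 1))) / Real.exp γ / 2 := by ring
    rw [this]
    have := (div_le_one (Real.exp_pos γ)).2 hMK
    linarith
  have h6 : L + l * D * (e1 + e2) ≤ D := by
    have : (1 + 2 * (l * D) / K) * t = t + 2 * (l * D) / K * t := by ring
    linarith
  have hΛ : 0 < l * D := by positivity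
  have hLD : L ≤ D := by
    have : 0 ≤ l * D * (e1 + e2) := by positivity
    linarith
  have herr : ∀ e, 0 ≤ e → e ≤ e1 + e2 → (ε - 1 / l) + (1 - (ε - 1 / l)) * e ≤ ε := by
    intro e he hle
    have h7 : l * D * e ≤ D := by
      have := mul_le_mul_of_nonneg_left hle hΛ.le
      linarith
    have h8 : e ≤ 1 / l := by
      rw [le_div_iff₀ hl]
      have : D * (e * l) ≤ D * 1 := by linarith
      exact le_of_mul_le_mul_left this hD0
    have h9 : (1 - (ε - 1 / l)) * e ≤ 1 * e := by
      gcongr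
      linarith
    linarith
  refine nonempty_vlsfCode ch P (Real.exp γ) c (ε' := ε - 1 / l) (by linarith) (by linarith) ?_
    (herr e1 h1 (by linarith)) (herr e2 h2 (by linarith))
  have h10 : (1 - ε + 1 / l) * L ≤ (1 - ε + 1 / l) * D :=
    mul_le_mul_of_nonneg_left hLD (by linarith)
  linarith

end Achievability

section Asymptotics

lemma hitting_bound_le {C v c L γ : ℝ} (hC : 0 < C) (hv : 0 ≤ v) (hc : 0 ≤ c)
    (hγ : γ = C * L - √(v * L / (2 * π)) - C * c * √√C * √√L) :
    γ / C + √v / (2 * C) * √(2 * γ / (π * C)) + c * √√γ ≤ L := by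
  have hπ := Real.pi_pos
  have hγL : γ ≤ C * L := by
    rw [hγ]
    have : 0 ≤ C * c * √√C * √√L := by positivity
    linarith [Real.sqrt_nonneg (v * L / (2 * π))]
  have h1 : √v / (2 * C) * √(2 * γ / (π * C)) ≤ √(v * L / (2 * π)) / C := by
    have h2 : √(2 * γ / (π * C)) ≤ √(2 * 2 * (L / (2 * π))) := by
      apply Real.sqrt_le_sqrt
      rw [div_le_iff₀ (by positivity)]
      have : 2 * 2 * (L / (2 * π)) * (π * C) = 2 * (C * L) := by field_simp
      linarith
    have h3 : √(2 * 2 * (L / (2 * π))) = 2 * √(L / (2 * π)) := by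
      rw [Real.sqrt_mul (by norm_num), Real.sqrt_mul_self (by norm_num)]
    have h4 : √(v * L / (2 * π)) = √v * √(L / (2 * π)) := by
      rw [mul_div_assoc, Real.sqrt_mul hv]
    rw [h4]
    calc _ ≤ √v / (2 * C) * (2 * √(L / (2 * π))) := by
          rw [← h3]; gcongr
      _ = _ := by field_simp
  have h5 : c * √√γ ≤ c * (√√C * √√L) := by
    rw [← Real.sqrt_mul (Real.sqrt_nonneg _), ← Real.sqrt_mul hC.le]
    gcongr
  have h6 : γ / C = L - √(v * L / (2 * π)) / C - c * (√√C * √√L) := by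
    rw [hγ]; field_simp
  linarith

lemma sqrt_sqrt_le_sqrt {x : ℝ} (hx : 1 ≤ x) : √√x ≤ √x := by
  have h1 : 1 ≤ √x := Real.one_le_sqrt.2 hx
  exact (Real.sqrt_le_left (by linarith)).2 (by nlinarith)

lemma one_le_sqrt_sqrt {x : ℝ} (hx : 1 ≤ x) : 1 ≤ √√x :=
  Real.one_le_sqrt.2 (Real.one_le_sqrt.2 hx)

lemma sqrt_sqrt_le_rpow {x δ : ℝ} (hx : 1 ≤ x) (hδ : 0 ≤ δ) : √√x ≤ x ^ ((1 : ℝ) / 4 + δ) := by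
  rw [Real.sqrt_eq_rpow, Real.sqrt_eq_rpow, ← Real.rpow_mul (by linarith)]
  exact Real.rpow_le_rpow_of_exponent_le hx (by linarith)

/-- The rounded-down number of messages loses only a logarithmic term. -/
lemma exists_nat_mul_le_exp {γ A B l : ℝ} (hl : 1 ≤ l) (hA : 0 < A) (hAB : A ≤ B * l ^ 5)
    (hB : 1 ≤ B) (hγ : Real.log B + 20 * √√l ≤ γ) :
    ∃ M : ℕ, 1 ≤ M ∧ A * M ≤ Real.exp γ ∧
      γ - Real.log (2 * B) - 20 * √√l ≤ Real.log M := by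
  have hl0 : 0 < l := by linarith
  have hlog : Real.log (B * l ^ 5) ≤ Real.log B + 20 * √√l := by
    rw [Real.log_mul (by positivity) (by positivity), Real.log_pow]
    have := one_add_log_le hl0
    push_cast
    linarith
  have hA1 : A ≤ Real.exp γ := by
    refine hAB.trans ((Real.log_le_iff_le_exp (by positivity)).1 (hlog.trans hγ))
  have hx1 : 1 ≤ Real.exp γ / A := (one_le_div hA).2 hA1
  have hM : 1 ≤ ⌊Real.exp γ / A⌋₊ := Nat.one_le_floor_iff _ |>.2 hx1
  have hM' : (1 : ℝ) ≤ ⌊Real.exp γ / A⌋₊ := by exact_mod_cast hM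
  refine ⟨⌊Real.exp γ / A⌋₊, hM, ?_, ?_⟩
  · have := Nat.floor_le (zero_le_one.trans hx1)
    rw [le_div_iff₀ hA] at this
    linarith
  · have h2 : Real.exp γ / A / 2 ≤ ⌊Real.exp γ / A⌋₊ := by
      have := Nat.lt_floor_add_one (Real.exp γ / A)
      linarith
    have h3 := Real.log_le_log (by positivity) h2
    rw [Real.log_div (by positivity) (by norm_num), Real.log_div (by positivity) hA.ne',
      Real.log_exp] at h3
    have h4 := Real.log_le_log hA hAB
    rw [Real.log_mul (by norm_num) (by positivity)]
    linarith

set_option maxHeartbeats 1000000 in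
/-- Choice of threshold, horizon and number of messages. -/
lemma exists_code_parameters {C v c ε : ℝ} (hC : 0 < C) (hv : 0 ≤ v) (hc : 0 ≤ c)
    (hε0 : 0 < ε) (hε1 : ε < 1) :
    ∃ c' l₀ : ℝ, 0 ≤ c' ∧ 1 ≤ l₀ ∧ ∀ l ≥ l₀, ∃ (γ D : ℝ) (K M : ℕ), 1 ≤ γ ∧ 1 / l ≤ ε ∧ 1 ≤ D ∧
      (1 - ε + 1 / l) * D = l ∧ 4 * l * D ^ 2 ≤ K ∧ 1 ≤ M ∧
      4 * l * D * (M * (K + 1)) ≤ Real.exp γ ∧ γ ≤ C * K ∧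
      γ / C + √v / (2 * C) * √(2 * γ / (π * C)) + c * √√γ ≤ D - 1 ∧
      C * l / (1 - ε) - √(v / (2 * π * (1 - ε))) * √l - c' * √√l ≤ Real.log M := by
  have hπ := Real.pi_pos
  have h1ε : 0 < 1 - ε := by linarith
  set κ : ℝ := 1 / (1 - ε) with hκ
  have hκ0 : 0 < κ := by positivity
  have hκε : κ * (1 - ε) = 1 := by rw [hκ]; field_simp
  set b : ℝ := C * c * √√C * √√κ with hb
  have hb0 : 0 ≤ b := by positivity
  set σ : ℝ := √(v / (2 * π * (1 - ε))) with hσ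
  have hσ0 : 0 ≤ σ := Real.sqrt_nonneg _
  set B : ℝ := 4 * κ * (4 * κ ^ 2 + 2) + 1 with hB
  have hB1 : 1 ≤ B := by
    have : 0 ≤ 4 * κ * (4 * κ ^ 2 + 2) := by positivity
    linarith
  have hlogB : 0 ≤ Real.log B := Real.log_nonneg hB1
  have hlog2B : 0 ≤ Real.log (2 * B) := Real.log_nonneg (by linarith)
  set S : ℝ := σ + C * (κ ^ 2 + 1) + b + (Real.log B + 20 + 1) with hS
  have hS0 : 0 < S := by positivity
  refine ⟨C * (κ ^ 2 + 1) + b + Real.log (2 * B) + 20, max (max 1 (1 / ε)) ((S / (C * κ)) ^ 2),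
    by positivity, le_max_of_le_left (le_max_left _ _), fun l hl => ?_⟩
  have hl1 : 1 ≤ l := (le_max_left _ _).trans ((le_max_left _ _).trans hl)
  have hlε : 1 / ε ≤ l := (le_max_right _ _).trans ((le_max_left _ _).trans hl)
  have hlS : (S / (C * κ)) ^ 2 ≤ l := (le_max_right _ _).trans hl
  have hl0 : 0 < l := by linarith
  have hinv : 1 / l ≤ ε := by
    rw [div_le_iff₀ hl0]
    rw [div_le_iff₀ hε0] at hlε
    linarith
  have hinv0 : 0 < 1 / l := by positivity
  have hd0 : 0 < 1 - ε + 1 / l := by linarith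
  set D : ℝ := l / (1 - ε + 1 / l) with hD
  have hD1 : 1 ≤ D := by
    rw [hD, one_le_div hd0]
    linarith
  have hDl : (1 - ε + 1 / l) * D = l := by rw [hD]; field_simp
  have hDκ : D ≤ κ * l := by
    rw [hD, div_le_iff₀ hd0]
    have : κ * l * (1 - ε + 1 / l) = (κ * (1 - ε)) * l + κ := by field_simp
    rw [this, hκε]
    linarith
  have hDlow : κ * l - κ ^ 2 ≤ D := by
    rw [hD, le_div_iff₀ hd0]
    have : (κ * l - κ ^ 2) * (1 - ε + 1 / l)
        = (κ * (1 - ε)) * l + κ - κ * (κ * (1 - ε)) - κ ^ 2 / l := by field_simp; ring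
    rw [this, hκε]
    have : 0 ≤ κ ^ 2 / l := by positivity
    linarith
  set L : ℝ := D - 1 with hL
  have hL0 : 0 ≤ L := by linarith
  obtain ⟨γ, hγ⟩ : ∃ γ, γ = C * L - √(v * L / (2 * π)) - C * c * √√C * √√L := ⟨_, rfl⟩
  have hLl : L ≤ κ * l := by linarith
  have hs1 : √(v * L / (2 * π)) ≤ σ * √l := by
    rw [hσ, ← Real.sqrt_mul (by positivity)]
    apply Real.sqrt_le_sqrt
    have : v / (2 * π * (1 - ε)) * l = v * (κ * l) / (2 * π) := by rw [hκ]; field_simp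
    rw [this]
    gcongr
  have hs2 : C * c * √√C * √√L ≤ b * √√l := by
    have : √√L ≤ √√κ * √√l := by
      rw [← Real.sqrt_mul (Real.sqrt_nonneg _), ← Real.sqrt_mul hκ0.le]
      gcongr
    calc _ ≤ C * c * √√C * (√√κ * √√l) := by gcongr
      _ = _ := by rw [hb]; ring
  have hq1 := one_le_sqrt_sqrt hl1
  have hqs := sqrt_sqrt_le_sqrt hl1
  have hγlow : C * κ * l - σ * √l - (C * (κ ^ 2 + 1) + b) * √√l ≤ γ := by
    have h1 : C * (κ * l - κ ^ 2 - 1) ≤ C * L := by gcongr; linarith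
    have h2 : C * (κ ^ 2 + 1) ≤ C * (κ ^ 2 + 1) * √√l :=
      le_mul_of_one_le_right (by positivity) hq1
    linarith
  have hγbig : (Real.log B + 20 + 1) * √l ≤ γ := by
    have h1 : S / (C * κ) ≤ √l := Real.le_sqrt_of_sq_le hlS
    rw [div_le_iff₀ (by positivity)] at h1
    have h2 : S * √l ≤ C * κ * l := by
      calc S * √l ≤ √l * (C * κ) * √l := by gcongr
        _ = C * κ * (√l * √l) := by ring
        _ = C * κ * l := by rw [Real.mul_self_sqrt hl0.le]
    have h3 : (C * (κ ^ 2 + 1) + b) * √√l ≤ (C * (κ ^ 2 + 1) + b) * √l := by gcongr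
    have h4 : S * √l = σ * √l + (C * (κ ^ 2 + 1) + b) * √l + (Real.log B + 20 + 1) * √l := by
      rw [hS]; ring
    linarith
  have hsl : 1 ≤ √l := Real.one_le_sqrt.2 hl1
  have hγ1 : 1 ≤ γ := by
    have : (0 + 0 + 1) * 1 ≤ (Real.log B + 20 + 1) * √l := by gcongr; norm_num
    linarith
  have hγlog : Real.log B + 20 * √√l ≤ γ := by
    have h1 : Real.log B ≤ Real.log B * √l := le_mul_of_one_le_right hlogB hsl
    have h2 : (Real.log B + 20 + 1) * √l = Real.log B * √l + 20 * √l + √l := by ring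
    linarith
  set K : ℕ := ⌈4 * l * D ^ 2⌉₊ with hK
  have hKlow : 4 * l * D ^ 2 ≤ K := Nat.le_ceil _
  have hKup : (K : ℝ) + 1 ≤ (4 * κ ^ 2 + 2) * l ^ 3 := by
    have h1 : (K : ℝ) < 4 * l * D ^ 2 + 1 := Nat.ceil_lt_add_one (by positivity)
    have h2 : 4 * l * D ^ 2 ≤ 4 * l * (κ * l) ^ 2 := by gcongr
    have h3 : 1 ≤ l ^ 3 := one_le_pow₀ hl1
    linarith
  have hA : 4 * l * D * (K + 1) ≤ B * l ^ 5 := by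
    calc 4 * l * D * (K + 1) ≤ 4 * l * (κ * l) * ((4 * κ ^ 2 + 2) * l ^ 3) := by gcongr
      _ = (B - 1) * l ^ 5 := by rw [hB]; ring
      _ ≤ B * l ^ 5 := by gcongr; linarith
  obtain ⟨M, hM1, hM2, hM3⟩ := exists_nat_mul_le_exp hl1 (A := 4 * l * D * (K + 1))
    (by positivity) hA hB1 hγlog
  refine ⟨γ, D, K, M, hγ1, hinv, hD1, hDl, hKlow, hM1, ?_, ?_,
    hitting_bound_le hC hv hc hγ, ?_⟩
  · linarith
  · have h1 : γ ≤ C * L := by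
      have : 0 ≤ C * c * √√C * √√L := by positivity
      linarith [Real.sqrt_nonneg (v * L / (2 * π))]
    have h2 : L ≤ K := by
      have h2 : 1 ≤ 4 * l * D := by
        have := one_le_mul_of_one_le_of_one_le hl1 hD1
        linarith
      have h3 : 1 * D ≤ (4 * l * D) * D := mul_le_mul_of_nonneg_right h2 (by linarith)
      have h4 : (4 * l * D) * D = 4 * l * D ^ 2 := by ring
      linarith
    exact h1.trans (by gcongr)
  · have h1 : C * l / (1 - ε) = C * κ * l := by rw [hκ]; ring
    have h2 : Real.log (2 * B) ≤ Real.log (2 * B) * √√l := le_mul_of_one_le_right hlog2B hq1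
    rw [h1]
    linarith

end Asymptotics

/-- **Asymptotic achievability part of Theorem 3.**
For a broadcast channel with a unique input distribution `P*` simultaneously maximizing
`I(P, W₁)` and `I(P, W₂)`, equal capacities `C₁ = C₂ = C > 0` and dispersions
`V₁, V₂`, for every `ε ∈ (0,1)` and every `δ > 0`,
`log M*_sf(l, ε) ≥ C·l/(1−ε) − √((V₁+V₂)/(2π(1−ε)))·√l − O(l^{1/4+δ})` as `l → ∞`.
(`log M*_sf(l,ε) ≥ B` is expressed as: there exists an `M` for which an `(l,M,ε)`-VLSF
code exists and `log M ≥ B`.) -/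
theorem vlsf_asymptotic_achievability {𝓧 𝓨₁ 𝓨₂ : Type}
    [Fintype 𝓧] [Fintype 𝓨₁] [Fintype 𝓨₂] [Nonempty 𝓧]
    (ch : BroadcastChannel 𝓧 𝓨₁ 𝓨₂)
    (Pstar : 𝓧 → ℝ) (hP0 : ∀ x, 0 ≤ Pstar x) (hP1 : ∑ x, Pstar x = 1)
    (C V1 V2 : ℝ) (hCpos : 0 < C)
    (hC1 : mutualInfo Pstar ch.W1 = C) (hC2 : mutualInfo Pstar ch.W2 = C)
    (hV1 : infoVar Pstar ch.W1 = V1) (hV2 : infoVar Pstar ch.W2 = V2)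
    (hmax : ∀ P : 𝓧 → ℝ, (∀ x, 0 ≤ P x) → (∑ x, P x) = 1 →
      mutualInfo P ch.W1 ≤ C ∧ mutualInfo P ch.W2 ≤ C)
    (huniq : ∀ P : 𝓧 → ℝ, (∀ x, 0 ≤ P x) → (∑ x, P x) = 1 →
      mutualInfo P ch.W1 = C → mutualInfo P ch.W2 = C → P = Pstar)
    (ε : ℝ) (hε : ε ∈ Set.Ioo (0 : ℝ) 1) (δ : ℝ) (hδ : 0 < δ) :
    ∃ (c l0 : ℝ), ∀ l ≥ l0, ∃ M : ℕ, Nonempty (VLSFCode ch l M ε) ∧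
      C * l / (1 - ε)
        - Real.sqrt ((V1 + V2) / (2 * Real.pi * (1 - ε))) * Real.sqrt l
        - c * l ^ ((1 : ℝ) / 4 + δ)
      ≤ Real.log M := by
  have hv : 0 ≤ V1 + V2 := by
    rw [← hV1, ← hV2, infoVar, infoVar]
    exact add_nonneg
      (Finset.sum_nonneg fun x _ => Finset.sum_nonneg fun y _ =>
        mul_nonneg (mul_nonneg (hP0 x) (ch.W1_nonneg x y)) (sq_nonneg _))
      (Finset.sum_nonneg fun x _ => Finset.sum_nonneg fun y _ =>
        mul_nonneg (mul_nonneg (hP0 x) (ch.W2_nonneg x y)) (sq_nonneg _))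
  obtain ⟨c, hc, hhit⟩ := exists_iidE_jointHit_le (p := inOut Pstar ch.joint)
    (a := fun z : 𝓧 × (𝓨₁ × 𝓨₂) => Real.log (lratio Pstar ch.W1 z.1 z.2.1))
    (b := fun z => Real.log (lratio Pstar ch.W2 z.1 z.2.2)) (v := V1 + V2)
    (inOut_nonneg hP0 ch.joint_nonneg) (sum_inOut hP1 ch.sum_joint) hCpos
    ((sum_inOut_joint_fst ch Pstar fun x y => Real.log (lratio Pstar ch.W1 x y)).trans hC1)
    ((sum_inOut_joint_snd ch Pstar fun x y => Real.log (lratio Pstar ch.W2 x y)).trans hC2)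
    ((sum_inOut_joint_sub_sq ch hP0 hP1 hC1 hC2 fun P h h' => (hmax P h h').1).trans
      (by rw [hV1, hV2]))
  obtain ⟨c', l₀, hc', hl₀, hpar⟩ := exists_code_parameters hCpos hv hc hε.1 hε.2
  refine ⟨c', l₀, fun l hl => ?_⟩
  obtain ⟨γ, D, K, M, hγ, hlε, hD, hDl, hK, hM, hMK, hγK, hbound, hlog⟩ := hpar l hl
  have hl1 : 1 ≤ l := hl₀.trans hl
  refine ⟨M, nonempty_vlsfCode_of_densityHit ch hP0 hP1 hε.2 (by linarith) hlε hD hDl hK hM hMK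
    ((hhit γ hγ K hγK).trans hbound), ?_⟩
  have h := mul_le_mul_of_nonneg_left (sqrt_sqrt_le_rpow hl1 hδ.le) hc'
  linarith
end
end

section
/- (Property 1: stopping times can be pushed past t without loss.) Fix t ∈ ℤ≥0 and α ∈ [0,1], and suppose there exists an (l, M, ε)-VLSF code for a common-message discrete memoryless broadcast channel whose stopping times satisfy P[max(τ1, τ2) ≤ t] ≤ α. Then there exists an (l′, M, ε)-VLSF code for the same channel, for some l′ ≥ l, whose stopping times τ1′, τ2′ satisfy P[max(τ1′, τ2′) ≤ t] ≤ α and τ1′, τ2′ ∈ {t, t+1, t+2, …} almost surely. -/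
open MeasureTheory ProbabilityTheory Filter ENNReal Real

noncomputable section

/-- The stopping time as seen by a decoder that has observed `u0` and the first `t` outputs
of `y`, truncated at `t`. -/
def truncatedStop {Ω 𝓤 𝓨 : Type*} (u : Ω → 𝓤) (Y : Ω → ℕ → 𝓨) (τ : Ω → ℕ) (t : ℕ)
    (u0 : 𝓤) (y : ℕ → 𝓨) : ℕ :=
  sInf {n | n = t ∨ ∃ ω, u ω = u0 ∧ (∀ i < t, Y ω i = y i) ∧ τ ω = n}

section TruncatedStop

variable {Ω 𝓤 𝓨 β : Type*} {u : Ω → 𝓤} {Y : Ω → ℕ → 𝓨} {τ : Ω → ℕ}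

lemma truncatedStop_le (t : ℕ) (u0 : 𝓤) (y : ℕ → 𝓨) : truncatedStop u Y τ t u0 y ≤ t :=
  Nat.sInf_le (Or.inl rfl)

lemma truncatedStop_congr (t : ℕ) (u0 : 𝓤) {y y' : ℕ → 𝓨} (h : ∀ i < t, y i = y' i) :
    truncatedStop u Y τ t u0 y = truncatedStop u Y τ t u0 y' := by
  have key : ∀ ω, (∀ i < t, Y ω i = y i) ↔ ∀ i < t, Y ω i = y' i := fun ω =>
    forall₂_congr fun i hi => by rw [h i hi]
  simp only [truncatedStop, key]

lemma truncatedStop_eq {t : ℕ}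
    (hτ : ∀ (n : ℕ) (ω ω' : Ω), u ω = u ω' → (∀ i < n, Y ω i = Y ω' i) →
      (τ ω ≤ n ↔ τ ω' ≤ n))
    {ω : Ω} (hω : τ ω ≤ t) : truncatedStop u Y τ t (u ω) (Y ω) = τ ω := by
  refine le_antisymm (Nat.sInf_le (Or.inr ⟨ω, rfl, fun _ _ => rfl, rfl⟩)) ?_
  refine le_csInf ⟨t, Or.inl rfl⟩ ?_
  rintro n (rfl | ⟨ω', hu, hY, rfl⟩)
  · exact hω
  · by_contra! hlt
    exact hlt.not_ge ((hτ (τ ω') ω' ω hu fun i hi => hY i (by omega)).1 le_rfl)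

/-- The decoder for the stopping time `max τ t`: it reproduces at time `t` the decision taken
by `g` at the earlier time `τ ≤ t`. -/
def delayedDecoder (u : Ω → 𝓤) (Y : Ω → ℕ → 𝓨) (τ : Ω → ℕ) (t : ℕ)
    (g : ℕ → 𝓤 → (ℕ → 𝓨) → β) (n : ℕ) (u0 : 𝓤) (y : ℕ → 𝓨) : β :=
  if n = t then g (truncatedStop u Y τ t u0 y) u0 y else g n u0 y

lemma delayedDecoder_adapted {g : ℕ → 𝓤 → (ℕ → 𝓨) → β}
    (hg : ∀ (n : ℕ) (u0 : 𝓤) (y y' : ℕ → 𝓨), (∀ i < n, y i = y' i) → g n u0 y = g n u0 y')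
    (t n : ℕ) (u0 : 𝓤) (y y' : ℕ → 𝓨) (h : ∀ i < n, y i = y' i) :
    delayedDecoder u Y τ t g n u0 y = delayedDecoder u Y τ t g n u0 y' := by
  unfold delayedDecoder
  split_ifs with hn
  · subst hn
    rw [truncatedStop_congr n u0 h]
    exact hg _ _ _ _ fun i hi => h i (hi.trans_le (truncatedStop_le _ _ _))
  · exact hg _ _ _ _ h

lemma delayedDecoder_eq {t : ℕ}
    (hτ : ∀ (n : ℕ) (ω ω' : Ω), u ω = u ω' → (∀ i < n, Y ω i = Y ω' i) →
      (τ ω ≤ n ↔ τ ω' ≤ n))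
    (g : ℕ → 𝓤 → (ℕ → 𝓨) → β) (ω : Ω) :
    delayedDecoder u Y τ t g (max (τ ω) t) (u ω) (Y ω) = g (τ ω) (u ω) (Y ω) := by
  unfold delayedDecoder
  rcases le_or_gt (τ ω) t with h | h
  · rw [if_pos (max_eq_right h), truncatedStop_eq hτ h]
  · rw [max_eq_left h.le, if_neg h.ne']

lemma max_stopping
    (hτ : ∀ (n : ℕ) (ω ω' : Ω), u ω = u ω' → (∀ i < n, Y ω i = Y ω' i) →
      (τ ω ≤ n ↔ τ ω' ≤ n))
    (t n : ℕ) (ω ω' : Ω) (hu : u ω = u ω') (hY : ∀ i < n, Y ω i = Y ω' i) :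
    max (τ ω) t ≤ n ↔ max (τ ω') t ≤ n := by
  rw [max_le_iff, max_le_iff, hτ n ω ω' hu hY]

end TruncatedStop

/-- The code obtained by delaying both stopping times to at least `t`. -/
def VLSFCode.delay {𝓧 𝓨₁ 𝓨₂ : Type} [Fintype 𝓧] [Fintype 𝓨₁] [Fintype 𝓨₂]
    {ch : BroadcastChannel 𝓧 𝓨₁ 𝓨₂} {l ε : ℝ} {M : ℕ} (code : VLSFCode ch l M ε) (t : ℕ) :
    VLSFCode ch (max l 0 + t) M ε where
  __ := code
  τ1 ω := max (code.τ1 ω) t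
  τ2 ω := max (code.τ2 ω) t
  g1 := delayedDecoder code.u code.Y1seq code.τ1 t code.g1
  g2 := delayedDecoder code.u code.Y2seq code.τ2 t code.g2
  τ1_stopping := max_stopping code.τ1_stopping t
  τ2_stopping := max_stopping code.τ2_stopping t
  g1_adapted := delayedDecoder_adapted code.g1_adapted t
  g2_adapted := delayedDecoder_adapted code.g2_adapted t
  avg_len := by
    let := code.mΩ
    have := code.hμ
    calc ∫⁻ ω, ((max (max (code.τ1 ω) t) (max (code.τ2 ω) t) : ℕ) : ℝ≥0∞) ∂code.μ
        ≤ ∫⁻ ω, (((max (code.τ1 ω) (code.τ2 ω) : ℕ) : ℝ≥0∞) + t) ∂code.μ := by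
          refine lintegral_mono fun ω => ?_
          have h : max (max (code.τ1 ω) t) (max (code.τ2 ω) t)
              ≤ max (code.τ1 ω) (code.τ2 ω) + t := by omega
          exact (Nat.cast_le.2 h).trans_eq (Nat.cast_add _ _)
      _ = ∫⁻ ω, ((max (code.τ1 ω) (code.τ2 ω) : ℕ) : ℝ≥0∞) ∂code.μ + t := by
          rw [lintegral_add_right _ measurable_const]
          simp
      _ ≤ ENNReal.ofReal (max l 0) + ENNReal.ofReal t := by
          rw [ENNReal.ofReal_natCast]
          gcongr
          exact code.avg_len.trans (ENNReal.ofReal_le_ofReal (le_max_left _ _))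
      _ = ENNReal.ofReal (max l 0 + t) :=
          (ENNReal.ofReal_add (le_max_right _ _) t.cast_nonneg).symm
  err1 := by
    simpa only [delayedDecoder_eq code.τ1_stopping] using code.err1
  err2 := by
    simpa only [delayedDecoder_eq code.τ2_stopping] using code.err2

/-- **Property 1: stopping times can be pushed past `t` without loss.**
If there exists an `(l, M, ε)`-VLSF code whose stopping times satisfy
`P[max(τ1, τ2) ≤ t] ≤ α`, then there exists an `(l′, M, ε)`-VLSF code for some `l′ ≥ l`
whose stopping times `τ1′, τ2′` satisfy `P[max(τ1′, τ2′) ≤ t] ≤ α` and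
`τ1′, τ2′ ∈ {t, t+1, t+2, …}` almost surely. -/
theorem vlsf_stopping_times_past_t {𝓧 𝓨₁ 𝓨₂ : Type}
    [Fintype 𝓧] [Fintype 𝓨₁] [Fintype 𝓨₂]
    (ch : BroadcastChannel 𝓧 𝓨₁ 𝓨₂) (l ε : ℝ) (M : ℕ) (t : ℕ) (α : ℝ)
    (hα : α ∈ Set.Icc (0 : ℝ) 1)
    (code : VLSFCode ch l M ε)
    (hcode : code.μ {ω | max (code.τ1 ω) (code.τ2 ω) ≤ t} ≤ ENNReal.ofReal α) :
    ∃ l' ≥ l, ∃ code' : VLSFCode ch l' M ε,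
      code'.μ {ω | max (code'.τ1 ω) (code'.τ2 ω) ≤ t} ≤ ENNReal.ofReal α ∧
      (∀ᵐ ω ∂code'.μ, t ≤ code'.τ1 ω ∧ t ≤ code'.τ2 ω) := by
  refine ⟨max l 0 + t, ?_, code.delay t, ?_, ?_⟩
  · exact (le_max_left l 0).trans (le_add_of_nonneg_right t.cast_nonneg)
  · have h : {ω | max ((code.delay t).τ1 ω) ((code.delay t).τ2 ω) ≤ t}
        = {ω | max (code.τ1 ω) (code.τ2 ω) ≤ t} := by
      ext ω
      change max (max (code.τ1 ω) t) (max (code.τ2 ω) t) ≤ t ↔ max (code.τ1 ω) (code.τ2 ω) ≤ t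
      simp
    rw [h]
    exact hcode
  · exact ae_of_all _ fun ω => ⟨le_max_right _ _, le_max_right _ _⟩
end
end

section
/- (Square-root equation estimate.) Fix x ∈ ℝ, a > 0, b > 0, and λ > 0, and suppose ξ > 0 is a solution of (λ − ξ·a)/√(b·ξ) = x. Then 0 ≤ ξ − (λ/a − x·√(b·λ/a³)) ≤ (b/a²)·x². -/
/-- **Square-root equation estimate** (Property 2 of the paper).
If `x ∈ ℝ`, `a > 0`, `b > 0`, `λ > 0` and `ξ > 0` solves `(λ - ξ·a)/√(b·ξ) = x`, then
`0 ≤ ξ - (λ/a - x·√(b·λ/a³)) ≤ (b/a²)·x²`. -/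
theorem sqrt_equation_estimate (x a b lam ξ : ℝ) (ha : 0 < a) (hb : 0 < b) (hlam : 0 < lam)
    (hξ : 0 < ξ) (hsol : (lam - ξ * a) / Real.sqrt (b * ξ) = x) :
    0 ≤ ξ - (lam / a - x * Real.sqrt (b * lam / a ^ 3)) ∧
      ξ - (lam / a - x * Real.sqrt (b * lam / a ^ 3)) ≤ (b / a ^ 2) * x ^ 2 := by
  obtain ⟨s, hs, rfl⟩ : ∃ s : ℝ, 0 < s ∧ ξ = s ^ 2 :=
    ⟨√ξ, Real.sqrt_pos.2 hξ, (Real.sq_sqrt hξ.le).symm⟩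
  obtain ⟨r, hr, rfl⟩ : ∃ r : ℝ, 0 < r ∧ b = r ^ 2 :=
    ⟨√b, Real.sqrt_pos.2 hb, (Real.sq_sqrt hb.le).symm⟩
  obtain ⟨t, ht, rfl⟩ : ∃ t : ℝ, 0 < t ∧ lam = a * t ^ 2 := by
    refine ⟨√(lam / a), Real.sqrt_pos.2 (by positivity), ?_⟩
    rw [Real.sq_sqrt (by positivity)]
    field_simp
  have h₁ : √(r ^ 2 * s ^ 2) = r * s := by
    rw [← mul_pow, Real.sqrt_sq (by positivity)]
  have h₂ : √(r ^ 2 * (a * t ^ 2) / a ^ 3) = r * t / a := by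
    rw [show r ^ 2 * (a * t ^ 2) / a ^ 3 = (r * t / a) ^ 2 by field_simp,
      Real.sqrt_sq (by positivity)]
  rw [h₁] at hsol
  rw [h₂, ← hsol]
  have h₃ : s ^ 2 - (a * t ^ 2 / a - (a * t ^ 2 - s ^ 2 * a) / (r * s) * (r * t / a)) =
      (t - s) ^ 2 * (t + s) / s := by
    field_simp
    ring
  have h₄ : r ^ 2 / a ^ 2 * ((a * t ^ 2 - s ^ 2 * a) / (r * s)) ^ 2 =
      (t - s) ^ 2 * (t + s) / s + (t - s) ^ 2 * (t + s) * t / s ^ 2 := by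
    field_simp
    ring
  rw [h₃, h₄]
  exact ⟨by positivity, le_add_of_nonneg_right (by positivity)⟩
end

section
/- (Properties of the function ψ.) Define ψ : ℝ → ℝ by ψ(x) = exp(−x²/2) + x·√(π/2)·(erf(x/√2) − sgn(x)), where sgn(0) = 0. Then: (i) ψ is even; (ii) 0 < ψ(x) ≤ 1 for all x ∈ ℝ, with ψ(0) = 1; (iii) ψ is nonincreasing on [0, ∞) (so ψ is unimodal with its maximum attained at 0); and (iv) ψ(x) → 0 as |x| → ∞. -/
open MeasureTheory Real Filter

noncomputable section

/-- The error function `erf(u) = (2/√π)·∫_0^u e^{−t²} dt`. -/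
def erf (u : ℝ) : ℝ := (2 / Real.sqrt Real.pi) * ∫ t in (0 : ℝ)..u, Real.exp (-t ^ 2)

/-- The function `ψ(x) = exp(−x²/2) + x·√(π/2)·(erf(x/√2) − sgn(x))`, with `sgn 0 = 0`. -/
def psiFun (x : ℝ) : ℝ :=
  Real.exp (-x ^ 2 / 2) + x * Real.sqrt (Real.pi / 2) * (erf (x / Real.sqrt 2) - Real.sign x)

theorem erf_neg (u : ℝ) : erf (-u) = -erf u := by
  have h := intervalIntegral.integral_comp_neg (a := 0) (b := u) (fun t : ℝ => Real.exp (-t ^ 2))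
  simp only [neg_sq, neg_zero] at h
  rw [erf, erf, intervalIntegral.integral_symm, ← h]
  ring

theorem hasDerivAt_erf (u : ℝ) :
    HasDerivAt erf (2 / Real.sqrt Real.pi * Real.exp (-u ^ 2)) u := by
  have hc : Continuous fun t : ℝ => Real.exp (-t ^ 2) := by fun_prop
  exact (hc.integral_hasStrictDerivAt 0 u).hasDerivAt.const_mul _

theorem strictMono_erf : StrictMono erf :=
  strictMono_of_deriv_pos fun u => by
    rw [(hasDerivAt_erf u).deriv]
    positivity

theorem tendsto_erf_atTop : Tendsto erf atTop (nhds 1) := by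
  have hi : IntegrableOn (fun t : ℝ => Real.exp (-t ^ 2)) (Set.Ioi 0) := by
    simpa using (integrable_exp_neg_mul_sq (b := 1) one_pos).integrableOn
  have hv : ∫ t in Set.Ioi (0 : ℝ), Real.exp (-t ^ 2) = Real.sqrt Real.pi / 2 := by
    simpa using integral_gaussian_Ioi 1
  have h := (intervalIntegral_tendsto_integral_Ioi 0 hi tendsto_id).const_mul
    (2 / Real.sqrt Real.pi)
  rw [hv] at h
  have hpi : Real.sqrt Real.pi ≠ 0 := by positivity
  convert! h using 2
  field_simp

theorem erf_lt_one (u : ℝ) : erf u < 1 :=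
  (strictMono_erf (lt_add_one u)).trans_le
    (strictMono_erf.monotone.ge_of_tendsto tendsto_erf_atTop (u + 1))

theorem tendsto_exp_neg_sq_atTop : Tendsto (fun u : ℝ => Real.exp (-u ^ 2)) atTop (nhds 0) :=
  Real.tendsto_exp_neg_atTop_nhds_zero.comp (tendsto_pow_atTop two_ne_zero)

/-- The Mills ratio bound for the complementary error function. -/
theorem sqrt_pi_mul_one_sub_erf_lt {u : ℝ} (hu : 0 < u) :
    Real.sqrt Real.pi * (1 - erf u) < Real.exp (-u ^ 2) / u := by
  set q : ℝ → ℝ := fun v => Real.sqrt Real.pi * (1 - erf v) - Real.exp (-v ^ 2) / v with hq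
  have hd : ∀ v : ℝ, 0 < v → HasDerivAt q (Real.exp (-v ^ 2) / v ^ 2) v := by
    intro v hv
    have he : HasDerivAt (fun v : ℝ => Real.exp (-v ^ 2)) (Real.exp (-v ^ 2) * -(2 * v)) v := by
      simpa using ((hasDerivAt_pow 2 v).neg).exp
    refine ((((hasDerivAt_erf v).const_sub 1).const_mul (Real.sqrt Real.pi)).sub
      (he.div (hasDerivAt_id v) hv.ne')).congr_deriv ?_
    have hpi : Real.sqrt Real.pi ≠ 0 := by positivity
    simp only [id]
    field_simp
    ring
  have hmono : StrictMonoOn q (Set.Ioi 0) := by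
    refine strictMonoOn_of_deriv_pos (convex_Ioi 0)
      (fun v hv => (hd v hv).continuousAt.continuousWithinAt) fun v hv => ?_
    rw [interior_Ioi] at hv
    have hv : 0 < v := hv
    rw [(hd v hv).deriv]
    positivity
  have hlim : Tendsto q atTop (nhds 0) := by
    simpa [hq, div_eq_mul_inv] using
      ((tendsto_erf_atTop.const_sub 1).const_mul (Real.sqrt Real.pi)).sub
        (tendsto_exp_neg_sq_atTop.mul tendsto_inv_atTop_zero)
  have hle : q (u + 1) ≤ 0 := by
    refine ge_of_tendsto hlim ?_
    filter_upwards [eventually_ge_atTop (u + 1)] with v hv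
    exact hmono.monotoneOn (Set.mem_Ioi.2 (by linarith)) (Set.mem_Ioi.2 (by linarith)) hv
  have hlt : q u < q (u + 1) := hmono hu (Set.mem_Ioi.2 (by linarith)) (lt_add_one u)
  have := hlt.trans_le hle
  simp only [hq] at this
  linarith

/-- The function `u ↦ ψ(√2 u)` on the half-line `u ≥ 0`, extended smoothly to `ℝ`. -/
def psiAux (u : ℝ) : ℝ := Real.exp (-u ^ 2) - u * (Real.sqrt Real.pi * (1 - erf u))

theorem antitone_psiAux : Antitone psiAux := by
  have hd : ∀ u : ℝ, HasDerivAt psiAux (-(Real.sqrt Real.pi * (1 - erf u))) u := by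
    intro u
    have he : HasDerivAt (fun v : ℝ => Real.exp (-v ^ 2)) (Real.exp (-u ^ 2) * -(2 * u)) u := by
      simpa using ((hasDerivAt_pow 2 u).neg).exp
    refine (he.sub ((hasDerivAt_id u).mul
      (((hasDerivAt_erf u).const_sub 1).const_mul (Real.sqrt Real.pi)))).congr_deriv ?_
    have hpi : Real.sqrt Real.pi ≠ 0 := by positivity
    simp only [id]
    field_simp
    ring
  refine antitone_of_deriv_nonpos (fun u => (hd u).differentiableAt) fun u => ?_
  rw [(hd u).deriv]
  have := sub_pos.2 (erf_lt_one u)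
  exact neg_nonpos.2 (by positivity)

theorem psiAux_zero : psiAux 0 = 1 := by simp [psiAux]

theorem psiAux_pos {u : ℝ} (hu : 0 ≤ u) : 0 < psiAux u := by
  rcases hu.eq_or_lt with rfl | hu
  · simp [psiAux_zero]
  · have h := (lt_div_iff₀ hu).1 (sqrt_pi_mul_one_sub_erf_lt hu)
    rw [psiAux]
    linarith

theorem tendsto_psiAux_atTop : Tendsto psiAux atTop (nhds 0) := by
  refine tendsto_of_tendsto_of_tendsto_of_le_of_le' tendsto_const_nhds tendsto_exp_neg_sq_atTop ?_ ?_
  · filter_upwards [eventually_ge_atTop 0] with u hu using (psiAux_pos hu).le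
  · filter_upwards [eventually_ge_atTop 0] with u hu
    have := sub_pos.2 (erf_lt_one u)
    exact sub_le_self _ (by positivity)

theorem psiFun_eq_psiAux {x : ℝ} (hx : 0 ≤ x) : psiFun x = psiAux (x / Real.sqrt 2) := by
  rcases hx.eq_or_lt with rfl | hx
  · simp [psiFun, psiAux]
  · rw [psiFun, psiAux, Real.sign_of_pos hx, div_pow, Real.sq_sqrt zero_le_two,
      Real.sqrt_div Real.pi_pos.le, neg_div]
    ring

theorem psiFun_neg (x : ℝ) : psiFun (-x) = psiFun x := by
  rw [psiFun, psiFun, neg_div (Real.sqrt 2) x, erf_neg, Real.sign_neg, neg_sq]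
  ring

theorem psiFun_eq_psiAux_abs (x : ℝ) : psiFun x = psiAux (|x| / Real.sqrt 2) := by
  rw [← psiFun_eq_psiAux (abs_nonneg x)]
  rcases abs_choice x with h | h <;> rw [h]
  rw [psiFun_neg]

/-- **Properties of the function `ψ`.**
(i) `ψ` is even; (ii) `0 < ψ(x) ≤ 1` for all `x`, with `ψ(0) = 1`; (iii) `ψ` is
nonincreasing on `[0, ∞)` (so `ψ` is unimodal with its maximum attained at `0`);
(iv) `ψ(x) → 0` as `|x| → ∞`. -/
theorem psiFun_properties :
    (∀ x : ℝ, psiFun (-x) = psiFun x) ∧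
    (∀ x : ℝ, 0 < psiFun x ∧ psiFun x ≤ 1) ∧
    psiFun 0 = 1 ∧
    AntitoneOn psiFun (Set.Ici (0 : ℝ)) ∧
    Tendsto psiFun atTop (nhds 0) ∧ Tendsto psiFun atBot (nhds 0) := by
  have hs : 0 < Real.sqrt 2 := by positivity
  have htop : Tendsto psiFun atTop (nhds 0) := by
    refine (tendsto_psiAux_atTop.comp (tendsto_id.atTop_div_const hs)).congr' ?_
    filter_upwards [eventually_ge_atTop 0] with x hx using (psiFun_eq_psiAux hx).symm
  refine ⟨psiFun_neg, fun x => ?_, ?_, ?_, htop, ?_⟩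
  · have hx : 0 ≤ |x| / Real.sqrt 2 := by positivity
    rw [psiFun_eq_psiAux_abs]
    exact ⟨psiAux_pos hx, psiAux_zero ▸ antitone_psiAux hx⟩
  · simp [psiFun]
  · intro x hx y hy hxy
    rw [psiFun_eq_psiAux hx, psiFun_eq_psiAux hy]
    exact antitone_psiAux (by gcongr)
  · exact (htop.comp tendsto_neg_atBot_atTop).congr psiFun_neg
end
end

section
/- (Transfer of a nonuniform CDF bound to mean absolute deviation.) Let Y be a real random variable with cumulative distribution function F, and let s > 0 and A ≥ 0 be such that |F(t) − Φ(t)| ≤ A/(1 + t²) for all t ∈ ℝ. Then for every a ∈ ℝ, E[|a − s·Y|] ≤ √(2/π)·s·ψ(a/s) + |a| + π·s·A, where ψ(x) = exp(−x²/2) + x·√(π/2)·(erf(x/√2) − sgn(x)) with sgn(0) = 0. -/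
open MeasureTheory Real

noncomputable section

/-- The standard normal cumulative distribution function `Φ`. -/
def stdGaussianCDF (x : ℝ) : ℝ := ∫ t in Set.Iic x, stdGaussianPDF t

open ProbabilityTheory Filter Topology Set

/-- Layer-cake formula for the mean absolute deviation from `x`. -/
lemma lintegral_abs_sub_eq (P : Measure ℝ) [SFinite P] (x : ℝ) :
    ∫⁻ y, ENNReal.ofReal |x - y| ∂P = ∫⁻ t, if t < x then P (Iic t) else P (Ioi t) := by
  have hS : MeasurableSet {p : ℝ × ℝ | min x p.1 ≤ p.2 ∧ p.2 < max x p.1} :=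
    (measurableSet_le (measurable_const.min measurable_fst) measurable_snd).inter
      (measurableSet_lt measurable_snd (measurable_const.max measurable_fst))
  have h := (Measure.prod_apply (μ := P) (ν := volume) hS).symm.trans
    (Measure.prod_apply_symm hS)
  convert h using 3 with y t
  · have : Prod.mk y ⁻¹' {p : ℝ × ℝ | min x p.1 ≤ p.2 ∧ p.2 < max x p.1}
        = Ico (min x y) (max x y) := rfl
    rw [this, Real.volume_Ico, max_sub_min_eq_abs, abs_sub_comm]
  · split_ifs with htx
    · congr 1
      ext y
      simp [htx, htx.not_ge]
    · congr 1
      ext y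
      simp [htx, not_lt.mp htx]

lemma stdGaussianPDF_eq_gaussianPDFReal : stdGaussianPDF = gaussianPDFReal 0 1 := by
  ext x
  simp [stdGaussianPDF, gaussianPDFReal, div_eq_inv_mul]

lemma integrable_stdGaussianPDF : Integrable stdGaussianPDF :=
  stdGaussianPDF_eq_gaussianPDFReal ▸ integrable_gaussianPDFReal 0 1

lemma measureReal_gaussianReal_Iic (t : ℝ) :
    (gaussianReal 0 1).real (Iic t) = stdGaussianCDF t := by
  rw [measureReal_def, gaussianReal_apply_eq_integral 0 one_ne_zero, ENNReal.toReal_ofReal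
    (integral_nonneg fun _ => gaussianPDFReal_nonneg _ _ _), stdGaussianCDF,
    stdGaussianPDF_eq_gaussianPDFReal]

lemma integrable_mul_stdGaussianPDF : Integrable fun z => z * stdGaussianPDF z := by
  refine ((integrable_mul_exp_neg_mul_sq (b := 1 / 2) (by norm_num)).div_const
    (√(2 * π))).congr (.of_forall fun z => ?_)
  simp only [stdGaussianPDF, mul_div_assoc]
  ring_nf

lemma hasDerivAt_neg_stdGaussianPDF (z : ℝ) :
    HasDerivAt (fun z => -stdGaussianPDF z) (z * stdGaussianPDF z) z := by
  have h := ((((hasDerivAt_pow 2 z).neg.div_const 2).exp).div_const (√(2 * π))).neg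
  refine h.congr_deriv ?_
  simp only [stdGaussianPDF, Pi.neg_apply]
  push_cast
  ring

lemma tendsto_stdGaussianPDF_cocompact : Tendsto stdGaussianPDF (cocompact ℝ) (𝓝 0) := by
  have h := (tendsto_rpow_abs_mul_exp_neg_mul_sq_cocompact (a := 1 / 2) (by norm_num) 0).div_const
    (√(2 * π))
  rw [zero_div] at h
  refine h.congr fun z => ?_
  simp only [stdGaussianPDF, rpow_zero, one_mul]
  ring_nf

lemma integral_Iic_mul_stdGaussianPDF (x : ℝ) :
    ∫ z in Iic x, z * stdGaussianPDF z = -stdGaussianPDF x := by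
  have h := (tendsto_stdGaussianPDF_cocompact.mono_left atBot_le_cocompact).neg
  rw [integral_Iic_of_hasDerivAt_of_tendsto' (fun z _ => hasDerivAt_neg_stdGaussianPDF z)
    integrable_mul_stdGaussianPDF.integrableOn h]
  simp

lemma integral_Ioi_mul_stdGaussianPDF (x : ℝ) :
    ∫ z in Ioi x, z * stdGaussianPDF z = stdGaussianPDF x := by
  have h := (tendsto_stdGaussianPDF_cocompact.mono_left atTop_le_cocompact).neg
  rw [integral_Ioi_of_hasDerivAt_of_tendsto' (fun z _ => hasDerivAt_neg_stdGaussianPDF z)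
    integrable_mul_stdGaussianPDF.integrableOn h]
  simp

lemma stdGaussianCDF_add_integral_Ioi (x : ℝ) :
    stdGaussianCDF x + ∫ z in Ioi x, stdGaussianPDF z = 1 := by
  rw [stdGaussianCDF, intervalIntegral.integral_Iic_add_Ioi integrable_stdGaussianPDF.integrableOn
    integrable_stdGaussianPDF.integrableOn, stdGaussianPDF_eq_gaussianPDFReal,
    integral_gaussianPDFReal_eq_one 0 one_ne_zero]

lemma stdGaussianCDF_zero : stdGaussianCDF 0 = 1 / 2 := by
  have h := stdGaussianCDF_add_integral_Ioi 0
  have h' := integral_comp_neg_Iic 0 stdGaussianPDF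
  have heven : ∀ z, stdGaussianPDF (-z) = stdGaussianPDF z := fun z => by simp [stdGaussianPDF]
  simp only [heven, neg_zero] at h'
  rw [← h', ← stdGaussianCDF] at h
  linarith

lemma two_mul_stdGaussianCDF_sub_one (x : ℝ) : 2 * stdGaussianCDF x - 1 = erf (x / √2) := by
  have h : stdGaussianCDF x - stdGaussianCDF 0 = ∫ z in (0 : ℝ)..x, stdGaussianPDF z :=
    intervalIntegral.integral_Iic_sub_Iic integrable_stdGaussianPDF.integrableOn
      integrable_stdGaussianPDF.integrableOn
  have h2 : (√2 : ℝ) ≠ 0 := by positivity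
  have hc := intervalIntegral.integral_comp_div (a := 0) (b := x)
    (fun t => Real.exp (-t ^ 2)) h2
  have hφ : ∀ z, stdGaussianPDF z = Real.exp (-(z / √2) ^ 2) / √(2 * π) := fun z => by
    rw [stdGaussianPDF, div_pow, Real.sq_sqrt zero_le_two, neg_div]
  simp only [hφ, intervalIntegral.integral_div, hc, zero_div, smul_eq_mul] at h
  rw [stdGaussianCDF_zero, Real.sqrt_mul zero_le_two] at h
  have hπ : √π ≠ 0 := by positivity
  rw [erf, ← sub_eq_zero]
  field_simp at h ⊢
  linarith

/-- The mean absolute deviation of a standard normal variable from `x`. -/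
lemma integral_abs_sub_gaussianReal (x : ℝ) :
    ∫ z, |x - z| ∂(gaussianReal 0 1) = x * erf (x / √2) + 2 * stdGaussianPDF x := by
  have hi : Integrable fun z => x * stdGaussianPDF z - z * stdGaussianPDF z :=
    (integrable_stdGaussianPDF.const_mul x).sub integrable_mul_stdGaussianPDF
  have hl : EqOn (fun z => stdGaussianPDF z * |x - z|)
      (fun z => x * stdGaussianPDF z - z * stdGaussianPDF z) (Iic x) := fun z hz => by
    simp only [abs_of_nonneg (sub_nonneg.2 (mem_Iic.1 hz))]
    ring
  have hr : EqOn (fun z => stdGaussianPDF z * |x - z|)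
      (fun z => -(x * stdGaussianPDF z - z * stdGaussianPDF z)) (Ioi x) := fun z hz => by
    simp only [abs_of_neg (sub_neg.2 (mem_Ioi.1 hz))]
    ring
  have hs : ∀ s, ∫ z in s, (x * stdGaussianPDF z - z * stdGaussianPDF z)
      = x * (∫ z in s, stdGaussianPDF z) - ∫ z in s, z * stdGaussianPDF z := fun s => by
    rw [integral_sub (integrable_stdGaussianPDF.const_mul x).restrict
      integrable_mul_stdGaussianPDF.restrict, integral_const_mul]
  simp only [integral_gaussianReal_eq_integral_smul one_ne_zero, smul_eq_mul,
    ← stdGaussianPDF_eq_gaussianPDFReal]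
  rw [← intervalIntegral.integral_Iic_add_Ioi (b := x)
      (hi.integrableOn.congr_fun hl.symm measurableSet_Iic)
      (hi.neg.integrableOn.congr_fun hr.symm measurableSet_Ioi),
    setIntegral_congr_fun measurableSet_Iic hl, setIntegral_congr_fun measurableSet_Ioi hr,
    integral_neg, hs, hs, integral_Iic_mul_stdGaussianPDF, integral_Ioi_mul_stdGaussianPDF,
    ← two_mul_stdGaussianCDF_sub_one, ← stdGaussianCDF,
    ← eq_sub_iff_add_eq'.2 (stdGaussianCDF_add_integral_Ioi x) |>.symm]
  ring

lemma sqrt_mul_psiFun_add_abs (x : ℝ) :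
    √(2 / π) * psiFun x + |x| = x * erf (x / √2) + 2 * stdGaussianPDF x := by
  have h1 : √(2 / π) * √(π / 2) = 1 := by
    rw [← Real.sqrt_mul (by positivity), div_mul_div_cancel₀ pi_ne_zero, div_self two_ne_zero,
      Real.sqrt_one]
  have h2 : √(2 / π) = 2 / √(2 * π) := by
    rw [Real.sqrt_div zero_le_two, Real.sqrt_mul zero_le_two]
    have := Real.sq_sqrt (zero_le_two (α := ℝ))
    field_simp
    exact this
  have h3 : x * Real.sign x = |x| := by
    rcases lt_trichotomy x 0 with h | rfl | h
    · rw [Real.sign_of_neg h, abs_of_neg h]; ring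
    · simp
    · rw [Real.sign_of_pos h, abs_of_pos h]; ring
  rw [psiFun, stdGaussianPDF]
  linear_combination (x * (erf (x / √2) - Real.sign x)) * h1 + Real.exp (-x ^ 2 / 2) * h2 - h3

/-- A nonuniform bound on the difference of two distribution functions transfers to the mean
absolute deviations from `x`. -/
lemma lintegral_abs_sub_le_of_cdf_bound (P Q : Measure ℝ) [IsProbabilityMeasure P]
    [IsProbabilityMeasure Q] {A : ℝ} (hA : 0 ≤ A)
    (h : ∀ t, |P.real (Iic t) - Q.real (Iic t)| ≤ A / (1 + t ^ 2)) (x : ℝ) :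
    ∫⁻ y, ENNReal.ofReal |x - y| ∂P
      ≤ ∫⁻ y, ENNReal.ofReal |x - y| ∂Q + ENNReal.ofReal (π * A) := by
  have hA' : ∫⁻ t : ℝ, ENNReal.ofReal (A / (1 + t ^ 2)) = ENNReal.ofReal (π * A) := by
    simp only [div_eq_mul_inv]
    rw [← ofReal_integral_eq_lintegral_ofReal (integrable_inv_one_add_sq.const_mul A)
      (.of_forall fun t => by positivity), integral_const_mul, integral_univ_inv_one_add_sq,
      mul_comm]
  have hle : ∀ (s : Set ℝ) (b : ℝ), P.real s ≤ Q.real s + b →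
      P s ≤ Q s + ENNReal.ofReal b := fun s b hs => by
    rw [← ofReal_measureReal (μ := P), ← ofReal_measureReal (μ := Q)]
    exact (ENNReal.ofReal_le_ofReal hs).trans ENNReal.ofReal_add_le
  have hIoi : ∀ (R : Measure ℝ) [IsProbabilityMeasure R] (t : ℝ),
      R.real (Ioi t) = 1 - R.real (Iic t) := fun R _ t => by
    rw [← compl_Iic, probReal_compl_eq_one_sub measurableSet_Iic]
  rw [lintegral_abs_sub_eq, lintegral_abs_sub_eq, ← hA', ← lintegral_add_right _ (by fun_prop)]
  refine lintegral_mono fun t => ?_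
  have ht := abs_le.1 (h t)
  dsimp only
  split_ifs
  · exact hle _ _ (by linarith)
  · exact hle _ _ (by rw [hIoi, hIoi]; linarith)

/-- **Transfer of a nonuniform CDF bound to mean absolute deviation.**
If `Y` is a real random variable whose cumulative distribution function `F` satisfies
`|F(t) − Φ(t)| ≤ A/(1 + t²)` for all `t`, `s > 0` and `A ≥ 0`, then for every `a ∈ ℝ`,
`E[|a − s·Y|] ≤ √(2/π)·s·ψ(a/s) + |a| + π·s·A`. -/
theorem cdf_bound_to_mean_abs_deviation {Ω : Type*} [MeasurableSpace Ω]
    (μ : Measure Ω) [IsProbabilityMeasure μ] (Y : Ω → ℝ) (hY : Measurable Y)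
    (s A : ℝ) (hs : 0 < s) (hA : 0 ≤ A)
    (hF : ∀ t : ℝ, |(μ {ω | Y ω ≤ t}).toReal - stdGaussianCDF t| ≤ A / (1 + t ^ 2))
    (a : ℝ) :
    (∫ ω, |a - s * Y ω| ∂μ)
      ≤ Real.sqrt (2 / Real.pi) * s * psiFun (a / s) + |a| + Real.pi * s * A := by
  have : IsProbabilityMeasure (μ.map Y) := Measure.isProbabilityMeasure_map hY.aemeasurable
  have hG : ∫⁻ z, ENNReal.ofReal |a / s - z| ∂(gaussianReal 0 1)
      = ENNReal.ofReal (√(2 / π) * psiFun (a / s) + |a / s|) := by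
    rw [sqrt_mul_psiFun_add_abs, ← integral_abs_sub_gaussianReal,
      ofReal_integral_eq_lintegral_ofReal _ (.of_forall fun _ => abs_nonneg _)]
    exact ((integrable_const _).sub ((memLp_id_gaussianReal 1).integrable le_rfl)).abs
  have hnn : 0 ≤ √(2 / π) * psiFun (a / s) + |a / s| := by
    rw [sqrt_mul_psiFun_add_abs, ← integral_abs_sub_gaussianReal]
    exact integral_nonneg fun _ => abs_nonneg _
  have hb := lintegral_abs_sub_le_of_cdf_bound (μ.map Y) (gaussianReal 0 1) hA (fun t => by
    rw [measureReal_gaussianReal_Iic, measureReal_def, Measure.map_apply hY measurableSet_Iic]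
    exact hF t) (a / s)
  rw [hG, ← ENNReal.ofReal_add hnn (by positivity), lintegral_map (by fun_prop) hY] at hb
  have hle : ∫ ω, |a / s - Y ω| ∂μ ≤ √(2 / π) * psiFun (a / s) + |a / s| + π * A := by
    rw [integral_eq_lintegral_of_nonneg_ae (.of_forall fun _ => abs_nonneg _)
      (by fun_prop)]
    exact ENNReal.toReal_le_of_le_ofReal (by positivity) hb
  have hscale : ∀ ω, |a - s * Y ω| = s * |a / s - Y ω| := fun ω => by
    rw [← abs_of_pos hs, ← abs_mul, abs_of_pos hs, mul_sub, mul_div_cancel₀ _ hs.ne']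
  have habs : s * |a / s| = |a| := by
    rw [abs_div, abs_of_pos hs, mul_div_cancel₀ _ hs.ne']
  simp only [hscale, integral_const_mul]
  calc s * ∫ ω, |a / s - Y ω| ∂μ
      ≤ s * (√(2 / π) * psiFun (a / s) + |a / s| + π * A) := by gcongr
    _ = _ := by rw [← habs]; ring
end
end
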